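/- Let G = SL_r, P a parabolic with Levi L. As a G-module, the coordinate ring ℂ[O_𝔭] of the closure of the Richardson nilpotent orbit associated to P decomposes so that the multiplicity of every irreducible finite-dimensional G-module W in ℂ[O_𝔭] equals dim W^L, the dimension of the space of L-invariant vectors in W. -/

import Mathlib

namespace Richardson

open RingTheory.Sequence IsLocalRing CategoryTheory Abelian
open scoped Pointwise

/-- There is a chain of primes of length `t` starting at `P`. -/
def HasChain {R : Type*} [CommRing R] : ℕ → PrimeSpectrum R → Prop
  | 0, _ => True
  | t + 1, P => ∃ Q : PrimeSpectrum R, P < Q ∧ HasChain t Q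

lemma HasChain.mono {R : Type*} [CommRing R] {s t : ℕ} (hst : s ≤ t) {P : PrimeSpectrum R}
    (h : HasChain t P) : HasChain s P := by
  induction s generalizing t P with
  | zero => trivial
  | succ s ih =>
    obtain _ | t := t
    · omega
    · obtain ⟨Q, hPQ, hQ⟩ := h
      exact ⟨Q, hPQ, ih (by omega) hQ⟩

lemma HasChain.of_lt {R : Type*} [CommRing R] {t : ℕ} {P Q : PrimeSpectrum R}
    (hPQ : P ≤ Q) (h : HasChain t Q) : HasChain t P := by
  obtain _ | t := t
  · trivial
  · obtain ⟨Q', h1, h2⟩ := h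
    exact ⟨Q', lt_of_le_of_lt hPQ h1, h2⟩

lemma HasChain.comap {R S : Type*} [CommRing R] [CommRing S] (f : R →+* S)
    (hf : Function.Injective (PrimeSpectrum.comap f)) {t : ℕ} {P : PrimeSpectrum S}
    (h : HasChain t P) : HasChain t (PrimeSpectrum.comap f P) := by
  induction t generalizing P with
  | zero => trivial
  | succ t ih =>
    obtain ⟨Q, hPQ, hQ⟩ := h
    refine ⟨PrimeSpectrum.comap f Q, ?_, ih hQ⟩
    exact lt_of_le_of_ne (Ideal.comap_mono hPQ.le) fun e => hPQ.ne (hf e)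

universe u

variable {R : Type u} [CommRing R] [IsLocalRing R] [IsNoetherianRing R]

/-- `M` admits a regular sequence of length `t` in the maximal ideal. -/
def DepthGE (M : Type u) [AddCommGroup M] [Module R M] (t : ℕ) : Prop :=
  ∃ rs : List R, rs.length = t ∧ (∀ r ∈ rs, r ∈ maximalIdeal R) ∧ IsRegular M rs

omit [IsNoetherianRing R] in
lemma maximalIdeal_smul_lt (M : Type u) [AddCommGroup M] [Module R M] [Module.Finite R M]
    [Nontrivial M] : maximalIdeal R • (⊤ : Submodule R M) < ⊤ := by
  refine lt_top_iff_ne_top.mpr fun h => ?_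
  have := Submodule.eq_bot_of_le_smul_of_le_jacobson_bot (maximalIdeal R) (⊤ : Submodule R M)
    Module.Finite.fg_top h.ge (IsLocalRing.maximalIdeal_le_jacobson _)
  exact (bot_ne_top (α := Submodule R M)) this.symm

lemma DepthGE.quotSMulTop {M : Type u} [AddCommGroup M] [Module R M] [Module.Finite R M]
    [Nontrivial M] {t : ℕ} (h : DepthGE (R := R) M (t + 1)) {x : R} (hx : x ∈ maximalIdeal R)
    (hreg : IsSMulRegular M x) : DepthGE (R := R) (QuotSMulTop x M) t := by
  have hnt : Nontrivial (QuotSMulTop x M) := nontrivial_quotSMulTop_of_mem_maximalIdeal M hx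
  have h1 := (ModuleCat.exists_isRegular_tfae (maximalIdeal R) (t + 1) (ModuleCat.of R M)
    (maximalIdeal_smul_lt M)).out 3 1
  have h2 := (ModuleCat.exists_isRegular_tfae (maximalIdeal R) t
    (ModuleCat.of R (QuotSMulTop x M)) (maximalIdeal_smul_lt (QuotSMulTop x M))).out 1 3
  refine h2.1 fun i hi => ?_
  have h3 := h1.1 h
  have zero1 := AddCommGrpCat.isZero_of_iff_subsingleton.mpr (h3 i (by omega))
  have zero2 := AddCommGrpCat.isZero_of_iff_subsingleton.mpr (h3 (i + 1) (by omega))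
  have hreg' : IsSMulRegular (ModuleCat.of R M) x := hreg
  exact AddCommGrpCat.subsingleton_of_isZero <| ShortComplex.Exact.isZero_of_both_zeros
        ((Ext.covariant_sequence_exact₃' _ hreg'.smulShortComplex_shortExact) i (i + 1) rfl)
        (zero1.eq_zero_of_src _) (zero2.eq_zero_of_tgt _)


lemma exists_prime_kills_quot {M : Type u} [AddCommGroup M] [Module R M] [Module.Finite R M]
    {x : R} (hx : x ∈ maximalIdeal R) (hreg : IsSMulRegular M x) {P : PrimeSpectrum R}
    (hP : ∃ m : M, m ≠ 0 ∧ ∀ a ∈ P.asIdeal, a • m = 0) :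
    ∃ Q : PrimeSpectrum R, P < Q ∧
      ∃ m : QuotSMulTop x M, m ≠ 0 ∧ ∀ a ∈ Q.asIdeal, a • m = 0 := by
  let N : Submodule R M := Submodule.torsionBySet R M (P.asIdeal : Set R)
  have hmemN : ∀ m : M, m ∈ N ↔ ∀ a ∈ P.asIdeal, a • m = 0 := by
    intro m
    simp [N, Submodule.mem_torsionBySet_iff]
  have hN : N ≠ ⊥ := by
    obtain ⟨m, hm0, hm⟩ := hP
    intro h
    exact hm0 ((Submodule.mem_bot R).1 (h ▸ (hmemN m).2 hm))
  have hnot : ∃ n ∈ N, (n : M) ∉ x • (⊤ : Submodule R M) := by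
    by_contra! hcon
    apply hN
    refine Submodule.eq_bot_of_le_smul_of_le_jacobson_bot (maximalIdeal R) N
      (IsNoetherian.noetherian N) ?_ (IsLocalRing.maximalIdeal_le_jacobson _)
    intro n hn
    obtain ⟨y, -, hy⟩ := (Submodule.mem_smul_pointwise_iff_exists _ _ _).1 (hcon n hn)
    rw [← hy]
    refine Submodule.smul_mem_smul hx ((hmemN y).2 fun a ha => ?_)
    apply hreg
    have := (hmemN n).1 hn a ha
    rw [← hy, smul_comm] at this
    simpa using this
  obtain ⟨n, hnN, hn⟩ := hnot
  let nb : QuotSMulTop x M := Submodule.Quotient.mk n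
  have hnb : nb ≠ 0 := fun h => hn ((Submodule.Quotient.mk_eq_zero _).1 h)
  obtain ⟨Q, hQass, hQ⟩ := exists_le_isAssociatedPrime_of_isNoetherianRing R nb hnb
  obtain ⟨hQp, m', hm'⟩ := isAssociatedPrime_iff.1 hQass
  have hkill : ∀ a, a • nb = 0 → a ∈ Q := fun a ha => hQ (by
    simpa [Submodule.mem_colon_singleton] using ha)
  have hPQ : P.asIdeal ≤ Q := fun a ha => hkill a (by
    have := (hmemN n).1 hnN a ha
    simp only [nb, ← Submodule.Quotient.mk_smul, this, Submodule.Quotient.mk_zero])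
  have hxQ : x ∈ Q := hkill x (by
    simp only [nb, ← Submodule.Quotient.mk_smul]
    exact (Submodule.Quotient.mk_eq_zero _).2 (Submodule.smul_mem_pointwise_smul _ _ _ trivial))
  have hxP : x ∉ P.asIdeal := fun hxP => by
    obtain ⟨m, hm0, hm⟩ := hP
    exact hm0 (hreg (by simpa using hm x hxP))
  have hm'0 : m' ≠ 0 := by
    rintro rfl
    apply hQp.ne_top
    rw [hm', Ideal.eq_top_iff_one]
    simp [Submodule.mem_colon_singleton]
  refine ⟨⟨Q, hQp⟩, lt_of_le_of_ne hPQ fun e => hxP (by rw [e]; exact hxQ), m', hm'0, ?_⟩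
  intro a ha
  have ha' : a ∈ Q := ha
  rw [hm'] at ha'
  simpa [Submodule.mem_colon_singleton] using ha'

lemma DepthGE.hasChain {M : Type u} [AddCommGroup M] [Module R M] [Module.Finite R M] {t : ℕ}
    (h : DepthGE (R := R) M t) {P : PrimeSpectrum R}
    (hP : ∃ m : M, m ≠ 0 ∧ ∀ a ∈ P.asIdeal, a • m = 0) : HasChain t P := by
  induction t generalizing M P with
  | zero => trivial
  | succ t ih =>
    obtain ⟨rs, hlen, hmem, hreg⟩ := h
    match rs with
    | [] => simp at hlen
    | a :: rs =>
      rw [isRegular_cons_iff] at hreg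
      have ha := hmem a (by simp)
      obtain ⟨Q, hPQ, hQ⟩ := exists_prime_kills_quot ha hreg.1 hP
      exact ⟨Q, hPQ, ih ⟨rs, by simpa using hlen, fun r hr => hmem r (by simp [hr]), hreg.2⟩ hQ⟩

/-- In a local ring of depth at least `n`, a sequence cutting the dimension at each step is
regular, and primes killing a nonzero element of the quotient begin long chains. -/
lemma hasChain_of_quot {M : Type u} [AddCommGroup M] [Module R M] [Module.Finite R M]
    [Nontrivial M] {n : ℕ} (h : DepthGE (R := R) M n) (ms : List R) (hlen : ms.length ≤ n)
    (hm : ∀ r ∈ ms, r ∈ maximalIdeal R) (J : Ideal R)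
    (hJ : ∀ a ∈ J, ∀ m : M, a • m = 0)
    (hdim : ∀ l₁ x l₂, ms = l₁ ++ x :: l₂ → ∀ P : PrimeSpectrum R,
      J ⊔ Ideal.ofList (l₁ ++ [x]) ≤ P.asIdeal → ¬ HasChain (n - l₁.length) P)
    {P : PrimeSpectrum R}
    (hP : ∃ m : M ⧸ (Ideal.ofList ms • ⊤ : Submodule R M), m ≠ 0 ∧ ∀ a ∈ P.asIdeal, a • m = 0) :
    HasChain (n - ms.length) P := by
  induction ms generalizing M n J P with
  | nil =>
    refine h.hasChain (M := M) ?_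
    obtain ⟨m, hm0, hm⟩ := hP
    obtain ⟨m, rfl⟩ := Submodule.Quotient.mk_surjective _ m
    refine ⟨m, fun h0 => hm0 (by rw [h0]; rfl), fun a ha => ?_⟩
    have := hm a ha
    rw [← Submodule.Quotient.mk_smul, Submodule.Quotient.mk_eq_zero] at this
    simpa using this
  | cons x ms ih =>
    obtain _ | n := n
    · simp at hlen
    have hx : x ∈ maximalIdeal R := hm x (by simp)
    have hreg : IsSMulRegular M x := by
      by_contra hcon
      have : ∃ m : M, m ≠ 0 ∧ x • m = 0 := by
        by_contra! hall
        refine hcon fun a b hab => ?_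
        by_contra hne
        exact hall (a - b) (sub_ne_zero.2 hne) (by rw [smul_sub, sub_eq_zero]; exact hab)
      obtain ⟨m, hm0, hxm⟩ := this
      obtain ⟨Q, hQass, hQ⟩ := exists_le_isAssociatedPrime_of_isNoetherianRing R m hm0
      obtain ⟨hQp, m', hm'⟩ := isAssociatedPrime_iff.1 hQass
      have hkill : ∀ a, a • m = 0 → a ∈ Q := fun a ha => hQ (by
        simpa [Submodule.mem_colon_singleton] using ha)
      refine hdim [] x ms rfl ⟨Q, hQp⟩ ?_ ?_
      · refine sup_le (fun a ha => hkill a (hJ a ha m)) ?_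
        simp only [List.nil_append, Ideal.ofList_singleton, Ideal.span_singleton_le_iff_mem]
        exact hkill x hxm
      · refine h.hasChain (M := M) ⟨m', ?_, fun a ha => ?_⟩
        · rintro rfl
          apply hQp.ne_top
          rw [hm', Ideal.eq_top_iff_one]
          simp [Submodule.mem_colon_singleton]
        · have ha' : a ∈ Q := ha
          rw [hm'] at ha'
          simpa [Submodule.mem_colon_singleton] using ha'
    have hnt : Nontrivial (QuotSMulTop x M) := nontrivial_quotSMulTop_of_mem_maximalIdeal M hx
    have e := Submodule.quotOfListConsSMulTopEquivQuotSMulTopInner M x ms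
    have := ih (M := QuotSMulTop x M) (n := n) (h.quotSMulTop hx hreg) (by simpa using hlen)
      (fun r hr => hm r (by simp [hr])) (J ⊔ Ideal.span {x}) ?_ ?_ (P := P) ?_
    · simpa using this
    · intro a ha m
      obtain ⟨m, rfl⟩ := Submodule.Quotient.mk_surjective _ m
      obtain ⟨b, hb, c, hc, rfl⟩ := Submodule.mem_sup.1 ha
      obtain ⟨d, rfl⟩ := Ideal.mem_span_singleton'.1 hc
      rw [add_smul, ← Submodule.Quotient.mk_smul, hJ b hb m, Submodule.Quotient.mk_zero, zero_add,
        mul_smul, ← Submodule.Quotient.mk_smul (r := x)]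
      have h0 : (Submodule.Quotient.mk (x • m) : QuotSMulTop x M) = 0 :=
        (Submodule.Quotient.mk_eq_zero _).2
          (Submodule.smul_mem_pointwise_smul m x ⊤ Submodule.mem_top)
      rw [h0, smul_zero]
    · rintro l₁ y l₂ rfl Q hQ
      have := hdim (x :: l₁) y l₂ rfl Q (by
        simpa [Ideal.ofList_cons, sup_assoc] using hQ)
      simpa using this
    · obtain ⟨m, hm0, hm⟩ := hP
      refine ⟨e m, by simpa using hm0, fun a ha => ?_⟩
      rw [← map_smul, hm a ha, map_zero]

end Richardson

namespace Richardson

open RingTheory.Sequence IsLocalRing MvPolynomial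

lemma isWeaklyRegular_X {σ : Type*} [Finite σ] {K : Type*} [CommRing K] (l : List σ)
    (hl : l.Nodup) :
    IsWeaklyRegular (MvPolynomial σ K) (l.map (X : σ → MvPolynomial σ K)) := by
  refine ⟨fun i hi => ?_⟩
  have hspan : (Ideal.ofList ((l.map (X : σ → MvPolynomial σ K)).take i) •
      (⊤ : Submodule (MvPolynomial σ K) (MvPolynomial σ K))) =
      Ideal.span ((X : σ → MvPolynomial σ K) '' {j | j ∈ l.take i}) := by
    rw [smul_eq_mul, Ideal.mul_top, Ideal.ofList]
    congr 1
    ext p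
    simp [← List.map_take]
  intro a b hab
  obtain ⟨a, rfl⟩ := Submodule.Quotient.mk_surjective _ a
  obtain ⟨b, rfl⟩ := Submodule.Quotient.mk_surjective _ b
  simp only [← Submodule.Quotient.mk_smul] at hab
  rw [Submodule.Quotient.eq] at hab ⊢
  rw [hspan] at hab ⊢
  rw [← smul_sub, smul_eq_mul, mem_ideal_span_X_image] at hab
  rw [mem_ideal_span_X_image]
  intro m hm
  have hi' : i < l.length := by simpa using hi
  obtain ⟨j, hj, hmj⟩ := hab (m + Finsupp.single l[i] 1) (by
    rw [mem_support_iff] at hm ⊢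
    rw [List.getElem_map, mul_comm, coeff_mul_X]
    exact hm)
  refine ⟨j, hj, ?_⟩
  have hne : l[i] ≠ j := by
    rintro rfl
    obtain ⟨k, hk, hkk⟩ := List.mem_take_iff_getElem.1 hj
    have := (List.Nodup.getElem_inj_iff hl).1 hkk
    omega
  simpa [Finsupp.single_apply, hne] using hmj

attribute [local instance] MvPolynomial.gradedAlgebra

lemma mem_of_mul_mem_of_constantCoeff {σ : Type*} {K : Type*} [Field K]
    {J : Ideal (MvPolynomial σ K)} (hJ : J.IsHomogeneous (homogeneousSubmodule σ K))
    {e : ℕ} {F u : MvPolynomial σ K} (hF : F.IsHomogeneous e) (hu : constantCoeff u ≠ 0)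
    (h : u * F ∈ J) : F ∈ J := by
  have h1 := hJ (0 + e) h
  rw [DirectSum.coe_decompose_mul_add_of_right_mem _ ((mem_homogeneousSubmodule _ _).2 hF)] at h1
  have h2 : ((DirectSum.decompose (homogeneousSubmodule σ K) u 0 : _) : MvPolynomial σ K) =
      C (constantCoeff u) := by
    refine (decomposition.decompose'_apply u 0).trans ?_
    simp [homogeneousComponent_zero, constantCoeff_eq]
  rw [h2] at h1
  have h3 := J.mul_mem_left (C (constantCoeff u)⁻¹) h1
  rwa [← mul_assoc, ← C_mul, inv_mul_cancel₀ hu, C_1, one_mul] at h3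

theorem exists_hasChain_of_notMem {σ : Type} [Fintype σ] {K : Type} [Field K]
    (ms : List (MvPolynomial σ K)) (hlen : ms.length ≤ Fintype.card σ)
    (hms : ∀ p ∈ ms, ∃ d, 0 < d ∧ p.IsHomogeneous d)
    (hdim : ∀ l₁ x l₂, ms = l₁ ++ x :: l₂ → ∀ P : PrimeSpectrum (MvPolynomial σ K),
      Ideal.ofList (l₁ ++ [x]) ≤ P.asIdeal → ¬ HasChain (Fintype.card σ - l₁.length) P)
    {F : MvPolynomial σ K} {e : ℕ} (hF : F.IsHomogeneous e) (hFm : F ∉ Ideal.ofList ms) :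
    ∃ P : PrimeSpectrum (MvPolynomial σ K), (∀ a, a * F ∈ Ideal.ofList ms → a ∈ P.asIdeal) ∧
      HasChain (Fintype.card σ - ms.length) P := by
  classical
  let S := MvPolynomial σ K
  let 𝔪 : Ideal S := RingHom.ker (constantCoeff : S →+* K)
  have h𝔪 : 𝔪.IsMaximal := RingHom.ker_isMaximal_of_surjective _
    fun c => ⟨C c, constantCoeff_C _ c⟩
  let R := Localization.AtPrime 𝔪
  have hinj : Function.Injective (PrimeSpectrum.comap (algebraMap S R)) :=
    PrimeSpectrum.localization_comap_injective R 𝔪.primeCompl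
  let l : List σ := Finset.univ.toList
  have hdepth : DepthGE (R := R) R (Fintype.card σ) := by
    refine ⟨(l.map (X : σ → S)).map (algebraMap S R), by simp [l], ?_, ?_⟩
    · intro r hr
      simp only [List.mem_map] at hr
      obtain ⟨_, ⟨i, -, rfl⟩, rfl⟩ := hr
      rw [IsLocalization.AtPrime.to_map_mem_maximal_iff R 𝔪]
      exact (RingHom.mem_ker).2 (constantCoeff_X _ i)
    · exact (isWeaklyRegular_X l (Finset.nodup_toList _)).isRegular_of_isLocalization_of_mem R 𝔪
        (by
          intro r hr
          simp only [List.mem_map] at hr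
          obtain ⟨i, -, rfl⟩ := hr
          exact (RingHom.mem_ker).2 (constantCoeff_X _ i))
  have hJhom : (Ideal.ofList ms).IsHomogeneous (homogeneousSubmodule σ K) := by
    refine Ideal.homogeneous_span _ _ fun p hp => ?_
    obtain ⟨d, -, hd⟩ := hms p hp
    exact ⟨d, hd⟩
  have hms𝔪 : ∀ p ∈ ms, p ∈ 𝔪 := fun p hp => by
    obtain ⟨d, hd0, hd⟩ := hms p hp
    rw [RingHom.mem_ker, constantCoeff_eq]
    by_contra hne
    have := hd hne
    simp at this
    omega
  let J' : Ideal R := Ideal.ofList (ms.map (algebraMap S R))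
  have hJ' : J' = (Ideal.ofList ms).map (algebraMap S R) := (Ideal.map_ofList _ _).symm
  have hFJ' : algebraMap S R F ∉ J' := by
    rw [hJ', IsLocalization.algebraMap_mem_map_algebraMap_iff 𝔪.primeCompl]
    rintro ⟨u, hu, huF⟩
    exact hFm (mem_of_mul_mem_of_constantCoeff hJhom hF (fun h => hu h) huF)
  let T : Submodule R R := J' • ⊤
  have hT : ∀ r : R, r ∈ T ↔ r ∈ J' := by
    intro r
    simp [T]
  let fb : R ⧸ T := Submodule.Quotient.mk (algebraMap S R F)
  have hfb : fb ≠ 0 := fun h => hFJ' ((hT _).1 ((Submodule.Quotient.mk_eq_zero _).1 h))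
  obtain ⟨Q, hQass, hQ⟩ := exists_le_isAssociatedPrime_of_isNoetherianRing R fb hfb
  obtain ⟨hQp, m', hm'⟩ := isAssociatedPrime_iff.1 hQass
  have hchain := hasChain_of_quot hdepth (ms.map (algebraMap S R)) (by simpa using hlen) (by
      intro r hr
      obtain ⟨p, hp, rfl⟩ := List.mem_map.1 hr
      rw [IsLocalization.AtPrime.to_map_mem_maximal_iff R 𝔪]
      exact hms𝔪 p hp) ⊥ (by
      intro a ha m
      rw [Ideal.mem_bot.1 ha, zero_smul]) (by
      intro l₁ x l₂ hl P hP hch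
      rw [List.map_eq_append_iff] at hl
      obtain ⟨k₁, k₂, rfl, rfl, hk⟩ := hl
      rw [List.map_eq_cons_iff] at hk
      obtain ⟨y, k₃, rfl, rfl, rfl⟩ := hk
      refine hdim k₁ y k₃ rfl (PrimeSpectrum.comap (algebraMap S R) P) ?_ ?_
      · rw [bot_sup_eq, show List.map (algebraMap S R) k₁ ++ [algebraMap S R y] =
          List.map (algebraMap S R) (k₁ ++ [y]) by simp, ← Ideal.map_ofList] at hP
        exact Ideal.map_le_iff_le_comap.1 hP
      · simpa using hch.comap _ hinj) (P := ⟨Q, hQp⟩) (by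
      refine ⟨m', ?_, fun a ha => ?_⟩
      · rintro rfl
        apply hQp.ne_top
        rw [hm', Ideal.eq_top_iff_one, Submodule.mem_colon_singleton, one_smul]
        exact Submodule.zero_mem _
      · have ha' : a ∈ Q := ha
        rw [hm'] at ha'
        rwa [Submodule.mem_colon_singleton, Submodule.mem_bot] at ha')
  refine ⟨PrimeSpectrum.comap (algebraMap S R) ⟨Q, hQp⟩, fun a ha => ?_, ?_⟩
  · refine hQ ?_
    rw [Submodule.mem_colon_singleton, Submodule.mem_bot]
    change algebraMap S R a • fb = 0
    refine (Submodule.Quotient.mk_eq_zero T (x := algebraMap S R a * algebraMap S R F)).2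
      ((hT _).2 ?_)
    rw [hJ', ← map_mul]
    exact Ideal.mem_map_of_mem _ ha
  · simpa using hchain.comap _ hinj

end Richardson

namespace Richardson

open MvPolynomial KaehlerDifferential

lemma exists_derivation_of_isTranscendenceBasis {k L ι : Type*} [Field k] [CharZero k] [Field L]
    [Algebra k L] {x : ι → L} (hx : IsTranscendenceBasis k x) (c : ι → L) :
    ∃ D : Derivation k L L, ∀ i, D (x i) = c i := by
  let A := MvPolynomial ι k
  let : Algebra A L := (aeval x : A →ₐ[k] L).toAlgebra
  have : IsScalarTower k A L := .of_algebraMap_eq fun r => by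
    simp [RingHom.algebraMap_toAlgebra, A]
  have hinj : Function.Injective (algebraMap A L) := hx.1
  have : FaithfulSMul A L := (faithfulSMul_iff_algebraMap_injective A L).2 hinj
  let : Algebra (FractionRing A) L := FractionRing.liftAlgebra A L
  have : IsScalarTower A (FractionRing A) L := FractionRing.isScalarTower_liftAlgebra A L
  have : CharZero A := charZero_of_injective_algebraMap (algebraMap k A).injective
  have : CharZero (FractionRing A) :=
    charZero_of_injective_algebraMap (IsFractionRing.injective A (FractionRing A))
  have : Algebra.IsAlgebraic A L := by
    have h := hx.isAlgebraic
    refine ⟨fun y => ?_⟩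
    obtain ⟨p, hp0, hp⟩ := h.isAlgebraic y
    refine ⟨p.map (hx.1.aevalEquiv.symm : _ →+* A), ?_, ?_⟩
    · rwa [Ne, Polynomial.map_eq_zero_iff hx.1.aevalEquiv.symm.injective]
    · rw [Polynomial.aeval_def, Polynomial.eval₂_map]
      rw [Polynomial.aeval_def] at hp
      convert hp using 2
      ext a
      obtain ⟨a, rfl⟩ := hx.1.aevalEquiv.surjective a
      simp [RingHom.algebraMap_toAlgebra]
  have : Algebra.IsAlgebraic (FractionRing A) L :=
    (IsFractionRing.comap_isAlgebraic_iff (A := A) (K := FractionRing A) (C := L)).1 inferInstance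
  have := Algebra.FormallyEtale.of_isSeparable (FractionRing A) L
  have : Algebra.FormallyEtale A (FractionRing A) :=
    .of_isLocalization (nonZeroDivisors A)
  have : Algebra.FormallyEtale A L := .comp A (FractionRing A) L
  let d : Derivation k A L := mkDerivation k c
  let l : Ω[L⁄k] →ₗ[L] L := (d.liftKaehlerDifferential.liftBaseChange L) ∘ₗ
    (tensorKaehlerEquivOfFormallyEtale k A L).symm.toLinearMap
  refine ⟨l.compDer (D k L), fun i => ?_⟩
  have hxi : x i = algebraMap A L (X i) := (aeval_X x i).symm
  change l (D k L (x i)) = c i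
  rw [hxi]
  simp only [l, LinearMap.comp_apply, LinearEquiv.coe_coe,
    tensorKaehlerEquivOfFormallyEtale_symm_D_algebraMap]
  simp only [LinearMap.liftBaseChange_tmul, one_smul, Derivation.liftKaehlerDifferential_comp_D]
  exact mkDerivation_X _ _ _

lemma exists_derivation_of_algebraicIndependent {k L ι : Type*} [Field k] [CharZero k] [Field L]
    [Algebra k L] {x : ι → L} (hx : AlgebraicIndependent k x) (c : ι → L) :
    ∃ D : Derivation k L L, ∀ i, D (x i) = c i := by
  obtain ⟨t, hst, ht⟩ := exists_isTranscendenceBasis_superset hx.coe_range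
  classical
  let c' : t → L := fun y => if h : ∃ i, x i = y then c h.choose else 0
  obtain ⟨D, hD⟩ := exists_derivation_of_isTranscendenceBasis ht c'
  refine ⟨D, fun i => ?_⟩
  have h := hD ⟨x i, hst ⟨i, rfl⟩⟩
  have hex : ∃ j, x j = x i := ⟨i, rfl⟩
  simp only [c', hex, dif_pos] at h
  rwa [hx.injective hex.choose_spec] at h

lemma exists_algebraicIndependent_of_hasChain {k S : Type*} [Field k] [CommRing S] [Algebra k S]
    {t : ℕ} {P : PrimeSpectrum S} (h : HasChain t P) :
    ∃ x : Fin t → S, AlgebraicIndependent k fun i => Ideal.Quotient.mk P.asIdeal (x i) := by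
  induction t generalizing P with
  | zero =>
    refine ⟨Fin.elim0, ?_⟩
    have : Nontrivial (S ⧸ P.asIdeal) := Ideal.Quotient.nontrivial_iff.2 P.isPrime.ne_top
    exact algebraicIndependent_empty_type
  | succ t ih =>
    obtain ⟨Q, hPQ, hQ⟩ := h
    obtain ⟨x, hx⟩ := ih hQ
    have hle : P.asIdeal ≤ Q.asIdeal := hPQ.le
    obtain ⟨y, hyQ, hyP⟩ := SetLike.exists_of_lt (show P.asIdeal < Q.asIdeal from hPQ)
    let π : (S ⧸ P.asIdeal) →ₐ[k] S ⧸ Q.asIdeal := Ideal.Quotient.factorₐ k hle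
    let xP : Fin t → S ⧸ P.asIdeal := fun i => Ideal.Quotient.mk P.asIdeal (x i)
    have hxP : AlgebraicIndependent k xP := hx.of_comp π
    let B := Algebra.adjoin k (Set.range xP)
    let yP : S ⧸ P.asIdeal := Ideal.Quotient.mk P.asIdeal y
    have hyP0 : yP ≠ 0 := fun h => hyP (Ideal.Quotient.eq_zero_iff_mem.1 h)
    have hπy : π yP = 0 := Ideal.Quotient.eq_zero_iff_mem.2 hyQ
    have htr : Transcendental B yP := by
      rintro ⟨p, hp0, hp⟩
      obtain ⟨q, hpq, hq⟩ := Polynomial.exists_eq_pow_rootMultiplicity_mul_and_not_dvd p hp0 0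
      rw [Polynomial.dvd_iff_isRoot, Polynomial.IsRoot.def, ← Polynomial.coeff_zero_eq_eval_zero]
        at hq
      rw [hpq, map_mul, map_pow, map_sub, Polynomial.aeval_X, Polynomial.aeval_C, map_zero,
        sub_zero] at hp
      have hq0 := (mul_eq_zero.1 hp).resolve_left (pow_ne_zero _ hyP0)
      rw [← Polynomial.divX_mul_X_add q, map_add, map_mul, Polynomial.aeval_X,
        Polynomial.aeval_C] at hq0
      have h1 := congrArg π hq0
      rw [map_add, map_mul, hπy, mul_zero, zero_add, map_zero] at h1
      obtain ⟨r, hr⟩ := hxP.aevalEquiv.surjective (q.coeff 0)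
      rw [← hr] at h1 hq
      apply hq
      have h2 : aeval (fun i => Ideal.Quotient.mk Q.asIdeal (x i)) r = 0 := by
        rw [← h1]
        change _ = π (hxP.aevalEquiv r)
        rw [AlgebraicIndependent.aevalEquiv_apply_coe, ← AlgHom.comp_apply, comp_aeval]
        rfl
      rw [(algebraicIndependent_iff.1 hx) r h2, map_zero]
    have hopt := (AlgebraicIndependent.option_iff_transcendental hxP yP).2 htr
    refine ⟨fun i => ((finSuccEquiv t) i).elim y x, ?_⟩
    convert hopt.comp _ (finSuccEquiv t).injective using 1
    ext i
    simp only [Function.comp]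
    cases finSuccEquiv t i <;> rfl

/-- A chain of primes of length `t` above `P` yields `t` derivations of the residue field of `P`
whose values at the coordinate functions are linearly independent. -/
theorem exists_linearIndependent_derivations {k σ : Type*} [Field k] [CharZero k]
    {t : ℕ} {P : PrimeSpectrum (MvPolynomial σ k)} (h : HasChain t P)
    {K : Type*} [Field K] [Algebra (MvPolynomial σ k ⧸ P.asIdeal) K] [Algebra k K]
    [IsScalarTower k (MvPolynomial σ k ⧸ P.asIdeal) K]
    [IsFractionRing (MvPolynomial σ k ⧸ P.asIdeal) K] :
    ∃ D : Fin t → Derivation k K K, LinearIndependent K fun i => fun j : σ =>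
      D i (algebraMap (MvPolynomial σ k ⧸ P.asIdeal) K (Ideal.Quotient.mk P.asIdeal (X j))) := by
  obtain ⟨x, hx⟩ := exists_algebraicIndependent_of_hasChain (k := k) h
  let ι : (MvPolynomial σ k ⧸ P.asIdeal) →ₐ[k] K := IsScalarTower.toAlgHom _ _ _
  have hxK := hx.map' (f := ι) (IsFractionRing.injective _ _)
  have hD := fun i : Fin t => exists_derivation_of_algebraicIndependent hxK (Pi.single i 1)
  choose D hD using hD
  refine ⟨D, ?_⟩
  rw [Fintype.linearIndependent_iff]
  intro c hc i
  let E : Derivation k K K := ∑ i, c i • D i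
  have hE : ∀ z, E z = ∑ i, c i * D i z := fun z => by
    have := congrFun (map_sum (Derivation.coeFnAddMonoidHom (R := k) (A := K) (M := K))
      (fun i => c i • D i) Finset.univ) z
    rw [Finset.sum_apply] at this
    exact this
  let m : MvPolynomial σ k →ₐ[k] K := ι.comp (Ideal.Quotient.mkₐ k P.asIdeal)
  have hEX : ∀ j, E (m (X j)) = 0 := fun j => by
    rw [hE]
    have := congrFun hc j
    rw [Finset.sum_apply] at this
    exact this
  have hEm : ∀ p, E (m p) = 0 := by
    intro p
    induction p using MvPolynomial.induction_on with
    | C a =>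
      rw [← algebraMap_eq, AlgHom.commutes]
      exact E.map_algebraMap a
    | add p q hp hq => rw [map_add, map_add, hp, hq, add_zero]
    | mul_X p j hp => rw [map_mul, E.leibniz, hp, hEX]; simp
  have h1 := hEm (x i)
  rw [hE, Finset.sum_eq_single i] at h1
  · simpa using (congrArg (c i * ·) (hD i i)).symm.trans h1
  · intro j _ hji
    rw [show D j (m (x i)) = Pi.single (M := fun _ => K) j 1 i from hD j i,
      Pi.single_eq_of_ne hji.symm, mul_zero]
  · simp

end Richardson

namespace Richardson

open Module

section NatPi

variable {K : Type*} [Field K] {M : ℕ → Type*} [∀ i, AddCommGroup (M i)] [∀ i, Module K (M i)]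

/-- A product over `ℕ` with trivial factors from `k` on is a product over `Fin k`. -/
noncomputable def natPiEquiv {k : ℕ} (h : ∀ i, k ≤ i → Subsingleton (M i)) :
    (∀ i, M i) ≃ₗ[K] ∀ i : Fin k, M i :=
  LinearEquiv.ofBijective (LinearMap.pi fun i : Fin k => LinearMap.proj (i : ℕ)) <| by
    constructor
    · intro x y hxy
      funext i
      by_cases hi : i < k
      · exact congrFun hxy ⟨i, hi⟩
      · exact (h i (not_lt.1 hi)).elim _ _
    · intro y
      refine ⟨fun i => if hi : i < k then y ⟨i, hi⟩ else 0, ?_⟩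
      funext i
      simp

variable [∀ i, FiniteDimensional K (M i)]

lemma finiteDimensional_natPi {k : ℕ} (h : ∀ i, k ≤ i → Subsingleton (M i)) :
    FiniteDimensional K (∀ i, M i) :=
  Module.Finite.equiv (natPiEquiv (K := K) h).symm

lemma finrank_natPi {k : ℕ} (h : ∀ i, k ≤ i → Subsingleton (M i)) :
    finrank K (∀ i, M i) = ∑ i ∈ Finset.range k, finrank K (M i) := by
  rw [(natPiEquiv (K := K) h).finrank_eq, finrank_pi_fintype, Finset.sum_range]

end NatPi

lemma finrank_add_finrank_le_of_pairing {K M M' : Type*} [Field K] [AddCommGroup M] [Module K M]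
    [FiniteDimensional K M] [AddCommMonoid M'] [Module K M'] (p : M' →ₗ[K] Dual K M)
    (hp : Function.Injective p) (S : Submodule K M) (hS : ∀ t, ∀ s ∈ S, p t s = 0) :
    finrank K S + finrank K M' ≤ finrank K M := by
  rw [← Subspace.finrank_add_finrank_dualAnnihilator_eq S]
  gcongr
  exact LinearMap.finrank_le_finrank_of_injective
    (f := p.codRestrict S.dualAnnihilator fun t => (Submodule.mem_dualAnnihilator _).2 (hS t))
    fun x y hxy => hp (congrArg Subtype.val hxy)

lemma eq_zero_of_trace_comp {K M : Type*} [Field K] [AddCommGroup M] [Module K M]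
    [FiniteDimensional K M] (x : M →ₗ[K] M) (h : ∀ z : M →ₗ[K] M, LinearMap.trace K M (x ∘ₗ z) = 0) :
    x = 0 := by
  ext v
  rw [LinearMap.zero_apply, ← forall_dual_apply_eq_zero_iff K]
  intro f
  rw [← h (f.smulRight v), ← LinearMap.trace_smulRight f (x v)]
  congr 1
  ext w
  simp

section Dimension

variable {K : Type*} [Field K] {V : ℕ → Type*} [∀ i, AddCommGroup (V i)] [∀ i, Module K (V i)]
  (a : ∀ i, V (i + 1) →ₗ[K] V i)

/-- Families of endomorphisms commuting with the chain of maps `a`, zero at the end of the chain. -/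
def chainEnd : Submodule K (∀ i, V i →ₗ[K] V i) where
  carrier := {h | h 0 = 0 ∧ ∀ i, a i ∘ₗ h (i + 1) = h i ∘ₗ a i}
  zero_mem' := by simp
  add_mem' := by
    rintro x y ⟨hx0, hx⟩ ⟨hy0, hy⟩
    simp [hx0, hy0, LinearMap.comp_add, LinearMap.add_comp, hx, hy]
  smul_mem' := by
    rintro c x ⟨hx0, hx⟩
    simp [hx0, LinearMap.comp_smul, LinearMap.smul_comp, hx]

/-- Families of maps in the opposite direction satisfying the preprojective relations. -/
def chainCoker : Submodule K (∀ i, V i →ₗ[K] V (i + 1)) where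
  carrier := {b | a 0 ∘ₗ b 0 = 0 ∧ ∀ i, a (i + 1) ∘ₗ b (i + 1) = b i ∘ₗ a i}
  zero_mem' := by simp
  add_mem' := by
    rintro x y ⟨hx0, hx⟩ ⟨hy0, hy⟩
    simp [hx0, hy0, LinearMap.comp_add, LinearMap.add_comp, hx, hy]
  smul_mem' := by
    rintro c x ⟨hx0, hx⟩
    simp [hx0, LinearMap.comp_smul, LinearMap.smul_comp, hx]

/-- The composite of the chain from the `i`-th space to the end. -/
def chainComp : ∀ i, V i →ₗ[K] V 0
  | 0 => LinearMap.id
  | i + 1 => chainComp i ∘ₗ a i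

/-- The kernel of the composite from the `i`-th space to the end of the chain. -/
abbrev chainKer (i : ℕ) : Submodule K (V i) := LinearMap.ker (chainComp a i)

/-- The chain maps restricted to the kernels. -/
def chainKerMap (i : ℕ) : chainKer a (i + 1) →ₗ[K] chainKer a i :=
  (a i).restrict fun _ hx => hx

lemma subtype_comp_chainKerMap (i : ℕ) :
    (chainKer a i).subtype ∘ₗ chainKerMap a i = a i ∘ₗ (chainKer a (i + 1)).subtype := rfl

/-- Endomorphisms of the chain of kernels. -/
def chainKerEnd : Submodule K (∀ i, chainKer a i →ₗ[K] chainKer a i) where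
  carrier := {h | ∀ i, chainKerMap a i ∘ₗ h (i + 1) = h i ∘ₗ chainKerMap a i}
  zero_mem' := by simp
  add_mem' := by
    intro x y hx hy i
    simp [LinearMap.comp_add, LinearMap.add_comp, hx i, hy i]
  smul_mem' := by
    intro c x hx i
    simp [LinearMap.comp_smul, LinearMap.smul_comp, hx i]

instance : Subsingleton (chainKer a 0) :=
  (Submodule.subsingleton_iff_eq_bot).2 (LinearMap.ker_id)

lemma apply_mem_chainKer {h : ∀ i, V i →ₗ[K] V i} (hh : h ∈ chainEnd a) (i : ℕ) (v : V i) :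
    h i v ∈ chainKer a i := by
  have : ∀ i, chainComp a i ∘ₗ h i = 0 := by
    intro i
    induction i with
    | zero => simp [hh.1]
    | succ i ih => rw [chainComp, LinearMap.comp_assoc, hh.2, ← LinearMap.comp_assoc, ih,
        LinearMap.zero_comp]
  exact LinearMap.congr_fun (this i) v

variable [∀ i, FiniteDimensional K (V i)]

lemma finrank_chainKer_sup_range (i : ℕ) :
    finrank K ↥(chainKer a i ⊔ LinearMap.range (a i)) + finrank K (chainKer a (i + 1)) =
      finrank K (chainKer a i) + finrank K (V (i + 1)) := by
  have h1 := Submodule.finrank_sup_add_finrank_inf_eq (chainKer a i) (LinearMap.range (a i))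
  have h2 := LinearMap.finrank_range_add_finrank_ker (a i)
  have h3 := LinearMap.finrank_range_add_finrank_ker ((a i).domRestrict (chainKer a (i + 1)))
  have h4 : LinearMap.range ((a i).domRestrict (chainKer a (i + 1))) =
      chainKer a i ⊓ LinearMap.range (a i) := by
    ext x
    constructor
    · rintro ⟨⟨y, hy⟩, rfl⟩
      exact ⟨hy, y, rfl⟩
    · rintro ⟨hx, y, rfl⟩
      exact ⟨⟨y, hx⟩, rfl⟩
  have h5 : finrank K (LinearMap.ker ((a i).domRestrict (chainKer a (i + 1)))) =
      finrank K (LinearMap.ker (a i)) := by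
    have hle : LinearMap.ker (a i) ≤ chainKer a (i + 1) := fun x hx => by
      rw [LinearMap.mem_ker, chainComp, LinearMap.comp_apply, LinearMap.mem_ker.1 hx, map_zero]
    rw [LinearMap.ker_domRestrict]
    exact (Submodule.submoduleOfEquivOfLe hle).finrank_eq
  rw [h4, h5] at h3
  omega

variable {k : ℕ} (hk : ∀ i, k ≤ i → Subsingleton (V i))

include hk in
lemma finrank_chainEnd_le :
    finrank K (chainEnd a) ≤ finrank K (chainKerEnd a) + ∑ i ∈ Finset.range k,
      (finrank K (V i) - finrank K ↥(chainKer a i ⊔ LinearMap.range (a i))) *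
        finrank K (chainKer a i) := by
  choose U hU using fun i => (chainKer a i ⊔ LinearMap.range (a i)).exists_isCompl
  have hkK : ∀ i, k ≤ i → Subsingleton (chainKer a i →ₗ[K] chainKer a i) := fun i hi =>
    have := hk i hi; inferInstance
  have hkU : ∀ i, k ≤ i → Subsingleton (U i →ₗ[K] chainKer a i) := fun i hi =>
    have := hk i hi; inferInstance
  have := finiteDimensional_natPi (K := K) hkK
  have := finiteDimensional_natPi (K := K) hkU
  let f : chainEnd a →ₗ[K] (chainKerEnd a) × (∀ i, U i →ₗ[K] chainKer a i) :=
    { toFun := fun h =>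
        (⟨fun i => (h.1 i).restrict fun v _ => apply_mem_chainKer a h.2 i v, fun i => by
            ext v
            exact LinearMap.congr_fun (h.2.2 i) v⟩,
          fun i => ((h.1 i).codRestrict (chainKer a i) (apply_mem_chainKer a h.2 i)).domRestrict
            (U i))
      map_add' := fun x y => rfl
      map_smul' := fun c x => rfl }
  have hf : Function.Injective f := by
    rw [injective_iff_map_eq_zero]
    rintro ⟨h, hh⟩ h0
    have h1 := congrArg (fun z => z.1.1) h0
    have h2 := congrArg Prod.snd h0
    ext1
    have key : ∀ n i, k ≤ i + n → h i = 0 := by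
      intro n
      induction n with
      | zero =>
        intro i hi
        have := hk i hi
        exact Subsingleton.elim _ _
      | succ n ih =>
        intro i hi
        have hi1 := ih (i + 1) (by omega)
        rw [← LinearMap.ker_eq_top, ← (hU i).sup_eq_top]
        refine le_antisymm ((hU i).sup_eq_top ▸ le_top) (sup_le (sup_le ?_ ?_) ?_)
        · intro v hv
          have := congrArg Subtype.val (LinearMap.congr_fun (congrFun h1 i) ⟨v, hv⟩)
          exact this
        · rintro _ ⟨v, rfl⟩
          have := LinearMap.congr_fun (hh.2 i) v
          rw [hi1] at this
          simpa using this.symm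
        · intro v hv
          have := congrArg Subtype.val (LinearMap.congr_fun (congrFun h2 i) ⟨v, hv⟩)
          exact this
    funext i
    exact key k i (by omega)
  refine (LinearMap.finrank_le_finrank_of_injective hf).trans ?_
  have : Module.Free K (chainKerEnd a) := 
    @Module.Free.of_divisionRing K (chainKerEnd a) _ (Submodule.addCommGroup _) _
  rw [finrank_prod, finrank_natPi hkU]
  gcongr with i hi
  rw [finrank_linearMap]
  gcongr
  have := Submodule.finrank_add_eq_of_isCompl (hU i)
  omega

/-- The defining relation of `chainCoker` for families with values in the kernels. -/
def chainKerRel : (∀ i, V i →ₗ[K] chainKer a (i + 1)) →ₗ[K]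
    ∀ i, V (i + 1) →ₗ[K] chainKer a (i + 1) where
  toFun B := fun i => chainKerMap a (i + 1) ∘ₗ B (i + 1) - B i ∘ₗ a i
  map_add' B B' := by
    funext i
    simp only [Pi.add_apply, LinearMap.comp_add, LinearMap.add_comp]
    abel
  map_smul' c B := by
    funext i
    simp [LinearMap.comp_smul, LinearMap.smul_comp, smul_sub]

include hk in
lemma finrank_chainKerEnd_add_le :
    finrank K (chainKerEnd a) + ∑ i ∈ Finset.range k, finrank K (V i) *
        finrank K (chainKer a (i + 1)) ≤
      finrank K (chainCoker a) + ∑ i ∈ Finset.range k, finrank K (V (i + 1)) *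
        finrank K (chainKer a (i + 1)) := by
  have hkV : ∀ i, k ≤ i → Subsingleton (V i →ₗ[K] chainKer a (i + 1)) := fun i hi =>
    have := hk i hi; inferInstance
  have hkV' : ∀ i, k ≤ i → Subsingleton (V (i + 1) →ₗ[K] chainKer a (i + 1)) := fun i hi =>
    have := hk (i + 1) (by omega); inferInstance
  have hkC : ∀ i, k ≤ i → Subsingleton (V i →ₗ[K] V (i + 1)) := fun i hi =>
    have := hk i hi; inferInstance
  have := finiteDimensional_natPi (K := K) hkV
  have := finiteDimensional_natPi (K := K) hkV'
  have := finiteDimensional_natPi (K := K) hkC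
  have hΘ := LinearMap.finrank_range_add_finrank_ker (chainKerRel a)
  rw [finrank_natPi hkV] at hΘ
  simp only [finrank_linearMap] at hΘ
  have hC : finrank K (LinearMap.ker (chainKerRel a)) ≤ finrank K (chainCoker a) := by
    let f : LinearMap.ker (chainKerRel a) →ₗ[K] chainCoker a :=
      { toFun := fun B => ⟨fun i => (chainKer a (i + 1)).subtype ∘ₗ B.1 i, by
            ext v
            exact (B.1 0 v).2, fun i => by
            have := congrFun (LinearMap.mem_ker.1 B.2) i
            ext v
            exact congrArg Subtype.val (LinearMap.congr_fun (sub_eq_zero.1 this) v)⟩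
        map_add' := fun x y => rfl
        map_smul' := fun c x => rfl }
    refine LinearMap.finrank_le_finrank_of_injective (f := f) fun x y hxy => ?_
    ext i v
    exact LinearMap.congr_fun (congrFun (congrArg Subtype.val hxy) i) v
  have hp : finrank K (LinearMap.range (chainKerRel a)) + finrank K (chainKerEnd a) ≤
      ∑ i ∈ Finset.range k, finrank K (V (i + 1)) * finrank K (chainKer a (i + 1)) := by
    have hrhs := finrank_natPi (K := K) hkV'
    simp only [finrank_linearMap] at hrhs
    rw [← hrhs]
    let p : chainKerEnd a →ₗ[K] Dual K (∀ i, V (i + 1) →ₗ[K] chainKer a (i + 1)) :=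
      LinearMap.mk₂ K (fun x Y => ∑ i ∈ Finset.range k, LinearMap.trace K _
          (x.1 (i + 1) ∘ₗ Y i ∘ₗ (chainKer a (i + 1)).subtype))
        (fun x x' Y => by simp [LinearMap.add_comp, Finset.sum_add_distrib])
        (fun c x Y => by simp [LinearMap.smul_comp, Finset.mul_sum])
        (fun x Y Y' => by simp [LinearMap.add_comp, LinearMap.comp_add, Finset.sum_add_distrib])
        (fun c x Y => by simp [LinearMap.smul_comp, LinearMap.comp_smul, Finset.mul_sum])
    refine finrank_add_finrank_le_of_pairing p ?_ _ ?_
    · rw [injective_iff_map_eq_zero]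
      rintro ⟨x, hx⟩ h0
      ext1
      funext i
      rcases i with _ | i
      · exact Subsingleton.elim _ _
      by_cases hi : i < k
      · refine eq_zero_of_trace_comp _ fun z => ?_
        obtain ⟨q, hq⟩ := (chainKer a (i + 1)).subtype.exists_leftInverse_of_injective
          (Submodule.ker_subtype _)
        have := LinearMap.congr_fun h0 (Pi.single i (z ∘ₗ q))
        change ∑ j ∈ Finset.range k, LinearMap.trace K _ (x (j + 1) ∘ₗ
          (Pi.single (M := fun i => V (i + 1) →ₗ[K] chainKer a (i + 1)) i (z ∘ₗ q) j) ∘ₗ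
            (chainKer a (j + 1)).subtype) = 0 at this
        rw [Finset.sum_eq_single i] at this
        · rwa [Pi.single_eq_same, LinearMap.comp_assoc, hq, LinearMap.comp_id] at this
        · intro j _ hji
          rw [Pi.single_eq_of_ne hji, LinearMap.zero_comp, LinearMap.comp_zero, map_zero]
        · intro h
          exact absurd (Finset.mem_range.2 hi) h
      · have := hk (i + 1) (by omega)
        exact Subsingleton.elim _ _
    · rintro ⟨x, hx⟩ _ ⟨B, rfl⟩
      let f : ℕ → K := fun i => LinearMap.trace K _
        (x (i + 1) ∘ₗ B i ∘ₗ (chainKer a i).subtype ∘ₗ chainKerMap a i)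
      have hf : ∀ i, LinearMap.trace K _ (x (i + 1) ∘ₗ chainKerRel a B i ∘ₗ
          (chainKer a (i + 1)).subtype) = f (i + 1) - f i := by
        intro i
        have e1 : x (i + 1) ∘ₗ chainKerRel a B i ∘ₗ (chainKer a (i + 1)).subtype =
            chainKerMap a (i + 1) ∘ₗ (x (i + 2) ∘ₗ B (i + 1) ∘ₗ (chainKer a (i + 1)).subtype) -
            x (i + 1) ∘ₗ B i ∘ₗ (chainKer a i).subtype ∘ₗ chainKerMap a i := by
          rw [subtype_comp_chainKerMap, show ∀ z, chainKerMap a (i + 1) ∘ₗ x (i + 2) ∘ₗ z =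
            (chainKerMap a (i + 1) ∘ₗ x (i + 2)) ∘ₗ z from fun z => rfl, hx (i + 1)]
          simp only [chainKerRel, LinearMap.coe_mk, AddHom.coe_mk, LinearMap.sub_comp,
            LinearMap.comp_sub, LinearMap.comp_assoc]
        rw [e1, map_sub, LinearMap.trace_comp_comm']
        rfl
      change ∑ i ∈ Finset.range k, LinearMap.trace K _ (x (i + 1) ∘ₗ chainKerRel a B i ∘ₗ
          (chainKer a (i + 1)).subtype) = 0
      simp only [hf]
      rw [Finset.sum_range_sub]
      have h0 : f 0 = 0 := by
        have : chainKerMap a 0 = 0 := Subsingleton.elim _ _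
        simp [f, this]
      have h1 : f k = 0 := by
        have := hk (k + 1) (by omega)
        have : x (k + 1) = 0 := Subsingleton.elim _ _
        simp [f, this]
      rw [h0, h1, sub_zero]
  omega

lemma sum_two_mul_sq_sub (α : ℕ → ℤ) (k : ℕ) :
    ∑ i ∈ Finset.range k, 2 * (α i ^ 2 - α i * α (i + 1)) =
      ∑ i ∈ Finset.range k, (α i - α (i + 1)) ^ 2 + α 0 ^ 2 - α k ^ 2 := by
  induction k with
  | zero => simp
  | succ k ih =>
    rw [Finset.sum_range_succ, Finset.sum_range_succ, ih]
    ring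

include hk in
/-- For a chain of spaces of convex dimensions, the endomorphisms are at most as many as the maps
satisfying the preprojective relations, and strictly fewer if there are any. -/
theorem finrank_chainEnd_le_finrank_chainCoker
    (hconv : ∀ i, 2 * finrank K (V (i + 1)) ≤ finrank K (V i) + finrank K (V (i + 2))) :
    finrank K (chainEnd a) ≤ finrank K (chainCoker a) ∧
      (chainEnd a ≠ ⊥ → finrank K (chainEnd a) < finrank K (chainCoker a)) := by
  have h1 := finrank_chainEnd_le a hk
  have h2 := finrank_chainKerEnd_add_le a hk
  set α : ℕ → ℤ := fun i => finrank K (chainKer a i) with hα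
  set ρ : ℕ → ℤ := fun i => finrank K (V i) with hρ
  have hαk : ∀ i, k ≤ i → α i = 0 := fun i hi => by
    have := hk i hi
    exact Nat.cast_eq_zero.2 (finrank_zero_of_subsingleton (R := K) (M := chainKer a i))
  have hα0 : α 0 = 0 :=
    Nat.cast_eq_zero.2 (finrank_zero_of_subsingleton (R := K) (M := chainKer a 0))
  have h1' : (finrank K (chainEnd a) : ℤ) ≤ finrank K (chainKerEnd a) +
      ∑ i ∈ Finset.range k, (ρ i - α i - ρ (i + 1) + α (i + 1)) * α i := by
    refine (Int.ofNat_le.2 h1).trans_eq ?_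
    push_cast
    congr 1
    refine Finset.sum_congr rfl fun i _ => ?_
    have h3 := finrank_chainKer_sup_range a i
    have h4 := Submodule.finrank_le (chainKer a i ⊔ LinearMap.range (a i))
    rw [Nat.cast_sub h4]
    congr 1
    simp only [hα, hρ]
    omega
  have h2' : (finrank K (chainKerEnd a) : ℤ) + ∑ i ∈ Finset.range k, ρ i * α (i + 1) ≤
      finrank K (chainCoker a) + ∑ i ∈ Finset.range k, ρ (i + 1) * α (i + 1) := by
    have := Int.ofNat_le.2 h2
    push_cast at this
    exact this
  have h3 : ∑ i ∈ Finset.range k, (ρ i - α i - ρ (i + 1) + α (i + 1)) * α i =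
      ∑ i ∈ Finset.range k, (ρ (i + 1) - α (i + 1) - ρ (i + 2) + α (i + 2)) * α (i + 1) := by
    have e1 := Finset.sum_range_succ
      (fun i => (ρ i - α i - ρ (i + 1) + α (i + 1)) * α i) k
    have e2 := Finset.sum_range_succ'
      (fun i => (ρ i - α i - ρ (i + 1) + α (i + 1)) * α i) k
    rw [e1, hαk k le_rfl, hα0, mul_zero, mul_zero, add_zero, add_zero] at e2
    exact e2
  have h4 : ∀ i, 0 ≤ α (i + 1) * (ρ i - 2 * ρ (i + 1) + ρ (i + 2)) := fun i => by
    refine mul_nonneg (by simp [hα]) ?_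
    have := hconv i
    simp only [hρ]
    omega
  have h5 := sum_two_mul_sq_sub (fun i => α (i + 1)) k
  rw [hαk (k + 1) (by omega)] at h5
  have h6 : ∑ i ∈ Finset.range k, ρ i * α (i + 1) - ∑ i ∈ Finset.range k, ρ (i + 1) * α (i + 1) -
      ∑ i ∈ Finset.range k, (ρ (i + 1) - α (i + 1) - ρ (i + 2) + α (i + 2)) * α (i + 1) =
      ∑ i ∈ Finset.range k, α (i + 1) * (ρ i - 2 * ρ (i + 1) + ρ (i + 2)) +
      ∑ i ∈ Finset.range k, (α (i + 1) ^ 2 - α (i + 1) * α (i + 1 + 1)) := by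
    rw [← Finset.sum_sub_distrib, ← Finset.sum_sub_distrib, ← Finset.sum_add_distrib]
    refine Finset.sum_congr rfl fun i _ => ?_
    ring
  have h7 := Finset.sum_nonneg fun i (_ : i ∈ Finset.range k) => h4 i
  rw [← Finset.mul_sum] at h5
  have h8 := Finset.sum_nonneg fun i (_ : i ∈ Finset.range k) =>
    sq_nonneg (α (i + 1) - α (i + 1 + 1))
  refine ⟨by nlinarith [sq_nonneg (α (0 + 1))], fun hne => ?_⟩
  by_contra hcon
  have h9 : (finrank K (chainCoker a) : ℤ) ≤ finrank K (chainEnd a) := by exact_mod_cast not_lt.1 hcon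
  have h10 : ∑ i ∈ Finset.range k, (α (i + 1) - α (i + 1 + 1)) ^ 2 = 0 := by
    nlinarith [sq_nonneg (α (0 + 1))]
  have h11 : α (0 + 1) ^ 2 = 0 := by nlinarith [sq_nonneg (α (0 + 1))]
  rw [Finset.sum_eq_zero_iff_of_nonneg fun i _ => sq_nonneg _] at h10
  have h12 : ∀ i, α i = 0 := by
    intro i
    induction i with
    | zero => exact hα0
    | succ i ih =>
      rcases i with _ | i
      · exact pow_eq_zero_iff two_ne_zero |>.1 h11
      by_cases hi : i < k
      · have := pow_eq_zero_iff two_ne_zero |>.1 (h10 i (Finset.mem_range.2 hi))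
        linarith
      · exact hαk _ (by omega)
  refine hne ((Submodule.eq_bot_iff _).2 fun x hx => ?_)
  funext i
  ext v
  have h13 := apply_mem_chainKer a hx i v
  have h14 : chainKer a i = ⊥ := Submodule.finrank_eq_zero.1 (Nat.cast_eq_zero.1 (h12 i))
  rwa [h14, Submodule.mem_bot] at h13

end Dimension

end Richardson

namespace Richardson

open Module Matrix

section Connection

variable {k K : Type*} [CommRing k] [Field K] [Algebra k K] (D : Derivation k K K)

/-- An additive map satisfying the Leibniz rule along the derivation `D`. -/
def IsConn {V : Type*} [AddCommGroup V] [Module K V] (c : V →+ V) : Prop :=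
  ∀ (x : K) (v : V), c (x • v) = D x • v + x • c v

variable {D}

lemma exists_conn_basis {U V W ι : Type*} [AddCommGroup U] [Module K U] [AddCommGroup V] [Module K V]
    [AddCommGroup W] [Module K W] [Fintype ι] (b : Basis ι K U) (s : U →ₗ[K] V) (A : V →ₗ[K] W)
    {cW : W →+ W} (hW : IsConn D cW) (h : ∀ u, ∃ v, A v = cW (A (s u))) :
    ∃ c : U →+ V, (∀ (x : K) (u : U), c (x • u) = D x • s u + x • c u) ∧
      ∀ u, A (c u) = cW (A (s u)) := by
  choose v hv using fun i => h (b i)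
  refine ⟨AddMonoidHom.mk' (fun u => ∑ i, (D (b.repr u i) • s (b i) + b.repr u i • v i)) ?_, ?_, ?_⟩
  · intro x y
    simp only [map_add, Finsupp.add_apply, add_smul, Finset.sum_add_distrib]
    abel
  · intro x u
    simp only [AddMonoidHom.mk'_apply, map_smul, Finsupp.smul_apply, smul_eq_mul, Derivation.leibniz,
      add_smul, Finset.sum_add_distrib, smul_add, Finset.smul_sum, ← mul_smul]
    have : D x • s u = ∑ i, (b.repr u i * D x) • s (b i) := by
      conv_lhs => rw [← b.sum_repr u, map_sum, Finset.smul_sum]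
      refine Finset.sum_congr rfl fun i _ => ?_
      rw [map_smul, ← mul_smul, mul_comm]
    rw [this]
    abel
  · intro u
    conv_rhs => rw [← b.sum_repr u, map_sum, map_sum, map_sum]
    simp only [AddMonoidHom.mk'_apply, map_sum, map_add, map_smul, hv, hW _ _]

/-- A connection lifts along a linear map, compatibly with a flag. -/
lemma exists_conn_lift {W : Type*} [AddCommGroup W] [Module K W] {cW : W →+ W} (hW : IsConn D cW)
    (N : ℕ) {V : Type*} [AddCommGroup V] [Module K V] [FiniteDimensional K V] (A : V →ₗ[K] W)
    (F : ℕ → Submodule K V) (hF : Antitone F) (hF0 : F 0 = ⊤) (hFN : F N = ⊥)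
    (h : ∀ j, ∀ v ∈ F j, ∃ v' ∈ F j, A v' = cW (A v)) :
    ∃ c : V →+ V, IsConn D c ∧ (∀ v, A (c v) = cW (A v)) ∧ ∀ j, ∀ v ∈ F j, c v ∈ F j := by
  induction N generalizing V with
  | zero =>
    have h0 : ∀ v : V, v = 0 := fun v => by
      have : v ∈ F 0 := hF0 ▸ Submodule.mem_top
      rwa [hFN, Submodule.mem_bot] at this
    refine ⟨0, fun x v => ?_, fun v => ?_, fun j v hv => (F j).zero_mem⟩
    · simp [h0 v]
    · simp [h0 v]
  | succ N ih =>
    obtain ⟨c, hc, hcA, hcF⟩ := ih (V := F 1) (A ∘ₗ (F 1).subtype)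
      (fun j => (F (j + 1)).comap (F 1).subtype)
      (fun i j hij => Submodule.comap_mono (hF (Nat.succ_le_succ hij)))
      (by simp) (by simp [hFN]) (by
        rintro j ⟨v, hv1⟩ hv
        obtain ⟨v', hv', e⟩ := h (j + 1) v hv
        exact ⟨⟨v', hF (by omega) hv'⟩, hv', e⟩)
    obtain ⟨U, hU⟩ := (F 1).exists_isCompl
    obtain ⟨g, hg, hgA⟩ := exists_conn_basis (finBasis K U) U.subtype A hW fun u => by
      obtain ⟨v', -, e⟩ := h 0 (U.subtype u) (hF0 ▸ Submodule.mem_top)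
      exact ⟨v', e⟩
    let e := ((F 1).prodEquivOfIsCompl U hU).symm
    have he : ∀ v, ((e v).1 : V) + (e v).2 = v := fun v =>
      ((F 1).prodEquivOfIsCompl U hU).apply_symm_apply v
    refine ⟨AddMonoidHom.mk' (fun v => (c (e v).1 : V) + g (e v).2) ?_, ?_, ?_, ?_⟩
    · intro x y
      simp only [map_add, Prod.fst_add, Prod.snd_add, Submodule.coe_add]
      abel
    · intro x v
      simp only [AddMonoidHom.mk'_apply, map_smul, Prod.smul_fst, Prod.smul_snd, hc _ _, hg,
        Submodule.coe_add, Submodule.coe_smul, Submodule.subtype_apply]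
      have h1 : D x • v = D x • ((e v).1 : V) + D x • ((e v).2 : V) := by rw [← smul_add, he]
      rw [smul_add, h1]
      abel
    · intro v
      have h1 := hcA (e v).1
      rw [LinearMap.comp_apply, LinearMap.comp_apply, Submodule.subtype_apply,
        Submodule.subtype_apply] at h1
      rw [AddMonoidHom.mk'_apply, map_add, h1, hgA, ← map_add, ← map_add, Submodule.subtype_apply, he]
    · rintro (_ | j) v hv
      · rw [hF0]
        exact Submodule.mem_top
      · have hv1 : v ∈ F 1 := hF (by omega) hv
        have h1 : e v = (⟨v, hv1⟩, 0) := by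
          rw [LinearEquiv.symm_apply_eq]
          simp
        rw [AddMonoidHom.mk'_apply, h1, map_zero, add_zero]
        exact hcF j ⟨v, hv1⟩ hv

/-- The images of the chain in its terms. -/
def chainFlag {V : ℕ → Type*} [∀ i, AddCommGroup (V i)] [∀ i, Module K (V i)]
    (a : ∀ i, V (i + 1) →ₗ[K] V i) : ℕ → ∀ i, Submodule K (V i)
  | 0, _ => ⊤
  | j + 1, i => (chainFlag a j (i + 1)).map (a i)

theorem exists_conn_chain {V : ℕ → Type*} [∀ i, AddCommGroup (V i)] [∀ i, Module K (V i)]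
    [∀ i, FiniteDimensional K (V i)] (a : ∀ i, V (i + 1) →ₗ[K] V i) {N : ℕ}
    (hN : ∀ i, N ≤ i → Subsingleton (V i)) :
    ∃ c : ∀ i, V i →+ V i, (∀ i, IsConn D (c i)) ∧ ∀ i v, a i (c (i + 1) v) = c i (a i v) := by
  have hanti : ∀ i, Antitone fun j => chainFlag a j i := by
    intro i
    refine antitone_nat_of_succ_le fun j => ?_
    induction j generalizing i with
    | zero => exact le_top
    | succ j ih => exact Submodule.map_mono (ih (i + 1))
  have hbot : ∀ j i, N ≤ i + j → chainFlag a j i = ⊥ := by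
    intro j
    induction j with
    | zero => exact fun i hi => have := hN i hi; Subsingleton.elim _ _
    | succ j ih =>
      intro i hi
      rw [chainFlag, ih (i + 1) (by omega), Submodule.map_bot]
  let S : ℕ → Type _ := fun i =>
    {c : V i →+ V i // IsConn D c ∧ ∀ j, ∀ v ∈ chainFlag a j i, c v ∈ chainFlag a j i}
  have hstep : ∀ i (c : S i), ∃ c' : S (i + 1), ∀ v, a i (c'.1 v) = c.1 (a i v) := by
    rintro i ⟨c, hc, hcF⟩
    obtain ⟨c', h1, h2, h3⟩ := exists_conn_lift hc N (a i) (fun j => chainFlag a j (i + 1))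
      (hanti _) rfl (hbot _ _ (by omega)) fun j v hv => hcF (j + 1) (a i v) ⟨v, hv, rfl⟩
    exact ⟨⟨c', h1, h3⟩, h2⟩
  obtain ⟨c0, h1, -, h3⟩ := exists_conn_lift (W := K) (cW := D.toLinearMap.toAddMonoidHom)
    (D := D) (fun x v => by simp [add_comm, mul_comm]) N (0 : V 0 →ₗ[K] K)
    (fun j => chainFlag a j 0) (hanti _) rfl (hbot _ _ (by omega))
    fun j v hv => ⟨0, Submodule.zero_mem _, by simp⟩
  choose f hf using hstep
  let s : ∀ i, S i := fun i => Nat.rec ⟨c0, h1, h3⟩ f i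
  exact ⟨fun i => (s i).1, fun i => (s i).2.1, fun i v => hf i (s i) v⟩

/-- A derivation acts on a chain of matrices through the infinitesimal base changes. -/
theorem exists_derivation_eq_commutator {r : ℕ → ℕ} {N : ℕ} (hN : ∀ i, N ≤ i → r i = 0)
    (D : Derivation k K K) (a : ∀ i, Matrix (Fin (r i)) (Fin (r (i + 1))) K) :
    ∃ x : ∀ i, Matrix (Fin (r i)) (Fin (r i)) K, ∀ i,
      (a i).map D = a i * x (i + 1) - x i * a i := by
  obtain ⟨c, hc, hca⟩ := exists_conn_chain (D := D) (V := fun i => Fin (r i) → K)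
    (fun i => toLin' (a i)) (N := N) fun i hi => by
      have : IsEmpty (Fin (r i)) := by rw [hN i hi]; infer_instance
      infer_instance
  refine ⟨fun i => Matrix.of fun p q => c i (Pi.single q 1) p, fun i => ?_⟩
  have hx : ∀ i (v : Fin (r i) → K), c i v = (fun p => D (v p)) +
      (Matrix.of fun p q => c i (Pi.single q 1) p) *ᵥ v := by
    intro i v
    conv_lhs => rw [pi_eq_sum_univ' v, map_sum]
    funext p
    simp only [hc i _ _, Finset.sum_apply, Pi.add_apply, Pi.smul_apply, smul_eq_mul, mulVec,
      dotProduct, of_apply, Finset.sum_add_distrib]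
    congr 1
    · simp [Pi.single_apply]
    · exact Finset.sum_congr rfl fun q _ => mul_comm _ _
  ext p q
  have h1 := congrFun (hca i (Pi.single q 1)) p
  have h2 := congrFun (hx i (a i *ᵥ Pi.single q 1)) p
  rw [toLin'_apply, toLin'_apply, h2] at h1
  simp only [mulVec_single_one, Pi.add_apply, col_apply] at h1
  rw [Matrix.sub_apply, map_apply, eq_sub_iff_add_eq]
  exact h1.symm
end Connection

end Richardson

namespace Richardson

open Module Matrix

section Quiver

variable {K : Type*} [CommRing K] {r : ℕ → ℕ}

variable (r) in
/-- The entries of the moment map at the inner nodes. -/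
abbrev MomentIdx : Type := Σ i : ℕ, Fin (r (i + 1)) × Fin (r (i + 1))

/-- The part of the moment map that is linear in the second family of matrices. -/
def momentLin (a : ∀ i, Matrix (Fin (r i)) (Fin (r (i + 1))) K) :
    (∀ i, Matrix (Fin (r (i + 1))) (Fin (r i)) K) →ₗ[K]
      ∀ i, Matrix (Fin (r (i + 1))) (Fin (r (i + 1))) K where
  toFun β := fun i => β i * a i - a (i + 1) * β (i + 1)
  map_add' x y := by
    funext i
    simp only [Pi.add_apply, Matrix.add_mul, Matrix.mul_add]
    abel
  map_smul' c x := by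
    funext i
    simp [smul_sub]

lemma momentLin_single_zero (a : ∀ i, Matrix (Fin (r i)) (Fin (r (i + 1))) K)
    (z : Matrix (Fin (r (0 + 1))) (Fin (r 0)) K) :
    momentLin a (Pi.single 0 z) = Pi.single 0 (z * a 0) := by
  funext i
  rcases i with _ | i
  · simp [momentLin]
  · simp [momentLin]

lemma momentLin_single_succ (a : ∀ i, Matrix (Fin (r i)) (Fin (r (i + 1))) K) (n : ℕ)
    (z : Matrix (Fin (r (n + 1 + 1))) (Fin (r (n + 1))) K) :
    momentLin a (Pi.single (n + 1) z) =
      Pi.single (n + 1) (z * a (n + 1)) - Pi.single n (a (n + 1) * z) := by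
  funext i
  rcases eq_or_ne i (n + 1) with rfl | h1
  · simp [momentLin]
  · rcases eq_or_ne i n with rfl | h2
    · simp [momentLin]
    · simp [momentLin, h1, h2]

/-- The infinitesimal base change of a chain of matrices. -/
def baseChangeLin (a : ∀ i, Matrix (Fin (r i)) (Fin (r (i + 1))) K) :
    (∀ i, Matrix (Fin (r i)) (Fin (r i)) K) →ₗ[K]
      ∀ i, Matrix (Fin (r i)) (Fin (r (i + 1))) K where
  toFun x := fun i => a i * x (i + 1) - x i * a i
  map_add' x y := by
    funext i
    simp only [Pi.add_apply, Matrix.add_mul, Matrix.mul_add]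
    abel
  map_smul' c x := by
    funext i
    simp [smul_sub]

/-- The linear part of the selected entries of the moment map. -/
def momentLinOn (a : ∀ i, Matrix (Fin (r i)) (Fin (r (i + 1))) K) (J : Finset (MomentIdx r)) :
    (∀ i, Matrix (Fin (r (i + 1))) (Fin (r i)) K) →ₗ[K] J → K :=
  LinearMap.pi (fun j : J => LinearMap.proj j.1.2.2 ∘ₗ LinearMap.proj j.1.2.1 ∘ₗ
    LinearMap.proj j.1.1) ∘ₗ momentLin a

lemma momentLinOn_apply (a : ∀ i, Matrix (Fin (r i)) (Fin (r (i + 1))) K) (J : Finset (MomentIdx r))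
    (β : ∀ i, Matrix (Fin (r (i + 1))) (Fin (r i)) K) (j : J) :
    momentLinOn a J β j = momentLin a β j.1.1 j.1.2.1 j.1.2.2 := rfl

end Quiver

section QuiverField

variable {K : Type*} [Field K] {r : ℕ → ℕ} {k : ℕ} (hk : ∀ i, k ≤ i → r i = 0)
  (a : ∀ i, Matrix (Fin (r i)) (Fin (r (i + 1))) K)

lemma functional_eq_trace {ι : Type*} [Fintype ι] [DecidableEq ι] {κ : Type*} [Fintype κ]
    [DecidableEq κ] (ψ : Matrix ι κ K →ₗ[K] K) (z : Matrix ι κ K) :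
    ψ z = trace (Matrix.of (fun p q => ψ (Matrix.single q p 1)) * z) := by
  conv_lhs => rw [matrix_eq_sum_single z]
  simp only [map_sum, trace, diag_apply, mul_apply, of_apply]
  rw [Finset.sum_comm]
  refine Finset.sum_congr rfl fun p _ => Finset.sum_congr rfl fun q _ => ?_
  rw [← mul_one (z q p), ← smul_eq_mul (z q p) 1, ← Matrix.smul_single, map_smul, smul_eq_mul,
    smul_eq_mul, mul_one, mul_comm]

lemma eq_zero_of_trace_mul {ι κ : Type*} [Fintype ι] [DecidableEq ι] [Fintype κ] [DecidableEq κ]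
    (x : Matrix ι κ K) (h : ∀ z : Matrix κ ι K, trace (x * z) = 0) : x = 0 := by
  ext i j
  have := h (Matrix.single j i 1)
  rw [trace_mul_comm, trace_single_mul, one_smul] at this
  exact this

/-- Endomorphisms of a chain of matrices that vanish at its end. -/
abbrev matChainEnd : Submodule K (∀ i, (Fin (r i) → K) →ₗ[K] (Fin (r i) → K)) :=
  chainEnd (V := fun i => Fin (r i) → K) fun i => toLin' (a i)

include hk in
lemma finiteDimensional_matChainEnd : FiniteDimensional K (matChainEnd a) := by
  have : ∀ i, k ≤ i → Subsingleton ((Fin (r i) → K) →ₗ[K] (Fin (r i) → K)) := fun i hi => by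
    rw [hk i hi]
    infer_instance
  have := finiteDimensional_natPi (K := K) this
  infer_instance

/-- The matrices representing a functional on the entries of the moment map. -/
def functionalMatrix (ψ : (∀ i, Matrix (Fin (r (i + 1))) (Fin (r (i + 1))) K) →ₗ[K] K) :
    ∀ i, Matrix (Fin (r i)) (Fin (r i)) K
  | 0 => 0
  | i + 1 => Matrix.of fun p q => ψ (Pi.single i (Matrix.single q p 1))

lemma functional_single (ψ : (∀ i, Matrix (Fin (r (i + 1))) (Fin (r (i + 1))) K) →ₗ[K] K) (i : ℕ)
    (z : Matrix (Fin (r (i + 1))) (Fin (r (i + 1))) K) :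
    ψ (Pi.single i z) = trace (functionalMatrix ψ (i + 1) * z) :=
  functional_eq_trace
    (ψ ∘ₗ LinearMap.single K (fun i => Matrix (Fin (r (i + 1))) (Fin (r (i + 1))) K) i) z

lemma functionalMatrix_mul (ψ : (∀ i, Matrix (Fin (r (i + 1))) (Fin (r (i + 1))) K) →ₗ[K] K)
    (hψ : ∀ β, ψ (momentLin a β) = 0) (i : ℕ) :
    a i * functionalMatrix ψ (i + 1) = functionalMatrix ψ i * a i := by
  rw [← sub_eq_zero]
  refine eq_zero_of_trace_mul _ fun z => ?_
  have h := hψ (Pi.single i z)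
  rcases i with _ | i
  · rw [momentLin_single_zero, functional_single] at h
    rw [show functionalMatrix ψ 0 = 0 from rfl, Matrix.zero_mul, sub_zero, Matrix.mul_assoc,
      trace_mul_comm, Matrix.mul_assoc, h]
  · rw [momentLin_single_succ, map_sub, functional_single, functional_single] at h
    rw [Matrix.sub_mul, trace_sub, ← h, Matrix.mul_assoc, trace_mul_comm, Matrix.mul_assoc,
      Matrix.mul_assoc]

include hk in
/-- The entries of the moment map satisfy at most as many relations as the chain has
endomorphisms. -/
lemma card_le_finrank_range_momentLinOn (J : Finset (MomentIdx r)) :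
    J.card ≤ finrank K (LinearMap.range (momentLinOn a J)) + finrank K (matChainEnd a) := by
  have := finiteDimensional_matChainEnd hk a
  have h1 := Subspace.finrank_add_finrank_dualAnnihilator_eq (LinearMap.range (momentLinOn a J))
  rw [finrank_fintype_fun_eq_card, Fintype.card_coe] at h1
  rw [← h1]
  gcongr
  let res : (∀ i, Matrix (Fin (r (i + 1))) (Fin (r (i + 1))) K) →ₗ[K] J → K :=
    LinearMap.pi (fun j : J => LinearMap.proj j.1.2.2 ∘ₗ LinearMap.proj j.1.2.1 ∘ₗ
      LinearMap.proj j.1.1)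
  have hres : ∀ j : J, res (Pi.single j.1.1 (Matrix.single j.1.2.1 j.1.2.2 1)) = Pi.single j 1 := by
    rintro ⟨⟨i, p, q⟩, hj⟩
    funext ⟨⟨i', p', q'⟩, hj'⟩
    change Pi.single (M := fun i => Matrix (Fin (r (i + 1))) (Fin (r (i + 1))) K) i
      (Matrix.single p q 1) i' p' q' = _
    rcases eq_or_ne i' i with rfl | hi
    · rw [Pi.single_eq_same, Pi.single_apply, Matrix.single_apply]
      congr 1
      simp [eq_comm]
    · rw [Pi.single_eq_of_ne hi, Pi.single_eq_of_ne]
      · rfl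
      · intro h
        exact hi (congrArg (fun j : J => j.1.1) h)
  have hann : ∀ φ ∈ (LinearMap.range (momentLinOn a J)).dualAnnihilator, ∀ β,
      (φ ∘ₗ res) (momentLin a β) = 0 := fun φ hφ β =>
    (Submodule.mem_dualAnnihilator φ).1 hφ _ ⟨β, rfl⟩
  let f : (LinearMap.range (momentLinOn a J)).dualAnnihilator →ₗ[K] matChainEnd a :=
    { toFun := fun φ => ⟨fun i => toLin' (functionalMatrix (φ.1 ∘ₗ res) i),
        by simp [functionalMatrix], fun i => by
          change toLin' _ ∘ₗ toLin' _ = toLin' _ ∘ₗ toLin' _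
          rw [← toLin'_mul, ← toLin'_mul, functionalMatrix_mul a _ (hann φ.1 φ.2)]⟩
      map_add' := fun x y => by
        ext1
        funext i
        rcases i with _ | i
        · simp [functionalMatrix]
        · exact map_add (toLin' (R := K))
            (functionalMatrix (x.1 ∘ₗ res) (i + 1)) (functionalMatrix (y.1 ∘ₗ res) (i + 1))
      map_smul' := fun c x => by
        ext1
        funext i
        rcases i with _ | i
        · simp [functionalMatrix]
        · exact map_smul (toLin' (R := K)) c (functionalMatrix (x.1 ∘ₗ res) (i + 1)) }
  refine LinearMap.finrank_le_finrank_of_injective (f := f) ?_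
  rw [injective_iff_map_eq_zero]
  rintro ⟨φ, hφ⟩ h0
  ext1
  refine LinearMap.pi_ext' fun j => ?_
  ext
  have h2 : toLin' (functionalMatrix (φ ∘ₗ res) (j.1.1 + 1)) = 0 :=
    congrFun (congrArg Subtype.val h0) (j.1.1 + 1)
  rw [LinearEquiv.map_eq_zero_iff] at h2
  have h3 := congrFun (congrFun h2 j.1.2.2) j.1.2.1
  change φ (res (Pi.single j.1.1 (Matrix.single j.1.2.1 j.1.2.2 1))) = 0 at h3
  rw [hres] at h3
  exact h3

include hk in
lemma finrank_range_baseChangeLin_add_le :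
    finrank K (LinearMap.range (baseChangeLin a)) +
      finrank K (chainCoker (V := fun i => Fin (r i) → K) fun i => toLin' (a i)) ≤
      ∑ i ∈ Finset.range k, r i * r (i + 1) := by
  have hkA : ∀ i, k ≤ i → Subsingleton (Matrix (Fin (r i)) (Fin (r (i + 1))) K) := fun i hi => by
    rw [hk i hi]
    infer_instance
  have := finiteDimensional_natPi (K := K) hkA
  have hN := finrank_natPi (K := K) hkA
  simp only [finrank_matrix, Fintype.card_fin, finrank_self, mul_one] at hN
  rw [← hN]
  let p : chainCoker (V := fun i => Fin (r i) → K) (fun i => toLin' (a i)) →ₗ[K]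
      Dual K (∀ i, Matrix (Fin (r i)) (Fin (r (i + 1))) K) :=
    LinearMap.mk₂ K (fun x Y => ∑ i ∈ Finset.range k, trace (LinearMap.toMatrix' (x.1 i) * Y i))
      (fun x x' Y => by simp [Matrix.add_mul, Finset.sum_add_distrib])
      (fun c x Y => by simp [Finset.mul_sum])
      (fun x Y Y' => by simp [Matrix.mul_add, Finset.sum_add_distrib])
      (fun c x Y => by simp [Finset.mul_sum])
  refine finrank_add_finrank_le_of_pairing p ?_ _ ?_
  · rw [injective_iff_map_eq_zero]
    rintro ⟨x, hx⟩ h0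
    ext1
    funext i
    by_cases hi : i < k
    · have : LinearMap.toMatrix' (x i) = 0 := by
        refine eq_zero_of_trace_mul _ fun z => ?_
        have := LinearMap.congr_fun h0 (Pi.single i z)
        change ∑ j ∈ Finset.range k, trace (LinearMap.toMatrix' (x j) *
          (Pi.single (M := fun i => Matrix (Fin (r i)) (Fin (r (i + 1))) K) i z j)) = 0 at this
        rw [Finset.sum_eq_single i] at this
        · rwa [Pi.single_eq_same] at this
        · intro j _ hji
          rw [Pi.single_eq_of_ne hji, Matrix.mul_zero, trace_zero]
        · intro h
          exact absurd (Finset.mem_range.2 hi) h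
      exact (LinearEquiv.map_eq_zero_iff _).1 this
    · have : IsEmpty (Fin (r i)) := by rw [hk i (not_lt.1 hi)]; infer_instance
      exact Subsingleton.elim _ _
  · rintro ⟨x, hx⟩ _ ⟨y, rfl⟩
    let f : ℕ → K := fun i => trace (LinearMap.toMatrix' (x i) * y i * a i)
    have h1 : a 0 * LinearMap.toMatrix' (x 0) = 0 := by
      have := congrArg LinearMap.toMatrix' hx.1
      rwa [LinearMap.toMatrix'_comp, LinearMap.toMatrix'_toLin', map_zero] at this
    have h2 : ∀ i, a (i + 1) * LinearMap.toMatrix' (x (i + 1)) =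
        LinearMap.toMatrix' (x i) * a i := fun i => by
      have := congrArg LinearMap.toMatrix' (hx.2 i)
      rwa [LinearMap.toMatrix'_comp, LinearMap.toMatrix'_comp, LinearMap.toMatrix'_toLin',
        LinearMap.toMatrix'_toLin'] at this
    have hf : ∀ i, trace (LinearMap.toMatrix' (x i) * baseChangeLin a y i) = f (i + 1) - f i := by
      intro i
      simp only [baseChangeLin, LinearMap.coe_mk, AddHom.coe_mk, Matrix.mul_sub, trace_sub, f]
      congr 1
      · rw [trace_mul_comm _ (a (i + 1)), ← Matrix.mul_assoc, ← Matrix.mul_assoc, h2]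
      · rw [Matrix.mul_assoc]
    change ∑ i ∈ Finset.range k, trace (LinearMap.toMatrix' (x i) * baseChangeLin a y i) = 0
    simp only [hf]
    rw [Finset.sum_range_sub]
    have h3 : f 0 = 0 := by
      simp only [f]
      rw [trace_mul_comm, ← Matrix.mul_assoc, h1, Matrix.zero_mul, trace_zero]
    have h4 : f k = 0 := by
      have : IsEmpty (Fin (r (k + 1))) := by rw [hk (k + 1) (by omega)]; infer_instance
      simp only [f]
      rw [trace, Fintype.sum_empty]
    rw [h3, h4, sub_zero]

include hk in
/-- A bound for spaces of tangent vectors to the fibres of the moment map. -/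
theorem finrank_tangent_add_card_le
    (hconv : ∀ i, 2 * r (i + 1) ≤ r i + r (i + 2))
    (b : ∀ i, Matrix (Fin (r (i + 1))) (Fin (r i)) K) (J : Finset (MomentIdx r))
    (W : Submodule K ((∀ i, Matrix (Fin (r i)) (Fin (r (i + 1))) K) ×
      ∀ i, Matrix (Fin (r (i + 1))) (Fin (r i)) K))
    (hW : ∀ w ∈ W, w.1 ∈ LinearMap.range (baseChangeLin a))
    (hWJ : ∀ w ∈ W, ∀ j ∈ J, (w.2 j.1 * a j.1 + b j.1 * w.1 j.1 - a (j.1 + 1) * w.2 (j.1 + 1) -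
      w.1 (j.1 + 1) * b (j.1 + 1)) j.2.1 j.2.2 = 0) :
    finrank K W + J.card ≤ 2 * ∑ i ∈ Finset.range k, r i * r (i + 1) ∧
      (matChainEnd a ≠ ⊥ → finrank K W + J.card < 2 * ∑ i ∈ Finset.range k, r i * r (i + 1)) := by
  have hkA : ∀ i, k ≤ i → Subsingleton (Matrix (Fin (r i)) (Fin (r (i + 1))) K) := fun i hi => by
    rw [hk i hi]
    infer_instance
  have hkB : ∀ i, k ≤ i → Subsingleton (Matrix (Fin (r (i + 1))) (Fin (r i)) K) := fun i hi => by
    rw [hk i hi]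
    infer_instance
  have := finiteDimensional_natPi (K := K) hkA
  have := finiteDimensional_natPi (K := K) hkB
  have hN := finrank_natPi (K := K) hkB
  simp only [finrank_matrix, Fintype.card_fin, finrank_self, mul_one] at hN
  have h1 := LinearMap.finrank_range_add_finrank_ker ((LinearMap.fst K
    (∀ i, Matrix (Fin (r i)) (Fin (r (i + 1))) K)
    (∀ i, Matrix (Fin (r (i + 1))) (Fin (r i)) K)).domRestrict W)
  have h2 : finrank K (LinearMap.range ((LinearMap.fst K
      (∀ i, Matrix (Fin (r i)) (Fin (r (i + 1))) K)
      (∀ i, Matrix (Fin (r (i + 1))) (Fin (r i)) K)).domRestrict W)) ≤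
      finrank K (LinearMap.range (baseChangeLin a)) := by
    refine Submodule.finrank_mono ?_
    rintro _ ⟨⟨w, hw⟩, rfl⟩
    exact hW w hw
  have h3 : finrank K (LinearMap.ker ((LinearMap.fst K
      (∀ i, Matrix (Fin (r i)) (Fin (r (i + 1))) K)
      (∀ i, Matrix (Fin (r (i + 1))) (Fin (r i)) K)).domRestrict W)) ≤
      finrank K (LinearMap.ker (momentLinOn a J)) := by
    let g : LinearMap.ker ((LinearMap.fst K (∀ i, Matrix (Fin (r i)) (Fin (r (i + 1))) K)
      (∀ i, Matrix (Fin (r (i + 1))) (Fin (r i)) K)).domRestrict W) →ₗ[K]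
        LinearMap.ker (momentLinOn a J) :=
      { toFun := fun w => ⟨w.1.1.2, by
          have hw : w.1.1.1 = 0 := w.2
          refine LinearMap.mem_ker.2 (funext fun j => ?_)
          have := hWJ w.1.1 w.1.2 j.1 j.2
          rw [hw] at this
          simpa [momentLinOn_apply, momentLin] using this⟩
        map_add' := fun x y => rfl
        map_smul' := fun c x => rfl }
    refine LinearMap.finrank_le_finrank_of_injective (f := g) ?_
    rw [injective_iff_map_eq_zero]
    rintro ⟨⟨⟨w1, w2⟩, hw⟩, hw'⟩ h0
    have e1 : w1 = 0 := hw'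
    have e2 : w2 = 0 := congrArg Subtype.val h0
    subst e1 e2
    rfl
  have h4 := LinearMap.finrank_range_add_finrank_ker (momentLinOn a J)
  have h5 := card_le_finrank_range_momentLinOn hk a J
  have h6 := finrank_range_baseChangeLin_add_le hk a
  have h7 : finrank K (matChainEnd a) ≤
      finrank K (chainCoker (V := fun i => Fin (r i) → K) fun i => toLin' (a i)) ∧
      (matChainEnd a ≠ ⊥ → finrank K (matChainEnd a) <
        finrank K (chainCoker (V := fun i => Fin (r i) → K) fun i => toLin' (a i))) :=
    finrank_chainEnd_le_finrank_chainCoker (K := K) (V := fun i => Fin (r i) → K)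
    (fun i => toLin' (a i)) (k := k) (fun i hi => by rw [hk i hi]; infer_instance)
    (by simpa using hconv)
  have h8 : ∑ i ∈ Finset.range k, r (i + 1) * r i = ∑ i ∈ Finset.range k, r i * r (i + 1) :=
    Finset.sum_congr rfl fun i _ => mul_comm _ _
  rw [hN, h8] at h4
  refine ⟨by omega, fun hne => ?_⟩
  have := h7.2 hne
  omega

end QuiverField

end Richardson

namespace Richardson

open Module Matrix MvPolynomial

section Generic

variable (r : ℕ → ℕ)

/-- The entries of representations of the doubled chain quiver. -/
abbrev RepVar : Type := (Σ i : ℕ, Fin (r i) × Fin (r (i + 1))) ⊕ (Σ i : ℕ, Fin (r (i + 1)) × Fin (r i))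

variable {r}

lemma finite_sigma_fin {k : ℕ} {T : ℕ → Type*} [∀ i, Finite (T i)]
    (hT : ∀ i, k ≤ i → IsEmpty (T i)) : Finite (Σ i, T i) := by
  refine Finite.of_injective (β := Σ i : Fin k, T i) (fun x => ⟨⟨x.1, ?_⟩, x.2⟩) ?_
  · by_contra h
    exact (hT x.1 (not_lt.1 h)).elim x.2
  · rintro ⟨i, x⟩ ⟨j, y⟩ h
    simp only [Sigma.mk.injEq, Fin.mk.injEq] at h
    obtain ⟨rfl, h⟩ := h
    rw [eq_of_heq h]

lemma finite_repVar {k : ℕ} (hk : ∀ i, k ≤ i → r i = 0) : Finite (RepVar r) := by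
  have := finite_sigma_fin (T := fun i => Fin (r i) × Fin (r (i + 1))) (k := k) fun i hi => by
    rw [hk i hi]; infer_instance
  have := finite_sigma_fin (T := fun i => Fin (r (i + 1)) × Fin (r i)) (k := k) fun i hi => by
    rw [hk i hi]; infer_instance
  infer_instance

lemma finite_momentIdx {k : ℕ} (hk : ∀ i, k ≤ i → r i = 0) : Finite (MomentIdx r) :=
  finite_sigma_fin (k := k) fun i hi => by rw [hk (i + 1) (by omega)]; infer_instance

/-- The first family of matrices with prescribed entries. -/
def matA {R : Type*} (v : RepVar r → R) (i : ℕ) : Matrix (Fin (r i)) (Fin (r (i + 1))) R :=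
  Matrix.of fun p q => v (Sum.inl ⟨i, p, q⟩)

/-- The second family of matrices with prescribed entries. -/
def matB {R : Type*} (v : RepVar r → R) (i : ℕ) : Matrix (Fin (r (i + 1))) (Fin (r i)) R :=
  Matrix.of fun p q => v (Sum.inr ⟨i, p, q⟩)

/-- The moment map at the inner nodes. -/
def moment {R : Type*} [Ring R] (v : RepVar r → R) (i : ℕ) :
    Matrix (Fin (r (i + 1))) (Fin (r (i + 1))) R :=
  matB v i * matA v i - matA v (i + 1) * matB v (i + 1)

lemma matA_comp {R R' : Type*} (f : R → R') (v : RepVar r → R) (i : ℕ) :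
    matA (f ∘ v) i = (matA v i).map f := rfl

lemma matB_comp {R R' : Type*} (f : R → R') (v : RepVar r → R) (i : ℕ) :
    matB (f ∘ v) i = (matB v i).map f := rfl

lemma moment_comp {R R' : Type*} [Ring R] [Ring R'] (f : R →+* R') (v : RepVar r → R) (i : ℕ) :
    moment (f ∘ v) i = (moment v i).map f := by
  simp only [moment, matA_comp, matB_comp]
  rw [Matrix.map_sub f (map_sub f), Matrix.map_mul, Matrix.map_mul]

lemma moment_eq_momentLin {R : Type*} [CommRing R] (v : RepVar r → R) :
    moment v = momentLin (matA v) (matB v) := rfl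

variable (r) in
/-- The entries of the moment map as polynomials. -/
noncomputable def momentPoly (k : Type*) [CommRing k] (j : MomentIdx r) : MvPolynomial (RepVar r) k :=
  moment (X : RepVar r → MvPolynomial (RepVar r) k) j.1 j.2.1 j.2.2

lemma map_momentPoly {k R : Type*} [CommRing k] [CommRing R] (f : MvPolynomial (RepVar r) k →+* R)
    (j : MomentIdx r) : f (momentPoly r k j) = moment (fun x => f (X x)) j.1 j.2.1 j.2.2 := by
  change _ = moment (f ∘ X) j.1 j.2.1 j.2.2
  rw [moment_comp]
  rfl

lemma isHomogeneous_momentPoly {k : Type*} [CommRing k] (j : MomentIdx r) :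
    (momentPoly r k j).IsHomogeneous 2 := by
  refine IsHomogeneous.sub ?_ ?_
  · rw [Matrix.mul_apply]
    exact IsHomogeneous.sum _ _ _ fun _ _ => (isHomogeneous_X _ _).mul (isHomogeneous_X _ _)
  · rw [Matrix.mul_apply]
    exact IsHomogeneous.sum _ _ _ fun _ _ => (isHomogeneous_X _ _).mul (isHomogeneous_X _ _)

/-- Entries packed into the two families of matrices. -/
def packEquiv (K : Type*) [Field K] : (RepVar r → K) ≃ₗ[K]
    (∀ i, Matrix (Fin (r i)) (Fin (r (i + 1))) K) × ∀ i, Matrix (Fin (r (i + 1))) (Fin (r i)) K where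
  toFun v := (matA v, matB v)
  map_add' _ _ := rfl
  map_smul' _ _ := rfl
  invFun w := Sum.elim (fun x => w.1 x.1 x.2.1 x.2.2) (fun x => w.2 x.1 x.2.1 x.2.2)
  left_inv v := by ext (x | x) <;> rfl
  right_inv w := rfl

lemma card_repVar [Fintype (RepVar r)] {k : ℕ} (hk : ∀ i, k ≤ i → r i = 0) :
    Fintype.card (RepVar r) = 2 * ∑ i ∈ Finset.range k, r i * r (i + 1) := by
  have hkA : ∀ i, k ≤ i → Subsingleton (Matrix (Fin (r i)) (Fin (r (i + 1))) ℚ) := fun i hi => by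
    rw [hk i hi]
    infer_instance
  have hkB : ∀ i, k ≤ i → Subsingleton (Matrix (Fin (r (i + 1))) (Fin (r i)) ℚ) := fun i hi => by
    rw [hk i hi]
    infer_instance
  have := finiteDimensional_natPi (K := ℚ) hkA
  have := finiteDimensional_natPi (K := ℚ) hkB
  rw [← finrank_fintype_fun_eq_card ℚ, (packEquiv ℚ).finrank_eq, finrank_prod, finrank_natPi hkA,
    finrank_natPi hkB, two_mul]
  congr 1
  · simp [finrank_matrix]
  · simp [finrank_matrix, mul_comm]

lemma map_derivation_mul {k K ι κ μ : Type*} [CommRing k] [CommRing K] [Algebra k K] [Fintype κ]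
    (D : Derivation k K K) (M : Matrix ι κ K) (N : Matrix κ μ K) :
    (M * N).map D = M.map D * N + M * N.map D := by
  ext i j
  simp only [Matrix.map_apply, Matrix.mul_apply, map_sum, Derivation.leibniz, smul_eq_mul,
    Matrix.add_apply, Finset.sum_add_distrib]
  rw [add_comm]
  congr 1
  exact Finset.sum_congr rfl fun _ _ => mul_comm _ _

/-- A prime over which entries of the moment map vanish has few specialisations. -/
theorem add_card_le_of_hasChain {F : Type} [Field F] [CharZero F] [Fintype (RepVar r)] {k : ℕ}
    (hk : ∀ i, k ≤ i → r i = 0) (hconv : ∀ i, 2 * r (i + 1) ≤ r i + r (i + 2))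
    {P : PrimeSpectrum (MvPolynomial (RepVar r) F)} {t : ℕ} (h : HasChain t P)
    (J : Finset (MomentIdx r)) (hJ : ∀ j ∈ J, momentPoly r F j ∈ P.asIdeal)
    {K : Type} [Field K] [Algebra (MvPolynomial (RepVar r) F ⧸ P.asIdeal) K] [Algebra F K]
    [IsScalarTower F (MvPolynomial (RepVar r) F ⧸ P.asIdeal) K]
    [IsFractionRing (MvPolynomial (RepVar r) F ⧸ P.asIdeal) K] :
    t + J.card ≤ Fintype.card (RepVar r) ∧
      (matChainEnd (matA fun x => algebraMap (MvPolynomial (RepVar r) F ⧸ P.asIdeal) K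
        (Ideal.Quotient.mk P.asIdeal (X x))) ≠ ⊥ → t + J.card < Fintype.card (RepVar r)) := by
  obtain ⟨D, hD⟩ := exists_linearIndependent_derivations h (K := K)
  set v : RepVar r → K := fun x => algebraMap (MvPolynomial (RepVar r) F ⧸ P.asIdeal) K
    (Ideal.Quotient.mk P.asIdeal (X x)) with hv
  have hlin := hD.map' (packEquiv K).toLinearMap (LinearEquiv.ker _)
  have hfr : finrank K (Submodule.span K (Set.range (packEquiv K ∘ fun i x => D i (v x)))) = t :=
    (finrank_span_eq_card hlin).trans (Fintype.card_fin t)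
  rw [card_repVar hk]
  have key := finrank_tangent_add_card_le hk (matA v) hconv (matB v) J
    (Submodule.span K (Set.range (packEquiv K ∘ fun i x => D i (v x)))) ?_ ?_
  · rwa [hfr] at key
  · intro w hw
    induction hw using Submodule.span_induction with
    | mem w hw =>
      obtain ⟨i, rfl⟩ := hw
      obtain ⟨x, hx⟩ := exists_derivation_eq_commutator hk (D i) (matA v)
      exact ⟨x, funext fun n => (hx n).symm⟩
    | zero => exact Submodule.zero_mem _
    | add x y _ _ hx hy => exact Submodule.add_mem _ hx hy
    | smul c x _ hx => exact Submodule.smul_mem _ c hx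
  · intro w hw j hj
    induction hw using Submodule.span_induction with
    | mem w hw =>
      obtain ⟨i, rfl⟩ := hw
      have h0 : moment v j.1 j.2.1 j.2.2 = 0 := by
        have h1 := map_momentPoly ((algebraMap (MvPolynomial (RepVar r) F ⧸ P.asIdeal) K).comp
          (Ideal.Quotient.mk P.asIdeal)) j
        rw [RingHom.comp_apply, Ideal.Quotient.eq_zero_iff_mem.2 (hJ j hj), map_zero] at h1
        exact h1.symm
      have h2 : ((moment v j.1).map (D i)) j.2.1 j.2.2 = 0 := by
        rw [Matrix.map_apply, h0, map_zero]
      rw [moment, Matrix.map_sub _ (map_sub (D i)), map_derivation_mul, map_derivation_mul] at h2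
      let α := matA fun x => D i (v x)
      let β := matB fun x => D i (v x)
      have h3 : (β j.1 * matA v j.1 + matB v j.1 * α j.1 - (α (j.1 + 1) * matB v (j.1 + 1) +
        matA v (j.1 + 1) * β (j.1 + 1))) j.2.1 j.2.2 = 0 := h2
      change (β j.1 * matA v j.1 + matB v j.1 * α j.1 - matA v (j.1 + 1) * β (j.1 + 1) -
        α (j.1 + 1) * matB v (j.1 + 1)) j.2.1 j.2.2 = 0
      simp only [Matrix.sub_apply, Matrix.add_apply] at h3 ⊢
      linear_combination h3
    | zero => simp
    | add x y _ _ hx hy =>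
      simp only [Prod.fst_add, Prod.snd_add, Pi.add_apply, Matrix.add_mul, Matrix.mul_add,
        Matrix.sub_apply, Matrix.add_apply] at hx hy ⊢
      linear_combination hx + hy
    | smul c x _ hx =>
      simp only [Prod.smul_fst, Prod.smul_snd, Pi.smul_apply, Matrix.smul_mul, Matrix.mul_smul,
        Matrix.sub_apply, Matrix.add_apply, Matrix.smul_apply, smul_eq_mul] at hx ⊢
      linear_combination c * hx

end Generic

end Richardson

namespace Richardson

open Module Matrix MvPolynomial

section Crux

variable {r : ℕ → ℕ} {F : Type} [Field F] {k : ℕ}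

lemma exists_lift_section [Fintype (MomentIdx r)] (hk : ∀ i, k ≤ i → r i = 0)
    (𝔮 : Ideal (MvPolynomial (RepVar r) F)) [𝔮.IsPrime] {K : Type} [Field K]
    [Algebra (MvPolynomial (RepVar r) F ⧸ 𝔮) K] [IsFractionRing (MvPolynomial (RepVar r) F ⧸ 𝔮) K]
    (hE : matChainEnd (matA fun x => algebraMap (MvPolynomial (RepVar r) F ⧸ 𝔮) K
        (Ideal.Quotient.mk 𝔮 (X x))) = ⊥) :
    ∃ (Y : MomentIdx r → (Σ i : ℕ, Fin (r (i + 1)) × Fin (r i)) → MvPolynomial (RepVar r) F)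
      (δ : MvPolynomial (RepVar r) F), δ ∉ 𝔮 ∧ ∀ j j' : MomentIdx r,
        Ideal.Quotient.mk 𝔮 (moment (Sum.elim (fun x => X (Sum.inl x)) (Y j)) j'.1 j'.2.1 j'.2.2) =
          if j' = j then Ideal.Quotient.mk 𝔮 δ else 0 := by
  set v : RepVar r → K := fun x => algebraMap (MvPolynomial (RepVar r) F ⧸ 𝔮) K
    (Ideal.Quotient.mk 𝔮 (X x)) with hv
  have h1 := card_le_finrank_range_momentLinOn hk (matA v) Finset.univ
  rw [hE, finrank_bot, add_zero] at h1
  have htop : LinearMap.range (momentLinOn (matA v) Finset.univ) = ⊤ := by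
    refine Submodule.eq_top_of_finrank_eq (le_antisymm (Submodule.finrank_le _) ?_)
    rwa [finrank_fintype_fun_eq_card, Fintype.card_coe]
  choose y hy using fun j : MomentIdx r => LinearMap.range_eq_top.1 htop
    (fun j' => if j'.1 = j then 1 else 0)
  have := finite_sigma_fin (T := fun i => Fin (r (i + 1)) × Fin (r i)) (k := k) fun i hi => by
    rw [hk i hi]; infer_instance
  obtain ⟨b, hb⟩ := IsLocalization.exist_integer_multiples_of_finite
    (nonZeroDivisors (MvPolynomial (RepVar r) F ⧸ 𝔮))
    (fun x : MomentIdx r × (Σ i : ℕ, Fin (r (i + 1)) × Fin (r i)) =>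
      y x.1 x.2.1 x.2.2.1 x.2.2.2)
  choose z hz using hb
  choose Y hY using fun x => Ideal.Quotient.mk_surjective (z x)
  obtain ⟨δ, hδ⟩ := Ideal.Quotient.mk_surjective b.1
  refine ⟨fun j x => Y (j, x), δ, ?_, fun j j' => ?_⟩
  · rw [← Ideal.Quotient.eq_zero_iff_mem, hδ]
    exact nonZeroDivisors.ne_zero b.2
  · apply IsFractionRing.injective (MvPolynomial (RepVar r) F ⧸ 𝔮) K
    have h2 := congrFun (congrFun (moment_comp
      ((algebraMap (MvPolynomial (RepVar r) F ⧸ 𝔮) K).comp (Ideal.Quotient.mk 𝔮))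
      (Sum.elim (fun x => X (Sum.inl x)) fun x => Y (j, x)) j'.1) j'.2.1) j'.2.2
    rw [Matrix.map_apply] at h2
    refine h2.symm.trans ?_
    rw [moment_eq_momentLin]
    have h3 : matB (((algebraMap (MvPolynomial (RepVar r) F ⧸ 𝔮) K).comp (Ideal.Quotient.mk 𝔮)) ∘
        (Sum.elim (fun x => X (Sum.inl x)) fun x => Y (j, x))) =
        algebraMap (MvPolynomial (RepVar r) F ⧸ 𝔮) K b.1 • y j := by
      funext i
      ext p q
      have := hz (j, ⟨i, p, q⟩)
      change algebraMap (MvPolynomial (RepVar r) F ⧸ 𝔮) K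
        (Ideal.Quotient.mk 𝔮 (Y (j, ⟨i, p, q⟩))) = _
      rw [hY, this]
      exact algebra_compatible_smul K b.1 _
    rw [h3]
    change momentLin (matA v) (_ • y j) j'.1 j'.2.1 j'.2.2 = _
    rw [map_smul]
    have h4 := congrFun (hy j) ⟨j', Finset.mem_univ _⟩
    rw [momentLinOn_apply] at h4
    change _ * momentLin (matA v) (y j) j'.1 j'.2.1 j'.2.2 = _
    rw [h4, hδ]
    split_ifs <;> simp

/-- A polynomial which vanishes on the zero fibre of the moment map and is homogeneous in the
second family of matrices lies in the ideal of the entries of the moment map. -/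
theorem mem_span_momentPoly [CharZero F] [Finite (RepVar r)] [Finite (MomentIdx r)]
    (hk : ∀ i, k ≤ i → r i = 0)
    (hconv : ∀ i, 2 * r (i + 1) ≤ r i + r (i + 2)) {f : MvPolynomial (RepVar r) F} {e d : ℕ}
    (hf : f.IsHomogeneous e) (hfB : ∀ c : MvPolynomial (RepVar r) F,
      aeval (Sum.elim (fun x => X (Sum.inl x)) fun x => c * X (Sum.inr x)) f = c ^ d * f)
    (hzero : ∀ u : RepVar r → F, (∀ i, moment u i = 0) → eval u f = 0) :
    f ∈ Ideal.span (Set.range (momentPoly r F)) := by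
  classical
  have := Fintype.ofFinite (RepVar r)
  have := Fintype.ofFinite (MomentIdx r)
  set ms := (Finset.univ : Finset (MomentIdx r)).toList.map (momentPoly r F) with hms
  have hofList : Ideal.ofList ms = Ideal.span (Set.range (momentPoly r F)) := by
    rw [Ideal.ofList]
    congr 1
    ext p
    simp [hms]
  by_contra hcon
  rw [← hofList] at hcon
  have hlen : ms.length = (Finset.univ : Finset (MomentIdx r)).card := by simp [hms]
  have hlen' : ms.length ≤ Fintype.card (RepVar r) := by
    have h1 := finrank_tangent_add_card_le (K := F) hk (fun _ => 0) hconv (fun _ => 0) Finset.univ ⊥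
      (fun w hw => by
        rw [(Submodule.mem_bot F).1 hw]
        exact Submodule.zero_mem _) (fun w hw j _ => by
        rw [(Submodule.mem_bot F).1 hw]
        simp)
    rw [card_repVar hk, hlen]
    omega
  obtain ⟨P, hP, hch⟩ := exists_hasChain_of_notMem ms hlen' (fun p hp => by
      obtain ⟨j, -, rfl⟩ := List.mem_map.1 hp
      exact ⟨2, two_pos, isHomogeneous_momentPoly j⟩) (by
      intro l₁ x l₂ h P hle hchP
      obtain ⟨L₁, L₂, hL, rfl, h2⟩ := List.map_eq_append_iff.1 h
      obtain ⟨j, L₃, rfl, rfl, rfl⟩ := List.map_eq_cons_iff.1 h2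
      have hnd := hL ▸ (Finset.univ : Finset (MomentIdx r)).nodup_toList
      have hnd' : (L₁ ++ [j]).Nodup := by
        rw [List.append_cons] at hnd
        exact hnd.of_append_left
      have h3 := (add_card_le_of_hasChain hk hconv hchP (L₁ ++ [j]).toFinset (fun j' hj' =>
        hle (Ideal.subset_span (List.mem_toFinset.1 hj' |> fun h => by
          have := List.mem_map_of_mem (f := momentPoly r F) h
          simpa using this)))
        (K := FractionRing (MvPolynomial (RepVar r) F ⧸ P.asIdeal))).1
      rw [List.toFinset_card_of_nodup hnd'] at h3
      have h4 : L₁.length + 1 ≤ ms.length := by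
        rw [h]
        simp
      simp only [List.length_append, List.length_map, List.length_singleton] at h3
      omega) hf hcon
  have hIP : Ideal.ofList ms ≤ P.asIdeal := fun a ha => hP a (Ideal.mul_mem_right _ _ ha)
  have hE := (add_card_le_of_hasChain hk hconv hch Finset.univ (fun j _ =>
      hIP (hofList ▸ Ideal.subset_span ⟨j, rfl⟩))
      (K := FractionRing (MvPolynomial (RepVar r) F ⧸ P.asIdeal))).2
  rw [← hlen] at hE
  have hE' := not_imp_comm.1 hE (by omega)
  obtain ⟨Y, δ, hδ, hY⟩ := exists_lift_section hk P.asIdeal hE'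
  let M : Matrix (MomentIdx r) (MomentIdx r) (MvPolynomial (RepVar r) F) := Matrix.of fun j' j =>
    moment (Sum.elim (fun x => X (Sum.inl x)) (Y j)) j'.1 j'.2.1 j'.2.2
  have hM : M.det ∉ P.asIdeal := by
    rw [← Ideal.Quotient.eq_zero_iff_mem, RingHom.map_det]
    have : (Ideal.Quotient.mk P.asIdeal).mapMatrix M =
        Matrix.diagonal fun _ => Ideal.Quotient.mk P.asIdeal δ := by
      ext j' j
      rw [Matrix.diagonal_apply]
      exact hY j j'
    rw [this, det_diagonal, Finset.prod_const]
    exact pow_ne_zero _ (mt Ideal.Quotient.eq_zero_iff_mem.1 hδ)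
  let c : MomentIdx r → MvPolynomial (RepVar r) F := M.adjugate *ᵥ momentPoly r F
  have hc : ∀ j, c j ∈ Ideal.ofList ms := fun j => Ideal.sum_mem _ fun j' _ =>
    Ideal.mul_mem_left _ _ (hofList ▸ Ideal.subset_span ⟨j', rfl⟩)
  let w : RepVar r → MvPolynomial (RepVar r) F := Sum.elim (fun x => X (Sum.inl x))
    fun x => M.det * X (Sum.inr x) - ∑ j, c j * Y j x
  have hw : ∀ i, moment w i = 0 := by
    intro i
    have h1 : matB w = M.det • matB X - ∑ j, c j •
        matB (Sum.elim (fun x => X (Sum.inl x)) (Y j)) := by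
      funext i
      ext p q
      simp [w, matB, Matrix.sum_apply]
    rw [moment_eq_momentLin, h1, map_sub, map_sum, map_smul]
    refine Matrix.ext fun p q => ?_
    have h2 := congrFun (congrArg (fun N => N *ᵥ momentPoly r F) M.mul_adjugate) ⟨i, p, q⟩
    simp only [Matrix.smul_mulVec, one_mulVec, ← mulVec_mulVec] at h2
    simp only [map_smul, Pi.sub_apply, Matrix.sub_apply, Pi.smul_apply, Matrix.smul_apply,
      Finset.sum_apply, Matrix.sum_apply, Matrix.zero_apply, sub_eq_zero]
    refine h2.symm.trans ?_
    exact Finset.sum_congr rfl fun j _ => mul_comm _ _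
  have hw0 : aeval w f = 0 := by
    refine MvPolynomial.funext fun u => ?_
    rw [map_zero, ← hzero (fun x => eval u (w x)) fun i => ?_]
    · have := DFunLike.congr_fun (comp_aeval w (aeval u)) f
      exact this
    · have := moment_comp (eval u) w i
      rw [hw i] at this
      refine this.trans ?_
      ext p q
      simp
  have h1 := hfB M.det
  have h2 : Ideal.Quotient.mk (Ideal.ofList ms) (aeval w f) = Ideal.Quotient.mk (Ideal.ofList ms)
      (aeval (Sum.elim (fun x => X (Sum.inl x)) fun x => M.det * X (Sum.inr x)) f) := by
    have h3 := fun w : RepVar r → MvPolynomial (RepVar r) F =>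
      (DFunLike.congr_fun (comp_aeval w (Ideal.Quotient.mkₐ F (Ideal.ofList ms))) f)
    refine (h3 _).trans (Eq.trans ?_ (h3 _).symm)
    congr 2
    funext x
    rcases x with x | x
    · rfl
    · refine Ideal.Quotient.eq.2 ?_
      simp only [w, Sum.elim_inr, sub_sub_cancel_left]
      exact neg_mem (Ideal.sum_mem _ fun j _ => Ideal.mul_mem_right _ _ (hc j))
  rw [hw0, map_zero, h1, eq_comm, Ideal.Quotient.eq_zero_iff_mem] at h2
  exact hM (P.2.mem_of_pow_mem _ (hP _ h2))

end Crux

end Richardson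

namespace Richardson

open Module

section Flag

variable {K : Type*} [Field K]

lemma exists_submodule_between {V : Type*} [AddCommGroup V] [Module K V] [FiniteDimensional K V]
    {A B : Submodule K V} (hAB : A ≤ B) (m : ℕ) (hm : finrank K A + m ≤ finrank K B) :
    ∃ F : Submodule K V, A ≤ F ∧ F ≤ B ∧ finrank K F = finrank K A + m := by
  induction m with
  | zero => exact ⟨A, le_rfl, hAB, rfl⟩
  | succ m ih =>
    obtain ⟨F, h1, h2, h3⟩ := ih (by omega)
    have hlt : ¬ B ≤ F := fun h => by
      have := Submodule.finrank_mono h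
      omega
    obtain ⟨v, hvB, hvF⟩ := SetLike.not_le_iff_exists.1 hlt
    refine ⟨F ⊔ Submodule.span K {v}, h1.trans le_sup_left,
      sup_le h2 ((Submodule.span_singleton_le_iff_mem _ _).2 hvB), ?_⟩
    rw [Submodule.finrank_sup_span_singleton hvF, h3]
    omega

lemma exists_submodule_comparable {V : Type*} [AddCommGroup V] [Module K V] [FiniteDimensional K V]
    {E : ℕ → Submodule K V} (hE : Antitone E) {c N : ℕ} (hc : c ≤ finrank K (E 0))
    (hN : E N = ⊥) :
    ∃ F ≤ E 0, finrank K F = c ∧ ∀ j, F ≤ E j ∨ E j ≤ F := by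
  rcases Nat.eq_zero_or_pos c with rfl | hpos
  · exact ⟨⊥, bot_le, finrank_bot _ _, fun j => Or.inl bot_le⟩
  have hex : ∃ j, finrank K (E j) < c := ⟨N, by rw [hN, finrank_bot]; exact hpos⟩
  classical
  obtain ⟨j, hj⟩ : ∃ j, Nat.find hex = j + 1 := Nat.exists_eq_succ_of_ne_zero fun h0 => by
    have := Nat.find_spec hex
    rw [h0] at this
    omega
  have h1 : finrank K (E (j + 1)) < c := hj ▸ Nat.find_spec hex
  have h2 : c ≤ finrank K (E j) := not_lt.1 (Nat.find_min hex (by omega))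
  obtain ⟨F, hF1, hF2, hF3⟩ := exists_submodule_between (hE (Nat.le_succ j))
    (c - finrank K (E (j + 1))) (by rw [Nat.succ_eq_add_one]; omega)
  refine ⟨F, hF2.trans (hE (Nat.zero_le j)), by rw [hF3, Nat.succ_eq_add_one]; omega, fun i => ?_⟩
  rcases Nat.lt_or_ge j i with h | h
  · exact Or.inr ((hE h).trans hF1)
  · exact Or.inl (hF2.trans (hE h))

lemma finrank_comap_eq {V : Type*} [AddCommGroup V] [Module K V] [FiniteDimensional K V]
    (f : V →ₗ[K] V) (F : Submodule K V) :
    finrank K (F.comap f) = finrank K (LinearMap.ker f) + finrank K (LinearMap.range f ⊓ F : Submodule K V) := by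
  have h := LinearMap.finrank_range_add_finrank_ker (f.domRestrict (F.comap f))
  have h1 : LinearMap.range (f.domRestrict (F.comap f)) = LinearMap.range f ⊓ F := by
    rw [LinearMap.range_domRestrict, Submodule.map_comap_eq]
  have h2 : finrank K (LinearMap.ker (f.domRestrict (F.comap f))) = finrank K (LinearMap.ker f) := by
    rw [LinearMap.ker_domRestrict]
    rw [← Submodule.finrank_map_subtype_eq, Submodule.map_comap_subtype, inf_eq_right.2]
    intro x hx
    rw [Submodule.mem_comap, LinearMap.mem_ker.1 hx]
    exact zero_mem _
  rw [h1, h2] at h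
  omega

theorem exists_basis_flag (k : ℕ) : ∀ {V : Type*} [AddCommGroup V] [Module K V]
    [FiniteDimensional K V] (X : V →ₗ[K] V) (n : Fin k → ℕ), ∑ i, n i = finrank K V →
    (∀ T : Finset (Fin k), ∑ i ∈ T, n i ≤ finrank K (LinearMap.ker (X ^ T.card))) →
    ∃ b : Basis (Σ i : Fin k, Fin (n i)) K V, ∀ x y, ¬ y.1 < x.1 → b.repr (X (b x)) y = 0 := by
  induction k with
  | zero =>
    intro V _ _ _ X n hn _
    have : Subsingleton V := finrank_zero_iff.1 (by rw [← hn]; simp)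
    exact ⟨Basis.empty V, fun x => x.1.elim0⟩
  | succ k ih =>
    intro V _ _ _ X n hn hT
    have hpow : X ^ (k + 1) = 0 := by
      have := hT Finset.univ
      rw [hn, Finset.card_univ, Fintype.card_fin] at this
      exact LinearMap.ker_eq_top.1 (Submodule.eq_top_of_finrank_eq
        (le_antisymm (Submodule.finrank_le _) this))
    obtain ⟨F, hF0, hFc, hFE⟩ := exists_submodule_comparable
      (E := fun j => LinearMap.range (X ^ j) ⊓ LinearMap.ker X) (c := n 0) (N := k + 1)
      (fun i j hij => inf_le_inf_right _ (by
        obtain ⟨l, rfl⟩ := Nat.exists_eq_add_of_le hij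
        rw [pow_add]
        exact LinearMap.range_comp_le_range _ _))
      (by
        have := hT {0}
        rw [Finset.sum_singleton, Finset.card_singleton, pow_one] at this
        rw [pow_zero, Module.End.one_eq_id, LinearMap.range_id, top_inf_eq]
        exact this)
      (by rw [hpow, LinearMap.range_zero, bot_inf_eq])
    have hFX : F ≤ LinearMap.ker X := hF0.trans inf_le_right
    have hFc' : F ≤ F.comap X := fun x hx => by
      rw [Submodule.mem_comap, LinearMap.mem_ker.1 (hFX hx)]
      exact zero_mem _
    have hdim := Submodule.finrank_quotient_add_finrank F
    obtain ⟨b', hb'⟩ := ih (F.mapQ F X hFc') (fun i => n i.succ) (by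
      rw [Fin.sum_univ_succ] at hn
      omega) (fun T => by
        have hle : F ≤ F.comap (X ^ T.card) := Submodule.le_comap_pow_of_le_comap F hFc' _
        rw [← Submodule.mapQ_pow, Submodule.ker_mapQ]
        have h1 : finrank K (Submodule.map F.mkQ (F.comap (X ^ T.card))) + n 0 =
            finrank K (F.comap (X ^ T.card)) := by
          have h := LinearMap.finrank_range_add_finrank_ker (F.mkQ.domRestrict (F.comap (X ^ T.card)))
          rw [LinearMap.range_domRestrict, LinearMap.ker_domRestrict, Submodule.ker_mkQ,
            ← Submodule.finrank_map_subtype_eq, Submodule.map_comap_subtype, inf_eq_right.2 hle, hFc] at h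
          exact h
        have h2 := finrank_comap_eq (X ^ T.card) F
        rcases T.eq_empty_or_nonempty with rfl | hne
        · simp
        rcases hFE T.card with h | h
        · rw [inf_eq_right.2 (h.trans inf_le_left), hFc] at h2
          have h3 := hT (T.map (Fin.succEmb k))
          rw [Finset.sum_map, Finset.card_map] at h3
          simp only [Fin.coe_succEmb] at h3
          omega
        · have h4 : LinearMap.range (X ^ T.card) ⊓ F = LinearMap.range (X ^ T.card) ⊓ LinearMap.ker X :=
            le_antisymm (inf_le_inf_left _ hFX) (le_inf inf_le_left h)
          have h5 := finrank_comap_eq (X ^ T.card) (LinearMap.ker X)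
          rw [← LinearMap.ker_comp, ← Module.End.mul_eq_comp, ← pow_succ'] at h5
          have h3 := hT (Finset.cons 0 (T.map (Fin.succEmb k)) (by simp))
          rw [Finset.sum_cons, Finset.sum_map, Finset.card_cons, Finset.card_map] at h3
          simp only [Fin.coe_succEmb] at h3
          rw [h4] at h2
          omega)
    let bF : Basis (Fin (n 0)) K F := (finBasis K F).reindex (finCongr hFc)
    let e : (Σ i : Fin (k + 1), Fin (n i)) ≃ Fin (n 0) ⊕ Σ i : Fin k, Fin (n i.succ) :=
      { toFun := fun x => Fin.cases (motive := fun i => Fin (n i) → _) Sum.inl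
          (fun i a => Sum.inr ⟨i, a⟩) x.1 x.2
        invFun := Sum.elim (fun a => ⟨0, a⟩) (fun x => ⟨x.1.succ, x.2⟩)
        left_inv := by
          rintro ⟨i, a⟩
          induction i using Fin.cases <;> rfl
        right_inv := by rintro (a | x) <;> rfl }
    refine ⟨(bF.sumQuot b').reindex e.symm, ?_⟩
    rintro ⟨i, a⟩ ⟨j, c⟩ hij
    simp only [Basis.reindex_apply, Basis.repr_reindex_apply, Equiv.symm_symm]
    induction i using Fin.cases with
    | zero =>
      have : X ((bF.sumQuot b') (e ⟨0, a⟩)) = 0 := by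
        change X ((bF.sumQuot b') (Sum.inl a)) = 0
        rw [Basis.sumQuot_inl]
        exact hFX (bF a).2
      rw [this]
      simp
    | succ i =>
      induction j using Fin.cases with
      | zero => exact absurd (Fin.succ_pos i) hij
      | succ j =>
        have := hb' ⟨i, a⟩ ⟨j, c⟩ (fun h => hij (Fin.succ_lt_succ_iff.2 h))
        change (bF.sumQuot b').repr (X ((bF.sumQuot b') (Sum.inr ⟨i, a⟩))) (Sum.inr ⟨j, c⟩) = 0
        rw [Basis.sumQuot_repr_inr, Submodule.mkQ_apply, ← Submodule.mapQ_apply F F X (h := hFc'),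
          Basis.sumQuot_inr]
        exact this

end Flag

end Richardson

namespace Richardson

open Module Matrix

section RankCondition

variable {K : Type*} [Field K] {r : ℕ}

lemma coe_mul_coe_inv (g : SpecialLinearGroup (Fin r) K) :
    (g : Matrix (Fin r) (Fin r) K) * ((g⁻¹ : SpecialLinearGroup (Fin r) K) :
      Matrix (Fin r) (Fin r) K) = 1 :=
  congrArg Subtype.val (mul_inv_cancel g)

lemma coe_inv_mul_coe (g : SpecialLinearGroup (Fin r) K) :
    ((g⁻¹ : SpecialLinearGroup (Fin r) K) : Matrix (Fin r) (Fin r) K) *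
      (g : Matrix (Fin r) (Fin r) K) = 1 :=
  congrArg Subtype.val (inv_mul_cancel g)

lemma exists_conj_of_mul_eq {X P N : Matrix (Fin r) (Fin r) K} (hP : P.det ≠ 0)
    (h : X * P = P * N) :
    ∃ g : SpecialLinearGroup (Fin r) K, ∃ w : Fin r → K,
      X = (g : Matrix (Fin r) (Fin r) K) * (Matrix.diagonal w⁻¹ * N * Matrix.diagonal w) *
        ((g⁻¹ : SpecialLinearGroup (Fin r) K) : Matrix (Fin r) (Fin r) K) := by
  obtain ⟨w, hw0, hw⟩ : ∃ w : Fin r → K, (∀ i, w i ≠ 0) ∧ (P * Matrix.diagonal w).det = 1 := by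
    rcases Nat.eq_zero_or_pos r with rfl | hr
    · exact ⟨1, fun i => i.elim0, by simp⟩
    · refine ⟨Function.update 1 ⟨0, hr⟩ P.det⁻¹, fun i => ?_, ?_⟩
      · rw [Function.update_apply]
        split_ifs
        · exact inv_ne_zero hP
        · exact one_ne_zero
      · rw [det_mul, det_diagonal, Finset.prod_update_of_mem (Finset.mem_univ _)]
        simp [hP]
  refine ⟨⟨_, hw⟩, w, ?_⟩
  let g : SpecialLinearGroup (Fin r) K := ⟨_, hw⟩
  have hww : Matrix.diagonal w * Matrix.diagonal w⁻¹ = 1 := by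
    rw [diagonal_mul_diagonal, ← diagonal_one]
    congr 1
    ext i
    exact mul_inv_cancel₀ (hw0 i)
  have h1 : (g : Matrix (Fin r) (Fin r) K) * (Matrix.diagonal w⁻¹ * N * Matrix.diagonal w) =
      X * (g : Matrix (Fin r) (Fin r) K) := by
    change P * Matrix.diagonal w * (Matrix.diagonal w⁻¹ * N * Matrix.diagonal w) =
      X * (P * Matrix.diagonal w)
    calc _ = P * (Matrix.diagonal w * Matrix.diagonal w⁻¹) * N * Matrix.diagonal w := by
          simp only [Matrix.mul_assoc]
      _ = _ := by rw [hww, Matrix.mul_one, ← h, Matrix.mul_assoc]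
  rw [h1, Matrix.mul_assoc, coe_mul_coe_inv, Matrix.mul_one]

theorem exists_conj_of_rank_pow_le {k : ℕ} {blk : Fin r → ℕ} (hblk : ∀ i, blk i < k)
    (X : Matrix (Fin r) (Fin r) K)
    (hX : ∀ T : Finset (Fin k), ∑ b ∈ T, (Finset.univ.filter fun i => blk i = b).card +
      (X ^ T.card).rank ≤ r) :
    ∃ g : SpecialLinearGroup (Fin r) K, ∃ nm : Matrix (Fin r) (Fin r) K,
      (∀ i j : Fin r, ¬ (blk i < blk j) → nm i j = 0) ∧
      X = (g : Matrix (Fin r) (Fin r) K) * nm *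
        ((g⁻¹ : SpecialLinearGroup (Fin r) K) : Matrix (Fin r) (Fin r) K) := by
  let n : Fin k → ℕ := fun b => (Finset.univ.filter fun i => blk i = b).card
  have hn : ∑ b, n b = finrank K (Fin r → K) := by
    rw [finrank_fin_fun]
    have := Finset.card_eq_sum_card_fiberwise (s := (Finset.univ : Finset (Fin r)))
      (t := (Finset.univ : Finset (Fin k))) (f := fun i => ⟨blk i, hblk i⟩) (by simp)
    rw [Finset.card_univ, Fintype.card_fin] at this
    rw [this]
    refine Finset.sum_congr rfl fun b _ => ?_
    refine congrArg Finset.card (Finset.ext fun i => ?_)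
    simp [Fin.ext_iff]
  obtain ⟨b, hb⟩ := exists_basis_flag k (Matrix.toLin' X) n hn fun T => by
    have h1 := LinearMap.finrank_range_add_finrank_ker (Matrix.toLin' X ^ T.card)
    have h2 := hX T
    rw [← Matrix.toLin'_pow, finrank_fin_fun] at h1
    rw [← Matrix.toLin'_pow]
    have h3 : (X ^ T.card).rank = finrank K (LinearMap.range (Matrix.toLin' (X ^ T.card))) := rfl
    change ∑ b ∈ T, n b + _ ≤ _ at h2
    omega
  let e : Fin r ≃ Σ b : Fin k, Fin (n b) :=
    Equiv.ofFiberEquiv (f := fun i => (⟨blk i, hblk i⟩ : Fin k)) (g := Sigma.fst) fun c =>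
      Fintype.equivOfCardEq (by
        rw [Fintype.card_congr (Equiv.sigmaSubtype c), Fintype.card_fin, Fintype.card_subtype]
        refine congrArg Finset.card (Finset.ext fun i => ?_)
        simp [Fin.ext_iff])
  have he : ∀ i, ((e i).1 : ℕ) = blk i := fun i =>
    congrArg Fin.val (Equiv.ofFiberEquiv_map (f := fun i => (⟨blk i, hblk i⟩ : Fin k)) (g := Sigma.fst) _ i)
  let b' : Basis (Fin r) K (Fin r → K) := b.reindex e.symm
  let P := (Pi.basisFun K (Fin r)).toMatrix b'
  let N := LinearMap.toMatrix b' b' (Matrix.toLin' X)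
  have hPN : X * P = P * N := by
    have h1 := basis_toMatrix_mul_linearMap_toMatrix b' (Pi.basisFun K (Fin r)) b' (Matrix.toLin' X)
    have h2 := linearMap_toMatrix_mul_basis_toMatrix b' (Pi.basisFun K (Fin r)) (Pi.basisFun K (Fin r))
      (Matrix.toLin' X)
    rw [LinearMap.toMatrix_eq_toMatrix', LinearMap.toMatrix'_toLin'] at h2
    exact h2.trans h1.symm
  have hdet : P.det ≠ 0 := by
    have := (Pi.basisFun K (Fin r)).toMatrix_mul_toMatrix_flip b'
    have h := congrArg Matrix.det this
    rw [det_mul, det_one] at h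
    exact left_ne_zero_of_mul_eq_one h
  obtain ⟨g, w, hgw⟩ := exists_conj_of_mul_eq hdet hPN
  refine ⟨g, _, fun i j hij => ?_, hgw⟩
  have : N i j = 0 := by
    simp only [N, b', LinearMap.toMatrix_apply, Basis.reindex_apply, Basis.repr_reindex_apply,
      Equiv.symm_symm]
    refine hb _ _ fun h => hij ?_
    rw [← he, ← he]
    exact h
  rw [mul_diagonal, diagonal_mul, this, mul_zero, zero_mul]

end RankCondition

section Chain

variable {r : ℕ → ℕ} {K : Type*} [Field K]

lemma mul_mul_pow_succ {ι κ : Type*} [Fintype ι] [Fintype κ] [DecidableEq ι] [DecidableEq κ]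
    (A : Matrix ι κ K) (B : Matrix κ ι K) (j : ℕ) : (A * B) ^ (j + 1) = A * (B * A) ^ j * B := by
  induction j with
  | zero => simp
  | succ j ih =>
    rw [pow_succ, ih, pow_succ]
    simp only [Matrix.mul_assoc]

lemma rank_pow_le_of_moment_eq_zero {u : RepVar r → K} (hu : ∀ i, moment u i = 0) (j : ℕ) :
    ∀ i, ((matA u i * matB u i) ^ j).rank ≤ r (i + j) := by
  induction j with
  | zero =>
    intro i
    exact (rank_le_height _).trans le_rfl
  | succ j ih =>
    intro i
    rw [mul_mul_pow_succ, sub_eq_zero.1 (hu i)]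
    refine (rank_mul_le_left _ _).trans ((rank_mul_le_right _ _).trans ((ih (i + 1)).trans ?_))
    rw [show i + 1 + j = i + (j + 1) by ring]

end Chain

end Richardson

namespace Richardson

open Module Matrix

lemma sum_le_sum_range_card {f : ℕ → ℕ} (hf : Antitone f) (s : Finset ℕ) :
    ∑ i ∈ s, f i ≤ ∑ i ∈ Finset.range s.card, f i := by
  induction s using Finset.induction_on_max with
  | empty => simp
  | insert a s ha ih =>
    have has : a ∉ s := fun h => lt_irrefl _ (ha a h)
    rw [Finset.sum_insert has, Finset.card_insert_of_notMem has, Finset.sum_range_succ, add_comm]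
    refine add_le_add ih (hf ?_)
    have : s ⊆ Finset.range a := fun i hi => Finset.mem_range.2 (ha i hi)
    simpa using Finset.card_le_card this

section ChainDims

variable {r : ℕ}

/-- The numbers of indices of level at least `j`. -/
def chainDims (c : Fin r → ℕ) : ℕ → ℕ
  | 0 => r
  | j + 1 => (Finset.univ.filter fun i => j + 1 ≤ c i).card

lemma chainDims_eq (c : Fin r → ℕ) (j : ℕ) :
    chainDims c j = (Finset.univ.filter fun i => j ≤ c i).card := by
  cases j with
  | zero => simp [chainDims]
  | succ j => rfl

lemma chainDims_eq_add (c : Fin r → ℕ) (j : ℕ) :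
    chainDims c j = (Finset.univ.filter fun i => c i = j).card + chainDims c (j + 1) := by
  rw [chainDims_eq, chainDims_eq, ← Finset.card_union_of_disjoint]
  · refine congrArg Finset.card (Finset.ext fun i => ?_)
    simp only [Finset.mem_filter, Finset.mem_univ, true_and, Finset.mem_union]
    omega
  · rw [Finset.disjoint_left]
    intro i
    simp only [Finset.mem_filter, Finset.mem_univ, true_and]
    omega

lemma sum_range_add_chainDims (c : Fin r → ℕ) (j : ℕ) :
    ∑ a ∈ Finset.range j, (Finset.univ.filter fun i => c i = a).card + chainDims c j = r := by
  induction j with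
  | zero => simp [chainDims]
  | succ j ih =>
    rw [Finset.sum_range_succ, add_assoc, ← chainDims_eq_add, ih]

lemma chainDims_eq_zero {c : Fin r → ℕ} {k : ℕ} (hc : ∀ i, c i < k) {j : ℕ} (hj : k ≤ j) :
    chainDims c j = 0 := by
  rw [chainDims_eq, Finset.card_eq_zero, Finset.filter_eq_empty_iff]
  intro i _
  have := hc i
  omega

lemma two_mul_chainDims_le {c : Fin r → ℕ}
    (hc : Antitone fun a => (Finset.univ.filter fun i => c i = a).card) (j : ℕ) :
    2 * chainDims c (j + 1) ≤ chainDims c j + chainDims c (j + 2) := by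
  have h1 := chainDims_eq_add c j
  have h2 := chainDims_eq_add c (j + 1)
  have h3 : (Finset.univ.filter fun i => c i = j + 1).card ≤
    (Finset.univ.filter fun i => c i = j).card := hc (Nat.le_succ j)
  rw [show j + 1 + 1 = j + 2 from rfl] at h2
  omega

lemma exists_sorted_levels {k : ℕ} {blk : Fin r → ℕ} (hblk : ∀ i, blk i < k) :
    ∃ σ : Equiv.Perm (Fin k), Antitone fun a =>
      (Finset.univ.filter fun i => ((σ ⟨blk i, hblk i⟩ : Fin k) : ℕ) = a).card := by
  let n : Fin k → ℕᵒᵈ := fun b => OrderDual.toDual (Finset.univ.filter fun i => blk i = b).card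
  have hmono := Tuple.monotone_sort n
  refine ⟨(Tuple.sort n)⁻¹, fun a b hab => ?_⟩
  by_cases hb : b < k
  · have key : ∀ a (ha : a < k), (Finset.univ.filter fun i =>
        (((Tuple.sort n)⁻¹ ⟨blk i, hblk i⟩ : Fin k) : ℕ) = a).card =
        OrderDual.ofDual (n (Tuple.sort n ⟨a, ha⟩)) := by
      intro a ha
      change _ = (Finset.univ.filter fun i => blk i = Tuple.sort n ⟨a, ha⟩).card
      refine congrArg Finset.card (Finset.ext fun i => ?_)
      simp only [Finset.mem_filter, Finset.mem_univ, true_and]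
      have h := Equiv.Perm.inv_eq_iff_eq (f := Tuple.sort n) (x := ⟨blk i, hblk i⟩) (y := ⟨a, ha⟩)
      rwa [Fin.ext_iff, Fin.ext_iff] at h
    simp only
    rw [key a (hab.trans_lt hb), key b hb]
    exact hmono (show (⟨a, hab.trans_lt hb⟩ : Fin k) ≤ ⟨b, hb⟩ from hab)
  · simp only
    rw [Finset.card_eq_zero.2]
    · exact Nat.zero_le _
    · rw [Finset.filter_eq_empty_iff]
      intro i _ h
      exact hb (h ▸ Fin.is_lt _)

theorem exists_conj_of_moment_eq_zero {K : Type*} [Field K] {k : ℕ} {blk : Fin r → ℕ}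
    (hblk : ∀ i, blk i < k) (σ : Equiv.Perm (Fin k)) {c : Fin r → ℕ}
    (hσ : ∀ i, c i = (σ ⟨blk i, hblk i⟩ : Fin k))
    (hc : Antitone fun a => (Finset.univ.filter fun i => c i = a).card)
    {u : RepVar (chainDims c) → K} (hu : ∀ i, moment u i = 0) :
    ∃ g : SpecialLinearGroup (Fin r) K, ∃ nm : Matrix (Fin r) (Fin r) K,
      (∀ i j : Fin r, ¬ (blk i < blk j) → nm i j = 0) ∧
      (matA u 0 * matB u 0 : Matrix (Fin r) (Fin r) K) = (g : Matrix (Fin r) (Fin r) K) * nm *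
        ((g⁻¹ : SpecialLinearGroup (Fin r) K) : Matrix (Fin r) (Fin r) K) := by
  refine exists_conj_of_rank_pow_le hblk _ fun T => ?_
  have h1 : ((matA u 0 * matB u 0) ^ T.card).rank ≤ chainDims c T.card :=
    (rank_pow_le_of_moment_eq_zero hu T.card 0).trans_eq (congrArg _ (zero_add _))
  have h2 := sum_range_add_chainDims c T.card
  have h3 := sum_le_sum_range_card hc (T.map (σ.toEmbedding.trans Fin.valEmbedding))
  rw [Finset.sum_map, Finset.card_map] at h3
  have h4 : ∑ b ∈ T, (Finset.univ.filter fun i => blk i = b).card =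
      ∑ b ∈ T, (Finset.univ.filter fun i => c i =
        (σ.toEmbedding.trans Fin.valEmbedding) b).card := by
    refine Finset.sum_congr rfl fun b _ => congrArg Finset.card (Finset.ext fun i => ?_)
    simp [hσ, Fin.val_inj, Fin.ext_iff]
  rw [h4]
  exact (add_le_add h3 h1).trans h2.le

end ChainDims

end Richardson

namespace Richardson

open Matrix
open scoped ComplexOrder

section Density

variable {n : Type*} [Fintype n] [DecidableEq n]

lemma unitary_norm_det_eq_one {W : Matrix n n ℂ} (h : Wᴴ * W = 1) : ‖W.det‖ = 1 := by
  have h1 := congrArg Matrix.det h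
  rw [det_mul, det_conjTranspose, det_one] at h1
  have h2 := congrArg norm h1
  rw [norm_mul, norm_star, norm_one] at h2
  nlinarith [norm_nonneg W.det]

/-- A complex curve through an invertible matrix whose imaginary times are unitary. -/
theorem exists_entire_path {g : Matrix n n ℂ} (hg : g.det ≠ 0) :
    ∃ γ : ℂ → Matrix n n ℂ, (∀ i j, Differentiable ℂ fun s => γ s i j) ∧ γ 1 = g ∧
      (∀ θ : ℝ, γ (θ * Complex.I) ∈ unitaryGroup n ℂ) ∧ (g.det = 1 → ∀ s, (γ s).det = 1) := by
  have hpd : (gᴴ * g).PosDef := PosDef.conjTranspose_mul_self g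
    (mulVec_injective_iff_isUnit.2 ((isUnit_iff_isUnit_det _).2 (isUnit_iff_ne_zero.2 hg)))
  let lam := hpd.isHermitian.eigenvalues
  have hlam : ∀ i, 0 < lam i := hpd.eigenvalues_pos
  let V : Matrix n n ℂ := hpd.isHermitian.eigenvectorUnitary
  have hV : V * Vᴴ = 1 := mem_unitaryGroup_iff.1 hpd.isHermitian.eigenvectorUnitary.2
  have hV' : Vᴴ * V = 1 := mem_unitaryGroup_iff'.1 hpd.isHermitian.eigenvectorUnitary.2
  have hspec : gᴴ * g = V * diagonal (fun i => (lam i : ℂ)) * Vᴴ := hpd.isHermitian.spectral_theorem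
  let t : n → ℝ := fun i => Real.log (lam i) / 2
  let D : ℂ → Matrix n n ℂ := fun s => diagonal fun i => Complex.exp (s * t i)
  have hDmul : ∀ s s', D s * D s' = D (s + s') := fun s s' => by
    simp only [D, diagonal_mul_diagonal, ← Complex.exp_add, add_mul]
  have hD0 : D 0 = 1 := by simp [D]
  have hDstar : ∀ s, (D s)ᴴ = D (star s) := fun s => by
    simp only [D, diagonal_conjTranspose]
    congr 1
    ext i
    simp [← Complex.exp_conj]
  have hD2 : D 2 = diagonal (fun i => (lam i : ℂ)) := by
    simp only [D]
    congr 1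
    ext i
    rw [show (2 : ℂ) * (t i : ℂ) = ((2 * t i : ℝ) : ℂ) by push_cast; ring, ← Complex.ofReal_exp]
    simp only [t]
    rw [mul_div_cancel₀ _ (two_ne_zero), Real.exp_log (hlam i)]
  let W := g * V * D (-1)
  have hW : Wᴴ * W = 1 := by
    have : Wᴴ * W = D (-1) * (Vᴴ * (gᴴ * g) * V) * D (-1) := by
      simp only [W, conjTranspose_mul, hDstar, star_neg, star_one, Matrix.mul_assoc]
    rw [this, hspec, ← hD2]
    have h2 : Vᴴ * (V * D 2 * Vᴴ) * V = D 2 := by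
      calc _ = (Vᴴ * V) * D 2 * (Vᴴ * V) := by simp only [Matrix.mul_assoc]
        _ = _ := by rw [hV', Matrix.one_mul, Matrix.mul_one]
    rw [h2, hDmul, hDmul, show (-1 + 2 + -1 : ℂ) = 0 by ring, hD0]
  have h1 : W * D 1 * Vᴴ = g := by
    simp only [W]
    rw [Matrix.mul_assoc (g * V), hDmul, neg_add_cancel, hD0, Matrix.mul_one, Matrix.mul_assoc, hV,
      Matrix.mul_one]
  refine ⟨fun s => W * D s * Vᴴ, fun i j => ?_, h1, fun θ => ?_, fun hdet s => ?_⟩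
  · simp only [D, Matrix.mul_apply (M := W * _), mul_diagonal]
    fun_prop
  · rw [mem_unitaryGroup_iff']
    change (W * D (θ * Complex.I) * Vᴴ)ᴴ * (W * D (θ * Complex.I) * Vᴴ) = 1
    have : (W * D (θ * Complex.I) * Vᴴ)ᴴ * (W * D (θ * Complex.I) * Vᴴ) =
        V * (D (star (θ * Complex.I)) * (Wᴴ * W) * D (θ * Complex.I)) * Vᴴ := by
      simp only [conjTranspose_mul, hDstar, Matrix.mul_assoc, conjTranspose_conjTranspose]
    rw [this, hW, Matrix.mul_one, hDmul, show star ((θ : ℂ) * Complex.I) + θ * Complex.I = 0 by simp,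
      hD0, Matrix.mul_one, hV]
  · have hDdet : ∀ s, (D s).det = Complex.exp (s * ((∑ i, t i : ℝ) : ℂ)) := fun s => by
      simp only [D, det_diagonal, ← Complex.exp_sum, ← Finset.mul_sum, Complex.ofReal_sum]
    have hnW := unitary_norm_det_eq_one hW
    have hnV := unitary_norm_det_eq_one (W := Vᴴ) (by rw [conjTranspose_conjTranspose, hV])
    have hdet1 := congrArg Matrix.det h1
    rw [det_mul, det_mul, hDdet, one_mul, hdet] at hdet1
    have hn := congrArg norm hdet1
    rw [norm_mul, norm_mul, hnW, hnV, ← Complex.ofReal_exp, Complex.norm_real, norm_one, one_mul,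
      mul_one, Real.norm_of_nonneg (Real.exp_pos _).le, Real.exp_eq_one_iff] at hn
    rw [det_mul, det_mul, hDdet, ← hdet1, hn]
    simp

lemma differentiable_eval {σ : Type*} (p : MvPolynomial σ ℂ) {v : ℂ → σ → ℂ}
    (hv : ∀ i, Differentiable ℂ fun s => v s i) :
    Differentiable ℂ fun s => MvPolynomial.eval (v s) p := by
  induction p using MvPolynomial.induction_on with
  | C a => simp
  | add p q hp hq =>
    simp only [map_add]
    exact hp.add hq
  | mul_X p i hp =>
    simp only [map_mul, MvPolynomial.eval_X]
    exact hp.mul (hv i)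

lemma eq_zero_of_imaginary {f : ℂ → ℂ} (hf : Differentiable ℂ f)
    (h : ∀ θ : ℝ, f (θ * Complex.I) = 0) (s : ℂ) : f s = 0 := by
  refine AnalyticOnNhd.eqOn_zero_of_preconnected_of_frequently_eq_zero (𝕜 := ℂ)
    (U := Set.univ) (z₀ := 0) (fun z _ => hf.analyticAt z) isPreconnected_univ (Set.mem_univ _) ?_
    (Set.mem_univ s)
  rw [Filter.frequently_iff]
  intro U hU
  obtain ⟨ε, hε, hb⟩ := Metric.mem_nhdsWithin_iff.1 hU
  refine ⟨((ε / 2 : ℝ) : ℂ) * Complex.I, hb ⟨?_, ?_⟩, h _⟩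
  · rw [Metric.mem_ball, dist_zero_right, norm_mul, Complex.norm_I, mul_one, Complex.norm_real,
      Real.norm_of_nonneg (by linarith)]
    linarith
  · simp [hε.ne']

theorem eval_eq_zero_of_specialUnitary {p : MvPolynomial (n × n) ℂ}
    (hp : ∀ g ∈ specialUnitaryGroup n ℂ, MvPolynomial.eval (fun q => g q.1 q.2) p = 0)
    {g : Matrix n n ℂ} (hg : g.det = 1) : MvPolynomial.eval (fun q => g q.1 q.2) p = 0 := by
  obtain ⟨γ, h1, h2, h3, h4⟩ := exists_entire_path (g := g) (by rw [hg]; exact one_ne_zero)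
  have := eq_zero_of_imaginary (differentiable_eval p (v := fun s q => γ s q.1 q.2)
    fun q => h1 q.1 q.2) (fun θ => hp _ (mem_specialUnitaryGroup_iff.2 ⟨h3 θ, h4 hg _⟩)) 1
  rwa [h2] at this

theorem eq_zero_of_unitary {p : MvPolynomial (n × n) ℂ}
    (hp : ∀ g ∈ unitaryGroup n ℂ, MvPolynomial.eval (fun q => g q.1 q.2) p = 0) : p = 0 := by
  have key : p * (mvPolynomialX n n ℂ).det = 0 := by
    refine MvPolynomial.funext fun x => ?_
    rw [map_mul, map_zero, RingHom.map_det]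
    have hx : (MvPolynomial.eval x).mapMatrix (mvPolynomialX n n ℂ) = Matrix.of fun i j => x (i, j) := by
      ext i j
      simp [mvPolynomialX]
    rw [hx]
    by_cases hdet : (Matrix.of fun i j => x (i, j)).det = 0
    · rw [hdet, mul_zero]
    · obtain ⟨γ, h1, h2, h3, -⟩ := exists_entire_path hdet
      have := eq_zero_of_imaginary (differentiable_eval p (v := fun s q => γ s q.1 q.2)
        fun q => h1 q.1 q.2) (fun θ => hp _ (h3 θ)) 1
      rw [h2] at this
      rw [show MvPolynomial.eval x p = 0 from this, zero_mul]
  exact (mul_eq_zero.1 key).resolve_right (det_mvPolynomialX_ne_zero n ℂ)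

end Density

end Richardson

namespace Richardson

open Matrix MeasureTheory

section Mean

/-- A compact group carries an invariant mean on continuous functions. -/
theorem exists_mean (K : Type*) [Group K] [TopologicalSpace K] [IsTopologicalGroup K]
    [CompactSpace K] : ∃ I : C(K, ℂ) →ₗ[ℂ] ℂ, I 1 = 1 ∧
      (∀ (f f' : C(K, ℂ)) (g : K), (∀ x, f' x = f (g * x)) → I f' = I f) ∧
      (∀ f, ‖I f‖ ≤ ‖f‖) ∧
      ∀ (f : C(K, ℂ)) (x : K), (∀ x, 0 ≤ (f x).re) → (f x).re ≠ 0 → 0 < (I f).re := by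
  let _ : MeasurableSpace K := borel K
  have : BorelSpace K := ⟨rfl⟩
  let μ : Measure K := Measure.haarMeasure ⊤
  have hprob : IsProbabilityMeasure μ := ⟨by
    have := Measure.haarMeasure_self (K₀ := (⊤ : TopologicalSpace.PositiveCompacts K))
    simpa using this⟩
  have hint : ∀ f : C(K, ℂ), Integrable (fun x => f x) μ := fun f =>
    f.continuous.integrable_of_hasCompactSupport (HasCompactSupport.of_compactSpace _)
  refine ⟨⟨⟨fun f => ∫ x, f x ∂μ, fun f g => ?_⟩, fun c f => ?_⟩, ?_, ?_, ?_, ?_⟩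
  · simpa using integral_add (hint f) (hint g)
  · simpa using integral_const_mul c (fun x => f x)
  · simp
  · intro f f' g h
    change ∫ x, f' x ∂μ = ∫ x, f x ∂μ
    simp_rw [h]
    exact integral_mul_left_eq_self (fun x => f x) g
  · intro f
    change ‖∫ x, f x ∂μ‖ ≤ ‖f‖
    have := norm_integral_le_of_norm_le_const (μ := μ) (f := fun x => f x) (C := ‖f‖)
      (Filter.Eventually.of_forall fun x => f.norm_coe_le_norm x)
    simpa using this
  · intro f x h hx
    change 0 < (∫ x, f x ∂μ).re
    have h1 : (∫ x, f x ∂μ).re = ∫ x, (f x).re ∂μ := (integral_re (hint f)).symm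
    rw [h1]
    exact (Complex.continuous_re.comp f.continuous).integral_pos_of_hasCompactSupport_nonneg_nonzero
      (HasCompactSupport.of_compactSpace _) h hx

end Mean

section Groups

variable (n : Type*) [Fintype n] [DecidableEq n]

lemma isCompact_unitaryGroup : IsCompact (unitaryGroup n ℂ : Set (Matrix n n ℂ)) := by
  have h1 : IsCompact (Set.univ.pi fun _ : n => Set.univ.pi fun _ : n => Metric.closedBall (0 : ℂ) 1) :=
    isCompact_univ_pi fun _ => isCompact_univ_pi fun _ => isCompact_closedBall _ _
  refine h1.of_isClosed_subset ?_ fun g hg i _ j _ => ?_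
  · have : (unitaryGroup n ℂ : Set (Matrix n n ℂ)) = {g : Matrix n n ℂ | star g * g = 1} := by
      ext g
      exact mem_unitaryGroup_iff'
    rw [this]
    exact isClosed_eq (by fun_prop) continuous_const
  · rw [mem_closedBall_zero_iff]
    exact entry_norm_bound_of_unitary hg i j

lemma isCompact_specialUnitaryGroup :
    IsCompact (specialUnitaryGroup n ℂ : Set (Matrix n n ℂ)) := by
  refine (isCompact_unitaryGroup n).of_isClosed_subset ?_ fun g hg =>
    (mem_specialUnitaryGroup_iff.1 hg).1
  have : (specialUnitaryGroup n ℂ : Set (Matrix n n ℂ)) =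
      (unitaryGroup n ℂ : Set (Matrix n n ℂ)) ∩ {g : Matrix n n ℂ | g.det = 1} := by
    ext g
    exact mem_specialUnitaryGroup_iff
  rw [this]
  exact (isCompact_unitaryGroup n).isClosed.inter (isClosed_eq (by fun_prop) continuous_const)

instance compactSpace_unitaryGroup : CompactSpace (unitaryGroup n ℂ) :=
  isCompact_iff_compactSpace.1 (isCompact_unitaryGroup n)

instance compactSpace_specialUnitaryGroup : CompactSpace (specialUnitaryGroup n ℂ) :=
  isCompact_iff_compactSpace.1 (isCompact_specialUnitaryGroup n)

instance isTopologicalGroup_specialUnitaryGroup : IsTopologicalGroup (specialUnitaryGroup n ℂ) where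
  continuous_inv := by
    refine continuous_induced_rng.2 ?_
    change Continuous fun g : specialUnitaryGroup n ℂ => star (g : Matrix n n ℂ)
    exact continuous_subtype_val.star

end Groups

end Richardson

namespace Richardson

open Module Matrix MvPolynomial

section DoubleCommutant

/-- A linear map commuting with all equivariant maps comes from the group algebra. -/
theorem exists_eq_sum_of_commute {G V : Type*} [Group G] [Fintype G] [AddCommGroup V] [Module ℂ V]
    [FiniteDimensional ℂ V] (ρ : Representation ℂ G V) (f : V →ₗ[ℂ] V)
    (hf : ∀ φ : V →ₗ[ℂ] V, (∀ g, φ ∘ₗ ρ g = ρ g ∘ₗ φ) → f ∘ₗ φ = φ ∘ₗ f) :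
    ∃ c : G → ℂ, f = ∑ g, c g • ρ g := by
  classical
  let R := MonoidAlgebra ℂ G
  have hcard : NeZero (Nat.card G : ℂ) := ⟨Nat.cast_ne_zero.2 Nat.card_pos.ne'⟩
  have hss : IsSemisimpleModule R ρ.asModule := inferInstance
  have hsm : ∀ (g : G) (v : ρ.asModule), MonoidAlgebra.single g (1 : ℂ) • v = ρ g v := fun g v => by
    rw [Representation.single_smul, one_smul]
    rfl
  let F : End (End R ρ.asModule) ρ.asModule :=
    { toFun := f
      map_add' := map_add f
      map_smul' := fun φ x => by
        let φ' : V →ₗ[ℂ] V := ((φ.restrictScalars ℂ : ρ.asModule →ₗ[ℂ] ρ.asModule))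
        have := hf φ' fun g => LinearMap.ext fun v => by
          let v' : ρ.asModule := v
          have h := φ.map_smul (MonoidAlgebra.single g (1 : ℂ)) v'
          rw [hsm, hsm] at h
          exact h
        exact LinearMap.congr_fun this x }
  let b := finBasis ℂ V
  obtain ⟨a, ha⟩ := jacobson_density F (Finset.univ.image fun i => (show ρ.asModule from b i))
  refine ⟨fun g => a.coeff g, b.ext fun i => ?_⟩
  have h1 : f (b i) = ρ.asAlgebraHom a (b i) :=
    (ha _ (Finset.mem_image_of_mem _ (Finset.mem_univ i))).trans
      (Representation.asModuleEquiv_map_smul ρ a (b i))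
  rw [h1, Representation.asAlgebraHom_def, MonoidAlgebra.lift_apply]
  congr 1
  rw [Finsupp.sum_fintype]
  simp

end DoubleCommutant

end Richardson

namespace Richardson

open Module Matrix MvPolynomial

section TensorPower

lemma exists_perm_of_sum_single_eq {e : ℕ} {α : Type*} {f f' : Fin e → α}
    (h : ∑ s, Finsupp.single (f s) 1 = ∑ s, Finsupp.single (f' s) (1 : ℕ)) :
    ∃ σ : Equiv.Perm (Fin e), f' = f ∘ σ := by
  classical
  have hcard : ∀ a, Fintype.card {s // f' s = a} = Fintype.card {s // f s = a} := fun a => by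
    have := DFunLike.congr_fun h a
    simp only [Finsupp.finsetSum_apply, Finsupp.single_apply] at this
    rw [Fintype.card_subtype, Fintype.card_subtype, Finset.card_filter, Finset.card_filter, this]
  refine ⟨Equiv.ofFiberEquiv fun a => Fintype.equivOfCardEq (hcard a), funext fun s => ?_⟩
  exact (Equiv.ofFiberEquiv_map _ s).symm

lemma prod_X_eq_monomial {e : ℕ} {α : Type*} (f : Fin e → α) :
    ∏ s, (X (f s) : MvPolynomial α ℂ) = monomial (∑ s, Finsupp.single (f s) 1) 1 := by
  simp only [X]
  rw [monomial_sum_one]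

variable {n : Type*} [Fintype n] {e : ℕ}

/-- The tensor power of a matrix. -/
def tensorPow (e : ℕ) (g : Matrix n n ℂ) : Matrix (Fin e → n) (Fin e → n) ℂ :=
  Matrix.of fun p q => ∏ s, g (p s) (q s)

lemma tensorPow_mul (g h : Matrix n n ℂ) : tensorPow e (g * h) = tensorPow e g * tensorPow e h := by
  ext p q
  simp only [tensorPow, Matrix.of_apply, Matrix.mul_apply]
  rw [Finset.prod_univ_sum, Fintype.piFinset_univ]
  simp only [Finset.prod_mul_distrib]

variable [DecidableEq n]

lemma commute_of_commute_tensorPow {Φ M : Matrix (Fin e → n) (Fin e → n) ℂ}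
    (hΦ : ∀ u ∈ unitaryGroup n ℂ, Φ * tensorPow e u = tensorPow e u * Φ)
    (hM : ∀ p q (σ : Equiv.Perm (Fin e)), M (p ∘ σ) (q ∘ σ) = M p q) : Φ * M = M * Φ := by
  classical
  ext a b
  rw [← sub_eq_zero, ← Matrix.sub_apply]
  let ℓ : Matrix (Fin e → n) (Fin e → n) ℂ →ₗ[ℂ] ℂ :=
    { toFun := fun M => (Φ * M - M * Φ) a b
      map_add' := fun M M' => by
        simp only [Matrix.mul_add, Matrix.add_mul, Matrix.sub_apply, Matrix.add_apply]
        ring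
      map_smul' := fun c M => by
        simp only [Matrix.mul_smul, Matrix.smul_mul, Matrix.sub_apply, Matrix.smul_apply, smul_eq_mul,
          RingHom.id_apply]
        ring }
  have hℓ : ∀ M, ℓ M = ∑ p, ∑ q, M p q * ℓ (Matrix.single p q 1) := fun M => by
    conv_lhs => rw [matrix_eq_sum_single M]
    simp only [map_sum]
    refine Finset.sum_congr rfl fun p _ => Finset.sum_congr rfl fun q _ => ?_
    rw [← smul_eq_mul, ← map_smul, smul_single, smul_eq_mul, mul_one]
  change ℓ M = 0
  let F : MvPolynomial (n × n) ℂ :=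
    ∑ p : Fin e → n, ∑ q : Fin e → n, ℓ (Matrix.single p q 1) • ∏ s, X (p s, q s)
  have hF : F = 0 := eq_zero_of_unitary fun g hg => by
    have : ℓ (tensorPow e g) = 0 := by
      change (Φ * tensorPow e g - tensorPow e g * Φ) a b = 0
      rw [hΦ g hg, sub_self, Matrix.zero_apply]
    rw [← this, hℓ]
    simp only [F, map_sum, smul_eval, map_prod, eval_X, tensorPow, Matrix.of_apply]
    exact Finset.sum_congr rfl fun p _ => Finset.sum_congr rfl fun q _ => mul_comm _ _
  let m : (n × n →₀ ℕ) → ℂ := fun μ =>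
    if h : ∃ pq : (Fin e → n) × (Fin e → n), ∑ s, Finsupp.single (pq.1 s, pq.2 s) 1 = μ
    then M h.choose.1 h.choose.2 else 0
  have hm : ∀ p q : Fin e → n, m (∑ s, Finsupp.single (p s, q s) 1) = M p q := fun p q => by
    have h : ∃ pq : (Fin e → n) × (Fin e → n), ∑ s, Finsupp.single (pq.1 s, pq.2 s) 1 =
        ∑ s, Finsupp.single (p s, q s) (1 : ℕ) := ⟨(p, q), rfl⟩
    simp only [m]
    rw [dif_pos h]
    obtain ⟨σ, hσ⟩ := exists_perm_of_sum_single_eq h.choose_spec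
    have h1 : p = h.choose.1 ∘ σ := funext fun s => congrArg Prod.fst (congrFun hσ s)
    have h2 : q = h.choose.2 ∘ σ := funext fun s => congrArg Prod.snd (congrFun hσ s)
    rw [← hM _ _ σ, ← h1, ← h2]
  let L : MvPolynomial (n × n) ℂ →ₗ[ℂ] ℂ := (MvPolynomial.basisMonomials (n × n) ℂ).constr ℂ m
  have hL : ∀ p q : Fin e → n, L (∏ s, X (p s, q s)) = M p q := fun p q => by
    rw [prod_X_eq_monomial (fun s => (p s, q s)), ← hm]
    have := (MvPolynomial.basisMonomials (n × n) ℂ).constr_basis ℂ m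
      (∑ s, Finsupp.single (p s, q s) 1)
    rwa [MvPolynomial.coe_basisMonomials] at this
  rw [hℓ, ← map_zero L, ← hF]
  simp only [F, map_sum, map_smul, hL, smul_eq_mul]
  exact Finset.sum_congr rfl fun p _ => Finset.sum_congr rfl fun q _ => mul_comm _ _

variable (n e) in
/-- The permutation action on tensors. -/
def permRep : Representation ℂ (Equiv.Perm (Fin e)) ((Fin e → n) → ℂ) where
  toFun σ := LinearMap.funLeft ℂ ℂ fun p => p ∘ σ
  map_one' := rfl
  map_mul' _ _ := rfl

theorem exists_eq_sum_perm {Φ : Matrix (Fin e → n) (Fin e → n) ℂ}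
    (hΦ : ∀ u ∈ unitaryGroup n ℂ, Φ * tensorPow e u = tensorPow e u * Φ) :
    ∃ c : Equiv.Perm (Fin e) → ℂ, ∀ p q, Φ p q = ∑ σ : Equiv.Perm (Fin e), if q = p ∘ σ then c σ else 0 := by
  obtain ⟨c, hc⟩ := exists_eq_sum_of_commute (permRep n e) (Matrix.toLin' Φ) fun φ hφ => by
    rw [← Matrix.toLin'_toMatrix' φ, ← Matrix.toLin'_mul, ← Matrix.toLin'_mul]
    congr 1
    refine commute_of_commute_tensorPow hΦ fun p q σ => ?_
    have h := congrFun (LinearMap.congr_fun (hφ σ) (Pi.single (q ∘ σ) 1)) p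
    rw [LinearMap.toMatrix'_apply, LinearMap.toMatrix'_apply]
    have h2 : permRep n e σ (Pi.single (q ∘ σ) 1) = Pi.single q 1 := by
      ext p
      change (Pi.single (q ∘ σ) 1 : (Fin e → n) → ℂ) (p ∘ σ) = _
      rw [Pi.single_apply, Pi.single_apply]
      simp only [σ.surjective.injective_comp_right.eq_iff]
    rw [LinearMap.comp_apply, h2] at h
    exact h.symm
  refine ⟨c, fun p q => ?_⟩
  have h := congrFun (LinearMap.congr_fun hc (Pi.single q 1)) p
  rw [Matrix.toLin'_apply, Matrix.mulVec_single_one] at h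
  change Φ p q = _ at h
  rw [h]
  simp only [LinearMap.sum_apply, LinearMap.smul_apply, Finset.sum_apply, Pi.smul_apply, smul_eq_mul]
  refine Finset.sum_congr rfl fun σ _ => ?_
  change c σ * (Pi.single q 1 : (Fin e → n) → ℂ) (p ∘ σ) = _
  rw [Pi.single_apply]
  simp [eq_comm]

end TensorPower

end Richardson

namespace Richardson

open Module Matrix MvPolynomial

section Averaging

variable {n α β : Type*} [Fintype n] [DecidableEq n]

lemma continuous_unitary_apply (a b : n) :
    Continuous fun h : unitaryGroup n ℂ => (h : Matrix n n ℂ) a b :=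
  (continuous_apply b).comp ((continuous_apply a).comp continuous_subtype_val)

lemma continuous_unitary_inv_apply (a b : n) :
    Continuous fun h : unitaryGroup n ℂ => ((h⁻¹ : unitaryGroup n ℂ) : Matrix n n ℂ) a b :=
  (continuous_unitary_apply a b).comp continuous_inv

lemma exists_norm_one_pow_ne {e e' : ℕ} (h : e ≠ e') :
    ∃ z : ℂ, star z * z = 1 ∧ z ^ e * star z ^ e' ≠ 1 := by
  have h0 : ((e : ℝ) - e' : ℝ) ≠ 0 := sub_ne_zero.2 (by exact_mod_cast h)
  have hs : star (Complex.exp ((Real.pi / (e - e') : ℝ) * Complex.I)) =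
      Complex.exp (-((Real.pi / (e - e') : ℝ) * Complex.I)) := by
    change (starRingEnd ℂ) _ = _
    rw [← Complex.exp_conj, map_mul, Complex.conj_I, Complex.conj_ofReal, mul_neg]
  refine ⟨Complex.exp ((Real.pi / (e - e') : ℝ) * Complex.I), ?_, ?_⟩
  · rw [hs, ← Complex.exp_add, neg_add_cancel, Complex.exp_zero]
  · rw [hs, ← Complex.exp_nat_mul, ← Complex.exp_nat_mul, ← Complex.exp_add]
    have : (e : ℂ) * ((Real.pi / (e - e') : ℝ) * Complex.I) +
        e' * -((Real.pi / (e - e') : ℝ) * Complex.I) = Real.pi * Complex.I := by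
      have h1 : (e : ℂ) * ((Real.pi / (e - e') : ℝ) * Complex.I) +
        e' * -((Real.pi / (e - e') : ℝ) * Complex.I) =
          ((((e : ℝ) - e') * (Real.pi / (e - e')) : ℝ) : ℂ) * Complex.I := by
        push_cast
        ring
      rw [h1, mul_div_cancel₀ _ h0]
    rw [this, Complex.exp_pi_mul_I]
    norm_num

theorem exists_mean_prod_eq {I : C(unitaryGroup n ℂ, ℂ) →ₗ[ℂ] ℂ}
    (hI : ∀ (f f' : C(unitaryGroup n ℂ, ℂ)) (g : unitaryGroup n ℂ),
      (∀ x, f' x = f (g * x)) → I f' = I f) {e e' : ℕ} (x : Fin e → α × n) (y : Fin e' → n × β) :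
    ∃ Q : MvPolynomial (α × β) ℂ, 2 * Q.totalDegree ≤ e + e' ∧
      ∀ (A : Matrix α n ℂ) (B : Matrix n β ℂ) (f : C(unitaryGroup n ℂ, ℂ)),
        (∀ h, f h = (∏ s, (A * (h : Matrix n n ℂ)) (x s).1 (x s).2) *
          ∏ t, (((h⁻¹ : unitaryGroup n ℂ) : Matrix n n ℂ) * B) (y t).1 (y t).2) →
        I f = eval (fun q => (A * B) q.1 q.2) Q := by
  classical
  by_cases he : e = e'
  · subst he
    let F : (Fin e → n) → (Fin e → n) → C(unitaryGroup n ℂ, ℂ) := fun p q =>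
      ⟨fun h => (∏ s, (h : Matrix n n ℂ) (p s) (x s).2) *
        ∏ t, ((h⁻¹ : unitaryGroup n ℂ) : Matrix n n ℂ) (y t).1 (q t),
        (continuous_finsetProd _ fun s _ => continuous_unitary_apply _ _).mul
          (continuous_finsetProd _ fun s _ => continuous_unitary_inv_apply _ _)⟩
    let Φ : Matrix (Fin e → n) (Fin e → n) ℂ := Matrix.of fun p q => I (F p q)
    obtain ⟨c, hc⟩ := exists_eq_sum_perm (Φ := Φ) fun u hu => by
      ext p q
      have h1 : (tensorPow e u * Φ) p q = I (∑ p', (tensorPow e u p p') • F p' q) := by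
        simp only [Matrix.mul_apply, map_sum, map_smul, smul_eq_mul, Φ, Matrix.of_apply]
      have h2 : (Φ * tensorPow e u) p q = I (∑ q', (tensorPow e u q' q) • F p q') := by
        simp only [Matrix.mul_apply, map_sum, map_smul, smul_eq_mul, Φ, Matrix.of_apply, mul_comm]
      rw [h1, h2]
      symm
      refine hI _ _ ⟨u, hu⟩ fun h => ?_
      have e1 : ∀ h : unitaryGroup n ℂ, (∑ p', (tensorPow e u p p') • F p' q) h =
          (∏ s, (u * (h : Matrix n n ℂ)) (p s) (x s).2) *
          ∏ t, ((h⁻¹ : unitaryGroup n ℂ) : Matrix n n ℂ) (y t).1 (q t) := fun h => by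
        have := congrFun (congrFun (tensorPow_mul (e := e) u (h : Matrix n n ℂ)) p) fun s => (x s).2
        rw [Matrix.mul_apply] at this
        simp only [tensorPow, Matrix.of_apply] at this
        rw [this]
        simp only [ContinuousMap.coe_sum, Finset.sum_apply, ContinuousMap.coe_smul, Pi.smul_apply,
          smul_eq_mul, F, ContinuousMap.coe_mk, Finset.sum_mul, tensorPow, Matrix.of_apply, mul_assoc]
      have e2 : ∀ h : unitaryGroup n ℂ, (∑ q', (tensorPow e u q' q) • F p q') h =
          (∏ s, (h : Matrix n n ℂ) (p s) (x s).2) *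
          ∏ t, (((h⁻¹ : unitaryGroup n ℂ) : Matrix n n ℂ) * u) (y t).1 (q t) := fun h => by
        have := congrFun (congrFun (tensorPow_mul (e := e)
          ((h⁻¹ : unitaryGroup n ℂ) : Matrix n n ℂ) u) fun s => (y s).1) q
        rw [Matrix.mul_apply] at this
        simp only [tensorPow, Matrix.of_apply] at this
        rw [this]
        simp only [ContinuousMap.coe_sum, Finset.sum_apply, ContinuousMap.coe_smul, Pi.smul_apply,
          smul_eq_mul, F, ContinuousMap.coe_mk, Finset.mul_sum, tensorPow, Matrix.of_apply]
        exact Finset.sum_congr rfl fun _ _ => by ring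
      rw [e1, e2]
      have e3 : (((⟨u, hu⟩ * h : unitaryGroup n ℂ)⁻¹ : unitaryGroup n ℂ) : Matrix n n ℂ) * u =
          ((h⁻¹ : unitaryGroup n ℂ) : Matrix n n ℂ) := by
        have : ((⟨u, hu⟩ * h : unitaryGroup n ℂ)⁻¹ * ⟨u, hu⟩ : unitaryGroup n ℂ) = h⁻¹ := by group
        exact congrArg Subtype.val this
      rw [e3]
      rfl
    refine ⟨∑ σ : Equiv.Perm (Fin e), c σ • ∏ s, X ((x s).1, (y (σ.symm s)).2), ?_,
      fun A B f hf => ?_⟩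
    · have : (∑ σ : Equiv.Perm (Fin e), c σ • ∏ s, (X ((x s).1, (y (σ.symm s)).2) :
          MvPolynomial (α × β) ℂ)).totalDegree ≤ e := by
        refine totalDegree_finsetSum_le fun σ _ => (totalDegree_smul_le _ _).trans
          ((totalDegree_finsetProd _ _).trans ?_)
        simp only [totalDegree_X]
        simp
      lia
    · have h1 : f = ∑ p : Fin e → n, ∑ q : Fin e → n,
          ((∏ s, A (x s).1 (p s)) * ∏ t, B (q t) (y t).2) • F p q := by
        ext h
        rw [hf]
        simp only [Matrix.mul_apply, Finset.prod_univ_sum, Fintype.piFinset_univ,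
          Finset.prod_mul_distrib, Finset.sum_mul_sum, ContinuousMap.coe_sum, Finset.sum_apply,
          ContinuousMap.coe_smul, Pi.smul_apply, smul_eq_mul, F, ContinuousMap.coe_mk]
        exact Finset.sum_congr rfl fun _ _ => Finset.sum_congr rfl fun _ _ => by ring
      have h2 : ∀ p q, I (F p q) = ∑ σ : Equiv.Perm (Fin e), if q = p ∘ σ then c σ else 0 := hc
      rw [h1]
      simp only [map_sum, map_smul, smul_eq_mul, h2, smul_eval, map_prod, eval_X]
      simp only [Finset.mul_sum, mul_ite, mul_zero]
      have h3 : ∀ p : Fin e → n, (∑ q : Fin e → n, ∑ σ : Equiv.Perm (Fin e), if q = p ∘ σ then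
          ((∏ s, A (x s).1 (p s)) * ∏ t, B (q t) (y t).2) * c σ else 0) =
          ∑ σ : Equiv.Perm (Fin e),
            ((∏ s, A (x s).1 (p s)) * ∏ t, B (p (σ t)) (y t).2) * c σ := fun p => by
        rw [Finset.sum_comm]
        refine Finset.sum_congr rfl fun σ _ => ?_
        rw [Finset.sum_ite_eq' Finset.univ (p ∘ σ), if_pos (Finset.mem_univ _)]
        rfl
      simp only [h3]
      rw [Finset.sum_comm]
      refine Finset.sum_congr rfl fun σ _ => ?_
      rw [← Finset.sum_mul, mul_comm]
      congr 1
      have h4 : ∀ p : Fin e → n, ∏ t, B (p (σ t)) (y t).2 = ∏ s, B (p s) (y (σ.symm s)).2 := fun p =>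
        Fintype.prod_equiv σ _ _ fun t => by rw [Equiv.symm_apply_apply]
      simp only [h4, ← Finset.prod_mul_distrib, Matrix.mul_apply]
      rw [Finset.prod_univ_sum, Fintype.piFinset_univ]
  · refine ⟨0, by simp, fun A B f hf => ?_⟩
    obtain ⟨z, hz, hz1⟩ := exists_norm_one_pow_ne he
    have hu : z • (1 : Matrix n n ℂ) ∈ unitaryGroup n ℂ := by
      rw [mem_unitaryGroup_iff']
      rw [star_smul, star_one, smul_mul_smul_comm, hz, one_mul, one_smul]
    have key : I ((z ^ e * star z ^ e') • f) = I f := hI _ _ ⟨_, hu⟩ fun h => by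
      have h1 : (((⟨_, hu⟩ * h : unitaryGroup n ℂ)) : Matrix n n ℂ) = z • (h : Matrix n n ℂ) := by
        change z • (1 : Matrix n n ℂ) * (h : Matrix n n ℂ) = _
        rw [Matrix.smul_mul, Matrix.one_mul]
      have h2 : (((⟨_, hu⟩ * h : unitaryGroup n ℂ)⁻¹ : unitaryGroup n ℂ) : Matrix n n ℂ) =
          star z • ((h⁻¹ : unitaryGroup n ℂ) : Matrix n n ℂ) := by
        change star (((⟨_, hu⟩ * h : unitaryGroup n ℂ)) : Matrix n n ℂ) = star z • star (h : Matrix n n ℂ)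
        rw [h1, star_smul]
      rw [ContinuousMap.smul_apply, hf, hf, h1, h2]
      simp only [Matrix.mul_smul, Matrix.smul_mul, Matrix.smul_apply, smul_eq_mul,
        Finset.prod_mul_distrib, Finset.prod_const, Finset.card_univ, Fintype.card_fin]
      ring
    rw [map_smul, smul_eq_mul] at key
    have : (z ^ e * star z ^ e' - 1) * I f = 0 := by linear_combination key
    rw [map_zero]
    exact (mul_eq_zero.1 this).resolve_left (sub_ne_zero.2 hz1)

/-- A monomial splits along a partition of the variables into three classes. -/
lemma exists_split_monomial {σ X Y : Type*} : ∀ (d : ℕ) (m : σ ⊕ X ⊕ Y →₀ ℕ), m.degree = d →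
    ∃ (a : MvPolynomial σ ℂ) (e e' : ℕ) (x : Fin e → X) (y : Fin e' → Y),
      a.totalDegree + e + e' ≤ d ∧ ∀ v : σ ⊕ X ⊕ Y → ℂ, eval v (monomial m 1) =
        eval (fun i => v (Sum.inl i)) a * ((∏ s, v (Sum.inr (Sum.inl (x s)))) *
          ∏ t, v (Sum.inr (Sum.inr (y t))))
  | 0, m, hm => by
    refine ⟨1, 0, 0, Fin.elim0, Fin.elim0, by simp, fun v => ?_⟩
    rw [(Finsupp.degree_eq_zero_iff m).1 hm]
    simp
  | d + 1, m, hm => by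
    classical
    obtain ⟨i, hi⟩ : ∃ i, m i ≠ 0 := by
      by_contra! h
      rw [(Finsupp.degree_eq_zero_iff m).2 (Finsupp.ext h)] at hm
      lia
    obtain ⟨m', rfl⟩ : ∃ m', m = m' + Finsupp.single i 1 :=
      ⟨m - Finsupp.single i 1, (tsub_add_cancel_of_le (Finsupp.single_le_iff.2 (by lia))).symm⟩
    rw [map_add, Finsupp.degree_single] at hm
    obtain ⟨a, e, e', x, y, h, hv⟩ := exists_split_monomial d m' (by lia)
    have hmul : ∀ v : σ ⊕ X ⊕ Y → ℂ, eval v (monomial (m' + Finsupp.single i 1) 1) =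
        eval v (monomial m' 1) * v i := fun v => by
      rw [← mul_one (1 : ℂ), ← monomial_mul, map_mul, mul_one]
      congr 1
      exact eval_X i
    rcases i with i | i | i
    · refine ⟨a * MvPolynomial.X i, e, e', x, y, ?_, fun v => ?_⟩
      · have := totalDegree_mul a (MvPolynomial.X i)
        rw [totalDegree_X] at this
        lia
      · rw [hmul, hv, map_mul, eval_X]
        ring
    · refine ⟨a, e + 1, e', Fin.cons i x, y, by lia, fun v => ?_⟩
      rw [hmul, hv, Fin.prod_univ_succ]
      simp only [Fin.cons_zero, Fin.cons_succ]
      ring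
    · refine ⟨a, e, e' + 1, x, Fin.cons i y, by lia, fun v => ?_⟩
      rw [hmul, hv, Fin.prod_univ_succ (n := e')]
      simp only [Fin.cons_zero, Fin.cons_succ]
      ring

/-- A polynomial which is invariant under the unitary group may be rewritten in terms of
the product of the two matrices on which the group acts. -/
theorem exists_eval_mul_of_invariant {σ : Type*} (p : MvPolynomial (σ ⊕ (α × n) ⊕ (n × β)) ℂ) :
    ∃ (a : p.support → MvPolynomial σ ℂ) (Q : p.support → MvPolynomial (α × β) ℂ),
      (∀ m, (a m).totalDegree + 2 * (Q m).totalDegree ≤ p.totalDegree) ∧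
      ∀ (v : σ → ℂ) (A : Matrix α n ℂ) (B : Matrix n β ℂ) (C : ℂ),
        (∀ h : unitaryGroup n ℂ, eval (Sum.elim v (Sum.elim
          (fun q => (A * (h : Matrix n n ℂ)) q.1 q.2)
          fun q => (((h⁻¹ : unitaryGroup n ℂ) : Matrix n n ℂ) * B) q.1 q.2)) p = C) →
        C = ∑ m, eval v (a m) * eval (fun q => (A * B) q.1 q.2) (Q m) := by
  obtain ⟨I, hI1, hI, -, -⟩ := exists_mean (unitaryGroup n ℂ)
  choose a e e' x y hd hv using fun m : σ ⊕ (α × n) ⊕ (n × β) →₀ ℕ => exists_split_monomial _ m rfl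
  choose Q hQ hQ2 using fun m => exists_mean_prod_eq (α := α) (β := β) hI (x m) (y m)
  refine ⟨fun m => p.coeff m • a m, fun m => Q m, fun m => ?_, fun v A B C hC => ?_⟩
  · have h1 := totalDegree_smul_le (p.coeff m) (a m)
    have h2 := hQ m
    have h3 := hd m
    have h4 := le_totalDegree m.2
    change Finsupp.degree _ ≤ _ at h4
    dsimp only
    lia
  · let f : (σ ⊕ (α × n) ⊕ (n × β) →₀ ℕ) → C(unitaryGroup n ℂ, ℂ) := fun m =>
      ⟨fun h => (∏ s, (A * (h : Matrix n n ℂ)) (x m s).1 (x m s).2) *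
          ∏ t, (((h⁻¹ : unitaryGroup n ℂ) : Matrix n n ℂ) * B) (y m t).1 (y m t).2, by
        refine (continuous_finsetProd _ fun s _ => ?_).mul (continuous_finsetProd _ fun s _ => ?_)
        · simp only [Matrix.mul_apply]
          exact continuous_finsetSum _ fun i _ => continuous_const.mul (continuous_unitary_apply _ _)
        · simp only [Matrix.mul_apply]
          exact continuous_finsetSum _ fun i _ =>
            (continuous_unitary_inv_apply _ _).mul continuous_const⟩
    have h1 : C • (1 : C(unitaryGroup n ℂ, ℂ)) =
        ∑ m : p.support, (p.coeff m * eval v (a m)) • f m := by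
      ext h
      simp only [ContinuousMap.smul_apply, ContinuousMap.one_apply, smul_eq_mul, mul_one,
        ContinuousMap.coe_sum, Finset.sum_apply]
      rw [← hC h]
      conv_lhs => rw [p.as_sum, map_sum, ← Finset.sum_coe_sort]
      refine Finset.sum_congr rfl fun m _ => ?_
      have hm : monomial (m : σ ⊕ (α × n) ⊕ (n × β) →₀ ℕ) (p.coeff m) =
          p.coeff m • monomial (m : σ ⊕ (α × n) ⊕ (n × β) →₀ ℕ) 1 := by
        rw [smul_monomial, smul_eq_mul, mul_one]
      rw [hm, smul_eval, hv, mul_assoc]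
      rfl
    have h2 := congrArg I h1
    rw [map_smul, hI1, smul_eq_mul, mul_one, map_sum] at h2
    rw [h2]
    refine Finset.sum_congr rfl fun m _ => ?_
    rw [map_smul, smul_eq_mul, smul_eval, hQ2 m A B (f m) fun h => rfl]

end Averaging

end Richardson

namespace Richardson

open Module Matrix MvPolynomial

section Degree

lemma totalDegree_aeval_le {σ τ R S : Type*} [CommSemiring R] [CommSemiring S] [Algebra R S]
    {e : ℕ} (p : MvPolynomial σ R) {g : σ → MvPolynomial τ S} (hg : ∀ i, (g i).totalDegree ≤ e) :
    (aeval g p).totalDegree ≤ e * p.totalDegree := by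
  rw [aeval_def, eval₂_eq]
  refine totalDegree_finsetSum_le fun m hm => ?_
  refine (totalDegree_mul _ _).trans ?_
  rw [MvPolynomial.algebraMap_apply, totalDegree_C, zero_add]
  refine (totalDegree_finsetProd _ _).trans ?_
  have h1 : m.degree ≤ p.totalDegree := le_totalDegree hm
  refine le_trans ?_ (Nat.mul_le_mul_left e h1)
  rw [Finsupp.degree_apply, Finset.mul_sum]
  refine Finset.sum_le_sum fun i _ => (totalDegree_pow _ _).trans ?_
  rw [mul_comm e]
  exact Nat.mul_le_mul_left _ (hg i)

end Degree

section Descent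

variable {r : ℕ → ℕ}

/-- Change of bases at the nodes of the chain. -/
def gauge {K : Type*} [Field K] (g g' : ∀ i, Matrix (Fin (r i)) (Fin (r i)) K) (u : RepVar r → K) :
    RepVar r → K :=
  Sum.elim (fun x => (g' x.1 * matA u x.1 * g (x.1 + 1)) x.2.1 x.2.2)
    fun x => (g' (x.1 + 1) * matB u x.1 * g x.1) x.2.1 x.2.2

lemma matA_gauge {K : Type*} [Field K] (g g' : ∀ i, Matrix (Fin (r i)) (Fin (r i)) K)
    (u : RepVar r → K) (i : ℕ) : matA (gauge g g' u) i = g' i * matA u i * g (i + 1) := rfl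

lemma matB_gauge {K : Type*} [Field K] (g g' : ∀ i, Matrix (Fin (r i)) (Fin (r i)) K)
    (u : RepVar r → K) (i : ℕ) : matB (gauge g g' u) i = g' (i + 1) * matB u i * g i := rfl

lemma matA_mul_matB_gauge {K : Type*} [Field K] {g g' : ∀ i, Matrix (Fin (r i)) (Fin (r i)) K}
    (hg : ∀ i, g i * g' i = 1) (u : RepVar r → K) (i : ℕ) :
    matA (gauge g g' u) i * matB (gauge g g' u) i = g' i * (matA u i * matB u i) * g i := by
  rw [matA_gauge, matB_gauge]
  calc _ = g' i * (matA u i * (g (i + 1) * g' (i + 1)) * matB u i) * g i := by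
        simp only [Matrix.mul_assoc]
    _ = _ := by rw [hg, Matrix.mul_one]

lemma moment_gauge {K : Type*} [Field K] {g g' : ∀ i, Matrix (Fin (r i)) (Fin (r i)) K}
    (hg : ∀ i, g i * g' i = 1) (u : RepVar r → K) (i : ℕ) :
    moment (gauge g g' u) i = g' (i + 1) * moment u i * g (i + 1) := by
  rw [moment, matA_mul_matB_gauge hg, matA_gauge, matB_gauge, moment, Matrix.mul_sub, Matrix.sub_mul]
  congr 1
  calc _ = g' (i + 1) * (matB u i * (g i * g' i) * matA u i) * g (i + 1) := by
        simp only [Matrix.mul_assoc]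
    _ = _ := by rw [hg, Matrix.mul_one]

lemma moment_gauge_of_scalar {K : Type*} [Field K] {g g' : ∀ i, Matrix (Fin (r i)) (Fin (r i)) K}
    (hg : ∀ i, g i * g' i = 1) {u : RepVar r → K} {τ : ℕ → K}
    (hu : ∀ i, moment u i = τ i • (1 : Matrix (Fin (r (i + 1))) (Fin (r (i + 1))) K)) (i : ℕ) :
    moment (gauge g g' u) i = τ i • (1 : Matrix (Fin (r (i + 1))) (Fin (r (i + 1))) K) := by
  rw [moment_gauge hg, hu, Matrix.mul_smul, Matrix.mul_one, Matrix.smul_mul,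
    mul_eq_one_comm.1 (hg (i + 1))]

/-- Separate the variables along the edge `n`. -/
def splitVar (n : ℕ) : RepVar r →
    RepVar r ⊕ (Fin (r n) × Fin (r (n + 1))) ⊕ (Fin (r (n + 1)) × Fin (r n))
  | Sum.inl x => if h : x.1 = n then Sum.inr (Sum.inl (h ▸ x.2)) else Sum.inl (Sum.inl x)
  | Sum.inr x => if h : x.1 = n then Sum.inr (Sum.inr (h ▸ x.2)) else Sum.inl (Sum.inr x)

section

variable {n : ℕ} {R : Type*} (v : RepVar r → R) (A : Matrix (Fin (r n)) (Fin (r (n + 1))) R)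
  (B : Matrix (Fin (r (n + 1))) (Fin (r n)) R)

lemma matA_splitVar_self :
    matA (Sum.elim v (Sum.elim (fun q => A q.1 q.2) fun q => B q.1 q.2) ∘ splitVar n) n = A := by
  ext i j
  simp [matA, splitVar]

lemma matB_splitVar_self :
    matB (Sum.elim v (Sum.elim (fun q => A q.1 q.2) fun q => B q.1 q.2) ∘ splitVar n) n = B := by
  ext i j
  simp [matB, splitVar]

lemma matA_splitVar_of_ne {i : ℕ} (h : i ≠ n) :
    matA (Sum.elim v (Sum.elim (fun q => A q.1 q.2) fun q => B q.1 q.2) ∘ splitVar n) i =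
      matA v i := by
  ext a b
  simp [matA, splitVar, h]

lemma matB_splitVar_of_ne {i : ℕ} (h : i ≠ n) :
    matB (Sum.elim v (Sum.elim (fun q => A q.1 q.2) fun q => B q.1 q.2) ∘ splitVar n) i =
      matB v i := by
  ext a b
  simp [matB, splitVar, h]

end

/-- The polynomial only involves the matrices along the edges below `n`. -/
def DependsBelow (n : ℕ) (p : MvPolynomial (RepVar r) ℂ) : Prop :=
  ∀ u u' : RepVar r → ℂ, (∀ i < n, matA u i = matA u' i ∧ matB u i = matB u' i) →
    eval u p = eval u' p

variable {τ : ℕ → ℂ} {f : MvPolynomial (Fin (r 0) × Fin (r 0)) ℂ}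

theorem exists_sum_eval_of_dependsBelow {n : ℕ} {p : MvPolynomial (RepVar r) ℂ}
    (hp : DependsBelow (n + 1) p)
    (hfp : ∀ u : RepVar r → ℂ,
      (∀ i, moment u i = τ i • (1 : Matrix (Fin (r (i + 1))) (Fin (r (i + 1))) ℂ)) →
      eval (fun q => (matA u 0 * matB u 0) q.1 q.2) f = eval u p) :
    ∃ (ι : Type) (_ : Fintype ι) (a : ι → MvPolynomial (RepVar r) ℂ)
      (Q : ι → MvPolynomial (Fin (r n) × Fin (r n)) ℂ),
      (∀ m, (a m).totalDegree + 2 * (Q m).totalDegree ≤ p.totalDegree) ∧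
      ∀ u v : RepVar r → ℂ,
        (∀ i, moment u i = τ i • (1 : Matrix (Fin (r (i + 1))) (Fin (r (i + 1))) ℂ)) →
        (∀ i < n, matA v i = matA u i ∧ matB v i = matB u i) →
        eval (fun q => (matA u 0 * matB u 0) q.1 q.2) f =
          ∑ m, eval v (a m) * eval (fun q => (matA u n * matB u n) q.1 q.2) (Q m) := by
  obtain ⟨a, Q, hd, h⟩ := exists_eval_mul_of_invariant (rename (splitVar n) p)
  refine ⟨_, inferInstance, a, Q, fun m => (hd m).trans (totalDegree_rename_le _ _),
    fun u v hu hv => h v (matA u n) (matB u n) _ fun h => ?_⟩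
  have hh : (h : Matrix (Fin (r (n + 1))) (Fin (r (n + 1))) ℂ) *
      ((h⁻¹ : unitaryGroup (Fin (r (n + 1))) ℂ) : Matrix (Fin (r (n + 1))) (Fin (r (n + 1))) ℂ) = 1 :=
    congrArg Subtype.val (mul_inv_cancel h)
  let g : ∀ i, Matrix (Fin (r i)) (Fin (r i)) ℂ :=
    Function.update (fun i => (1 : Matrix (Fin (r i)) (Fin (r i)) ℂ)) (n + 1) (h : Matrix _ _ ℂ)
  let g' : ∀ i, Matrix (Fin (r i)) (Fin (r i)) ℂ :=
    Function.update (fun i => (1 : Matrix (Fin (r i)) (Fin (r i)) ℂ)) (n + 1)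
      ((h⁻¹ : unitaryGroup (Fin (r (n + 1))) ℂ) : Matrix _ _ ℂ)
  have hg1 : g (n + 1) = h := Function.update_self ..
  have hg1' : g' (n + 1) = ((h⁻¹ : unitaryGroup (Fin (r (n + 1))) ℂ) : Matrix _ _ ℂ) :=
    Function.update_self ..
  have hg2 : ∀ i, i ≠ n + 1 → g i = 1 := fun i hi => Function.update_of_ne hi ..
  have hg2' : ∀ i, i ≠ n + 1 → g' i = 1 := fun i hi => Function.update_of_ne hi ..
  have hg : ∀ i, g i * g' i = 1 := fun i => by
    by_cases hi : i = n + 1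
    · subst hi
      rw [hg1, hg1', hh]
    · rw [hg2 i hi, hg2' i hi, Matrix.mul_one]
  have h1 := hfp (gauge g g' u) (moment_gauge_of_scalar hg hu)
  rw [matA_mul_matB_gauge hg, hg2 0 (by lia), hg2' 0 (by lia), Matrix.one_mul, Matrix.mul_one] at h1
  rw [h1, eval_rename]
  refine hp _ _ fun i hi => ?_
  by_cases hin : i = n
  · subst hin
    rw [matA_splitVar_self, matB_splitVar_self, matA_gauge, matB_gauge, hg1, hg1',
      hg2 i (by lia), hg2' i (by lia), Matrix.one_mul, Matrix.mul_one]
    exact ⟨rfl, rfl⟩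
  · rw [matA_splitVar_of_ne _ _ _ hin, matB_splitVar_of_ne _ _ _ hin, matA_gauge, matB_gauge,
      hg2 i (by lia), hg2' i (by lia), hg2 (i + 1) (by lia), hg2' (i + 1) (by lia), Matrix.one_mul,
      Matrix.mul_one, Matrix.one_mul, Matrix.mul_one]
    exact hv i (by lia)

theorem exists_dependsBelow {n : ℕ} {p : MvPolynomial (RepVar r) ℂ}
    (hp : DependsBelow (n + 2) p)
    (hfp : ∀ u : RepVar r → ℂ,
      (∀ i, moment u i = τ i • (1 : Matrix (Fin (r (i + 1))) (Fin (r (i + 1))) ℂ)) →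
      eval (fun q => (matA u 0 * matB u 0) q.1 q.2) f = eval u p) :
    ∃ p' : MvPolynomial (RepVar r) ℂ, p'.totalDegree ≤ p.totalDegree ∧ DependsBelow (n + 1) p' ∧
      ∀ u : RepVar r → ℂ,
      (∀ i, moment u i = τ i • (1 : Matrix (Fin (r (i + 1))) (Fin (r (i + 1))) ℂ)) →
      eval (fun q => (matA u 0 * matB u 0) q.1 q.2) f = eval u p' := by
  obtain ⟨ι, _, a, Q, hd, h⟩ := exists_sum_eval_of_dependsBelow hp hfp
  let t : RepVar r → MvPolynomial (RepVar r) ℂ :=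
    Sum.elim (fun x => if x.1 < n + 1 then X (Sum.inl x) else 0)
      fun x => if x.1 < n + 1 then X (Sum.inr x) else 0
  let z : Fin (r (n + 1)) × Fin (r (n + 1)) → MvPolynomial (RepVar r) ℂ := fun q =>
    ∑ s, X (Sum.inr ⟨n, q.1, s⟩) * X (Sum.inl ⟨n, s, q.2⟩) -
      C (τ n * (1 : Matrix (Fin (r (n + 1))) (Fin (r (n + 1))) ℂ) q.1 q.2)
  have ht : ∀ i, (t i).totalDegree ≤ 1 := by
    rintro (i | i) <;> simp only [t, Sum.elim_inl, Sum.elim_inr] <;> split_ifs <;> simp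
  have hz : ∀ i, (z i).totalDegree ≤ 2 := fun q => by
    refine (totalDegree_sub_C_le _ _).trans (totalDegree_finsetSum_le fun s _ => ?_)
    refine (totalDegree_mul _ _).trans ?_
    rw [totalDegree_X, totalDegree_X]
  have htA : ∀ (u : RepVar r → ℂ), ∀ i < n + 1,
      matA (fun x => eval u (t x)) i = matA u i ∧ matB (fun x => eval u (t x)) i = matB u i := by
    intro u i hi
    constructor <;> ext a b <;> simp [matA, matB, t, Nat.lt_succ_iff.1 hi]
  have hzB : ∀ (u : RepVar r → ℂ) q, eval u (z q) = (matB u n * matA u n - τ n •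
      (1 : Matrix (Fin (r (n + 1))) (Fin (r (n + 1))) ℂ)) q.1 q.2 := fun u q => by
    simp [z, Matrix.mul_apply, matA, matB]
  have heval : ∀ u : RepVar r → ℂ, eval u (∑ m, aeval t (a m) * aeval z (Q m)) =
      ∑ m, eval (fun x => eval u (t x)) (a m) * eval (fun q => (matB u n * matA u n - τ n •
      (1 : Matrix (Fin (r (n + 1))) (Fin (r (n + 1))) ℂ)) q.1 q.2) (Q m) := fun u => by
    simp only [map_sum, map_mul, ← hzB]
    refine Finset.sum_congr rfl fun m _ => ?_
    congr 1 <;> rw [← aeval_eq_eval, ← aeval_eq_eval, ← AlgHom.comp_apply, comp_aeval]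
  refine ⟨∑ m, aeval t (a m) * aeval z (Q m), ?_, fun u u' huu => ?_, fun u hu => ?_⟩
  · refine totalDegree_finsetSum_le fun m _ => (totalDegree_mul _ _).trans ?_
    have h1 := totalDegree_aeval_le (a m) ht
    have h2 := totalDegree_aeval_le (Q m) hz
    have h3 := hd m
    lia
  · rw [heval, heval, (huu n (by lia)).1, (huu n (by lia)).2]
    have : (fun x => eval u (t x)) = fun x => eval u' (t x) := by
      ext (x | x)
      · simp only [t, Sum.elim_inl]
        split_ifs with hx
        · rw [eval_X, eval_X]
          exact congrFun (congrFun (huu x.1 hx).1 x.2.1) x.2.2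
        · rfl
      · simp only [t, Sum.elim_inr]
        split_ifs with hx
        · rw [eval_X, eval_X]
          exact congrFun (congrFun (huu x.1 hx).2 x.2.1) x.2.2
        · rfl
    rw [this]
  · rw [heval, h u (fun x => eval u (t x)) hu fun i hi => htA u i hi]
    have : matA u (n + 1) * matB u (n + 1) = matB u n * matA u n - τ n •
      (1 : Matrix (Fin (r (n + 1))) (Fin (r (n + 1))) ℂ) := by
      rw [← hu n, moment, sub_sub_cancel]
    rw [this]

/-- An invariant function on a deformed fibre of the moment map which has a polynomial
representative of degree `D` comes from a polynomial of degree at most `D / 2` at the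
extremal node. -/
theorem exists_eval_mul_eq : ∀ (n : ℕ) (p : MvPolynomial (RepVar r) ℂ), DependsBelow (n + 1) p →
    (∀ u : RepVar r → ℂ,
      (∀ i, moment u i = τ i • (1 : Matrix (Fin (r (i + 1))) (Fin (r (i + 1))) ℂ)) →
      eval (fun q => (matA u 0 * matB u 0) q.1 q.2) f = eval u p) →
    ∃ q : MvPolynomial (Fin (r 0) × Fin (r 0)) ℂ, 2 * q.totalDegree ≤ p.totalDegree ∧
      ∀ u : RepVar r → ℂ,
      (∀ i, moment u i = τ i • (1 : Matrix (Fin (r (i + 1))) (Fin (r (i + 1))) ℂ)) →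
      eval (fun q => (matA u 0 * matB u 0) q.1 q.2) f =
        eval (fun q => (matA u 0 * matB u 0) q.1 q.2) q
  | 0, p, hp, hfp => by
    obtain ⟨ι, _, a, Q, hd, h⟩ := exists_sum_eval_of_dependsBelow hp hfp
    refine ⟨∑ m, eval 0 (a m) • Q m, ?_, fun u hu => ?_⟩
    · have : (∑ m, eval 0 (a m) • Q m).totalDegree ≤ p.totalDegree / 2 :=
        totalDegree_finsetSum_le fun m _ => (totalDegree_smul_le _ _).trans (by
          have := hd m
          lia)
      lia
    · rw [h u 0 hu fun i hi => absurd hi (Nat.not_lt_zero i), map_sum]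
      simp only [smul_eval]
  | n + 1, p, hp, hfp => by
    obtain ⟨p', h1, h2, h3⟩ := exists_dependsBelow hp hfp
    obtain ⟨q, hq, h⟩ := exists_eval_mul_eq n p' h2 h3
    exact ⟨q, hq.trans h1, h⟩

end Descent

end Richardson

namespace Richardson

open Module Matrix MvPolynomial

section Homogeneous

variable {σ τ R : Type*} [CommRing R]

lemma IsHomogeneous.aeval_mul {S : Type*} [CommRing S] [Algebra R S] {f : MvPolynomial σ R} {d : ℕ}
    (hf : f.IsHomogeneous d) (c : S) (g : σ → S) :
    aeval (fun i => c * g i) f = c ^ d * aeval g f := by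
  rw [aeval_def, aeval_def, eval₂_eq, eval₂_eq, Finset.mul_sum]
  refine Finset.sum_congr rfl fun m hm => ?_
  have h1 : m.degree = d := by
    rw [Finsupp.degree_eq_weight_one]
    exact hf (mem_support_iff.1 hm)
  simp only [mul_pow, Finset.prod_mul_distrib, Finset.prod_pow_eq_pow_sum]
  rw [← Finsupp.degree_apply, h1]
  ring

lemma homogeneousComponent_mul_of_mem {h m : MvPolynomial σ R} {e : ℕ} (hm : m.IsHomogeneous e)
    (d : ℕ) : homogeneousComponent (d + e) (h * m) = homogeneousComponent d h * m := by
  conv_lhs => rw [← sum_homogeneousComponent h, Finset.sum_mul, map_sum]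
  have h1 : ∀ i, homogeneousComponent (d + e) (homogeneousComponent i h * m) =
      if i = d then homogeneousComponent d h * m else 0 := fun i => by
    rw [homogeneousComponent_of_mem ((homogeneousComponent_isHomogeneous i h).mul hm)]
    by_cases hi : i = d
    · subst hi
      simp
    · rw [if_neg hi, if_neg (by lia)]
  simp only [h1]
  rw [Finset.sum_ite_eq' _ d]
  split_ifs with hd
  · rfl
  · rw [homogeneousComponent_eq_zero _ _ (by simpa using hd), zero_mul]

/-- A homogeneous element of an ideal generated by homogeneous polynomials has homogeneous
coefficients. -/
lemma exists_homogeneous_coeff {ι : Type*} [Finite ι] {m : ι → MvPolynomial σ R} {e d : ℕ}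
    (hm : ∀ i, (m i).IsHomogeneous e) {F : MvPolynomial σ R} (hF : F.IsHomogeneous (d + e))
    (h : F ∈ Ideal.span (Set.range m)) :
    ∃ (s : Finset ι) (a : ι → MvPolynomial σ R), (∀ i, (a i).IsHomogeneous d) ∧
      F = ∑ i ∈ s, a i * m i := by
  obtain ⟨c, hc⟩ := (Finsupp.mem_ideal_span_range_iff_exists_finsupp).1 h
  refine ⟨c.support, fun i => homogeneousComponent d (c i),
    fun i => homogeneousComponent_isHomogeneous _ _, ?_⟩
  have h1 := congrArg (homogeneousComponent (d + e)) hc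
  rw [homogeneousComponent_of_mem hF, if_pos rfl] at h1
  rw [← h1, Finsupp.sum, map_sum]
  exact Finset.sum_congr rfl fun i _ => homogeneousComponent_mul_of_mem (hm i) d

end Homogeneous

section Chain

variable {K : Type*} [Field K]

section Inclusion

variable {n α β : Type*} [DecidableEq n] {ι : α → n} {κ : β → n} (w : n → K)

/-- The matrix of a coordinate inclusion. -/
def inclA (K : Type*) [Field K] (ι : α → n) (κ : β → n) : Matrix α β K :=
  Matrix.of fun p q => if ι p = κ q then 1 else 0

/-- The matrix of a diagonal operator, corestricted to a coordinate subspace. -/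
def restrB (ι : α → n) (κ : β → n) : Matrix β α K :=
  Matrix.of fun q p => if κ q = ι p then w (ι p) else 0

lemma restrB_mul_inclA [Fintype α] [DecidableEq β] (hι : Function.Injective ι) (hκ : Function.Injective κ)
    (h : ∀ q, ∃ p, ι p = κ q) : restrB w ι κ * inclA K ι κ = diagonal fun q => w (κ q) := by
  ext q q'
  obtain ⟨p, hp⟩ := h q
  rw [Matrix.mul_apply, Finset.sum_eq_single p]
  · simp [restrB, inclA, diagonal_apply, hp, hκ.eq_iff]
  · intro p' _ hp'
    have : κ q ≠ ι p' := fun h => hp' (hι (by rw [← h, hp]))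
    simp [restrB, this]
  · simp

lemma inclA_mul_restrB [Fintype β] [DecidableEq α] (hι : Function.Injective ι) (hκ : Function.Injective κ)
    (h : ∀ p, (∀ q, κ q ≠ ι p) → w (ι p) = 0) :
    inclA K ι κ * restrB w ι κ = diagonal fun p => w (ι p) := by
  ext p p'
  rw [Matrix.mul_apply]
  by_cases hq : ∃ q, κ q = ι p
  · obtain ⟨q, hq⟩ := hq
    rw [Finset.sum_eq_single q]
    · by_cases hp : p = p'
      · subst hp
        simp [restrB, inclA, hq]
      · simp [restrB, inclA, hq, hι.eq_iff, hp]
    · intro q' _ hq'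
      have : ι p ≠ κ q' := fun h => hq' (hκ (by rw [← h, hq]))
      simp [inclA, this]
    · simp
  · push Not at hq
    rw [Finset.sum_eq_zero fun q _ => by simp [inclA, (hq q).symm], diagonal_apply, h p hq, ite_self]

end Inclusion

variable {r : ℕ}

/-- The coordinates spanning the `j`-th space of the chain. -/
def chainIncl (c : Fin r → ℕ) : ∀ j, Fin (chainDims c j) → Fin r
  | 0 => id
  | j + 1 => (Finset.univ.filter fun i => j + 1 ≤ c i).orderEmbOfFin rfl

lemma chainIncl_injective (c : Fin r → ℕ) : ∀ j, Function.Injective (chainIncl c j)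
  | 0 => Function.injective_id
  | j + 1 => ((Finset.univ.filter fun i => j + 1 ≤ c i).orderEmbOfFin rfl).injective

lemma exists_chainIncl_eq_iff (c : Fin r → ℕ) (j : ℕ) (i : Fin r) :
    (∃ p, chainIncl c j p = i) ↔ j ≤ c i := by
  cases j with
  | zero => exact ⟨fun _ => Nat.zero_le _, fun _ => ⟨i, rfl⟩⟩
  | succ j =>
    change i ∈ Set.range ((Finset.univ.filter fun i => j + 1 ≤ c i).orderEmbOfFin rfl) ↔ _
    rw [Finset.range_orderEmbOfFin]
    simp

/-- The orbit of a semisimple matrix consists of products at the extremal node of points of a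
deformed fibre of the moment map. -/
theorem exists_moment_eq_one (c : Fin r → ℕ) (g : SpecialLinearGroup (Fin r) K) :
    ∃ u : RepVar (chainDims c) → K,
      (∀ i, moment u i = (1 : K) • (1 : Matrix (Fin (chainDims c (i + 1)))
        (Fin (chainDims c (i + 1))) K)) ∧
      (matA u 0 * matB u 0 : Matrix (Fin r) (Fin r) K) = (g : Matrix (Fin r) (Fin r) K) *
        diagonal (fun i => (c i : K)) *
        ((g⁻¹ : SpecialLinearGroup (Fin r) K) : Matrix (Fin r) (Fin r) K) := by
  let u : RepVar (chainDims c) → K := Sum.elim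
    (fun x => inclA K (chainIncl c x.1) (chainIncl c (x.1 + 1)) x.2.1 x.2.2)
    fun x => restrB (fun i => (c i : K) - x.1) (chainIncl c x.1) (chainIncl c (x.1 + 1)) x.2.1 x.2.2
  have hA : ∀ j, matA u j = inclA K (chainIncl c j) (chainIncl c (j + 1)) := fun _ => rfl
  have hB : ∀ j, matB u j = restrB (fun i => (c i : K) - j) (chainIncl c j) (chainIncl c (j + 1)) :=
    fun _ => rfl
  have hBA : ∀ j, matB u j * matA u j = diagonal fun p => (c (chainIncl c (j + 1) p) : K) - j :=
    fun j => by
      rw [hA, hB, restrB_mul_inclA _ (chainIncl_injective c j) (chainIncl_injective c _)]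
      intro q
      rw [exists_chainIncl_eq_iff]
      exact (Nat.le_succ j).trans ((exists_chainIncl_eq_iff c (j + 1) _).1 ⟨q, rfl⟩)
  have hAB : ∀ j, matA u j * matB u j = diagonal fun p => (c (chainIncl c j p) : K) - j :=
    fun j => by
      rw [hA, hB, inclA_mul_restrB _ (chainIncl_injective c j) (chainIncl_injective c _)]
      intro p hp
      have h1 := (exists_chainIncl_eq_iff c j _).1 ⟨p, rfl⟩
      have h2 : ¬ j + 1 ≤ c (chainIncl c j p) := fun h =>
        let ⟨q, hq⟩ := (exists_chainIncl_eq_iff c (j + 1) _).2 h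
        hp q hq
      rw [show c (chainIncl c j p) = j by lia, sub_self]
  have hu : ∀ i, moment u i = (1 : K) • (1 : Matrix (Fin (chainDims c (i + 1)))
        (Fin (chainDims c (i + 1))) K) := fun i => by
    rw [moment, hBA, hAB, one_smul, ← diagonal_one, diagonal_sub]
    congr 1
    ext p
    push_cast
    ring
  let x : ∀ i, Matrix (Fin (chainDims c i)) (Fin (chainDims c i)) K
    | 0 => ((g⁻¹ : SpecialLinearGroup (Fin r) K) : Matrix (Fin r) (Fin r) K)
    | _ + 1 => 1
  let x' : ∀ i, Matrix (Fin (chainDims c i)) (Fin (chainDims c i)) K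
    | 0 => (g : Matrix (Fin r) (Fin r) K)
    | _ + 1 => 1
  have hx : ∀ i, x i * x' i = 1 := by
    rintro (_ | i)
    · exact coe_inv_mul_coe g
    · exact Matrix.mul_one 1
  refine ⟨gauge x x' u, moment_gauge_of_scalar hx hu, ?_⟩
  refine (matA_mul_matB_gauge hx u 0).trans ?_
  rw [hAB]
  simp only [Nat.cast_zero, sub_zero]
  rfl

end Chain

section Comparison

variable {r k : ℕ}

/-- On the semisimple orbit, a homogeneous polynomial which vanishes on the Richardson variety
agrees with a polynomial of smaller degree. -/
theorem exists_eval_eq_of_lower_degree {blk : Fin r → ℕ} (hblk : ∀ i, blk i < k)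
    (σ : Equiv.Perm (Fin k)) {c : Fin r → ℕ} (hσ : ∀ i, c i = (σ ⟨blk i, hblk i⟩ : Fin k))
    (hc : Antitone fun a => (Finset.univ.filter fun i => c i = a).card)
    {f : MvPolynomial (Fin r × Fin r) ℂ} {d : ℕ} (hf : f.IsHomogeneous (d + 1))
    (hO : ∀ (g : SpecialLinearGroup (Fin r) ℂ) (nm : Matrix (Fin r) (Fin r) ℂ),
      (∀ i j : Fin r, ¬ (blk i < blk j) → nm i j = 0) →
      eval (fun q => ((g : Matrix (Fin r) (Fin r) ℂ) * nm *
        ((g⁻¹ : SpecialLinearGroup (Fin r) ℂ) : Matrix (Fin r) (Fin r) ℂ)) q.1 q.2) f = 0) :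
    ∃ q : MvPolynomial (Fin r × Fin r) ℂ, q.totalDegree ≤ d ∧
      ∀ g : SpecialLinearGroup (Fin r) ℂ,
        eval (fun q => ((g : Matrix (Fin r) (Fin r) ℂ) * diagonal (fun i => (c i : ℂ)) *
          ((g⁻¹ : SpecialLinearGroup (Fin r) ℂ) : Matrix (Fin r) (Fin r) ℂ)) q.1 q.2) f =
        eval (fun q => ((g : Matrix (Fin r) (Fin r) ℂ) * diagonal (fun i => (c i : ℂ)) *
          ((g⁻¹ : SpecialLinearGroup (Fin r) ℂ) : Matrix (Fin r) (Fin r) ℂ)) q.1 q.2) q := by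
  have hck : ∀ i, c i < k := fun i => by
    rw [hσ]
    exact Fin.isLt _
  have hk : ∀ j, k ≤ j → chainDims c j = 0 := fun j hj => chainDims_eq_zero hck hj
  have := finite_repVar hk
  have := finite_momentIdx hk
  let z : Fin r × Fin r → MvPolynomial (RepVar (chainDims c)) ℂ := fun q =>
    ∑ s, X (Sum.inl ⟨0, q.1, s⟩) * X (Sum.inr ⟨0, s, q.2⟩)
  have hz : ∀ q, (z q).IsHomogeneous 2 := fun q =>
    IsHomogeneous.sum _ _ _ fun s _ => (isHomogeneous_X _ _).mul (isHomogeneous_X _ _)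
  have hF := hf.aeval z hz
  rw [show 2 * (d + 1) = 2 * d + 2 by ring] at hF
  have hFe : ∀ u : RepVar (chainDims c) → ℂ, eval u (aeval z f) =
      eval (fun q : Fin r × Fin r => (matA u 0 * matB u 0 : Matrix (Fin r) (Fin r) ℂ) q.1 q.2) f := by
    intro u
    rw [← aeval_eq_eval, ← aeval_eq_eval, ← AlgHom.comp_apply, comp_aeval]
    congr 2
    ext q
    simp only [z, aeval_eq_eval, map_sum, map_mul, eval_X]
    rfl
  have hmem := mem_span_momentPoly hk (two_mul_chainDims_le hc) hF (d := d + 1)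
    (fun e => by
      rw [← AlgHom.comp_apply, comp_aeval, ← IsHomogeneous.aeval_mul hf]
      congr 2
      ext1 q
      simp only [z, map_sum, map_mul, aeval_X, Sum.elim_inl, Sum.elim_inr, Finset.mul_sum]
      exact Finset.sum_congr rfl fun _ _ => by ring)
    fun u hu => by
      obtain ⟨g, nm, h1, h2⟩ := exists_conj_of_moment_eq_zero hblk σ hσ hc hu
      rw [hFe, h2]
      exact hO g nm h1
  obtain ⟨s, a, ha, hs⟩ := exists_homogeneous_coeff (fun j => isHomogeneous_momentPoly j) hF hmem
  let p : MvPolynomial (RepVar (chainDims c)) ℂ := ∑ j ∈ s,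
    (1 : Matrix (Fin (chainDims c (j.1 + 1))) (Fin (chainDims c (j.1 + 1))) ℂ) j.2.1 j.2.2 • a j
  have hp : p.totalDegree ≤ 2 * d := totalDegree_finsetSum_le fun j _ =>
    (totalDegree_smul_le _ _).trans (ha j).totalDegree_le
  obtain ⟨q, hq, h⟩ := exists_eval_mul_eq (r := chainDims c) (τ := fun _ => 1) (f := f) k p
    (fun u u' huu => by
      have : u = u' := by
        ext (⟨i, x⟩ | ⟨i, x⟩)
        · have hi : i < k := by
            by_contra hi
            exact absurd (x.1.2.trans_eq (hk i (not_lt.1 hi))) (Nat.not_lt_zero _)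
          exact congrFun (congrFun (huu i (by lia)).1 x.1) x.2
        · have hi : i < k := by
            by_contra hi
            exact absurd (x.2.2.trans_eq (hk i (not_lt.1 hi))) (Nat.not_lt_zero _)
          exact congrFun (congrFun (huu i (by lia)).2 x.1) x.2
      rw [this])
    fun u hu => by
      refine (hFe u).symm.trans ?_
      rw [hs, map_sum, map_sum]
      refine Finset.sum_congr rfl fun j _ => ?_
      rw [map_mul, map_momentPoly, smul_eval, mul_comm]
      simp only [eval_X]
      rw [hu, one_smul]
  refine ⟨q, Nat.le_of_mul_le_mul_left (hq.trans hp) two_pos, fun g => ?_⟩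
  obtain ⟨u, hu, hg⟩ := exists_moment_eq_one c g
  have := h u hu
  change eval (fun q : Fin r × Fin r => (matA u 0 * matB u 0 : Matrix (Fin r) (Fin r) ℂ) q.1 q.2) f =
    eval (fun q : Fin r × Fin r => (matA u 0 * matB u 0 : Matrix (Fin r) (Fin r) ℂ) q.1 q.2) q at this
  rwa [hg] at this

end Comparison

end Richardson

namespace Richardson

open Matrix MvPolynomial

section Regular

variable {r : ℕ}

/-- Evaluation of a polynomial in the matrix entries at a matrix. -/
noncomputable def evalMat (x : Matrix (Fin r) (Fin r) ℂ) :
    MvPolynomial (Fin r × Fin r) ℂ →ₐ[ℂ] ℂ :=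
  aeval fun q => x q.1 q.2

lemma evalMat_apply (x : Matrix (Fin r) (Fin r) ℂ) (p : MvPolynomial (Fin r × Fin r) ℂ) :
    evalMat x p = eval (fun q => x q.1 q.2) p := by
  rw [evalMat, aeval_eq_eval]

/-- The regular functions on the special linear group. -/
def IsRegularFun (f : Matrix.SpecialLinearGroup (Fin r) ℂ → ℂ) : Prop :=
  ∃ p : MvPolynomial (Fin r × Fin r) ℂ, ∀ g : Matrix.SpecialLinearGroup (Fin r) ℂ,
    f g = evalMat (g : Matrix (Fin r) (Fin r) ℂ) p

namespace IsRegularFun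

variable {f f' : Matrix.SpecialLinearGroup (Fin r) ℂ → ℂ}

lemma const (c : ℂ) : IsRegularFun fun _ : Matrix.SpecialLinearGroup (Fin r) ℂ => c :=
  ⟨C c, fun g => by rw [evalMat_apply, eval_C]⟩

lemma add (hf : IsRegularFun f) (hf' : IsRegularFun f') : IsRegularFun fun g => f g + f' g := by
  obtain ⟨p, hp⟩ := hf
  obtain ⟨p', hp'⟩ := hf'
  exact ⟨p + p', fun g => by simp only [map_add, hp, hp']⟩

lemma mul (hf : IsRegularFun f) (hf' : IsRegularFun f') : IsRegularFun fun g => f g * f' g := by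
  obtain ⟨p, hp⟩ := hf
  obtain ⟨p', hp'⟩ := hf'
  exact ⟨p * p', fun g => by simp only [map_mul, hp, hp']⟩

lemma sum {ι : Type*} (s : Finset ι) {f : ι → Matrix.SpecialLinearGroup (Fin r) ℂ → ℂ}
    (hf : ∀ i ∈ s, IsRegularFun (f i)) : IsRegularFun fun g => ∑ i ∈ s, f i g := by
  classical
  induction s using Finset.induction_on with
  | empty => simpa using const 0
  | insert i s hi ih =>
    simp_rw [Finset.sum_insert hi]
    exact (hf i (Finset.mem_insert_self i s)).add
      (ih fun j hj => hf j (Finset.mem_insert_of_mem hj))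

lemma coe (i j : Fin r) : IsRegularFun fun g : Matrix.SpecialLinearGroup (Fin r) ℂ =>
    (g : Matrix (Fin r) (Fin r) ℂ) i j :=
  ⟨X (i, j), fun g => by rw [evalMat_apply, eval_X]⟩

lemma coe_inv (i j : Fin r) : IsRegularFun fun g : Matrix.SpecialLinearGroup (Fin r) ℂ =>
    ((g⁻¹ : Matrix.SpecialLinearGroup (Fin r) ℂ) : Matrix (Fin r) (Fin r) ℂ) i j := by
  refine ⟨(mvPolynomialX (Fin r) (Fin r) ℂ).adjugate i j, fun g => ?_⟩
  have h := (evalMat (g : Matrix (Fin r) (Fin r) ℂ)).map_adjugate (mvPolynomialX (Fin r) (Fin r) ℂ)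
  have h1 : (evalMat (g : Matrix (Fin r) (Fin r) ℂ)).mapMatrix (mvPolynomialX (Fin r) (Fin r) ℂ) =
      (g : Matrix (Fin r) (Fin r) ℂ) := by
    ext a b
    rw [AlgHom.mapMatrix_apply, Matrix.map_apply, mvPolynomialX_apply, evalMat_apply, eval_X]
  rw [h1] at h
  exact (congrFun (congrFun (Matrix.SpecialLinearGroup.coe_inv g) i) j).trans
    (congrFun (congrFun h i) j).symm

lemma evalMat {x : Matrix.SpecialLinearGroup (Fin r) ℂ → Matrix (Fin r) (Fin r) ℂ}
    (hx : ∀ i j, IsRegularFun fun g => x g i j) (p : MvPolynomial (Fin r × Fin r) ℂ) :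
    IsRegularFun fun g => Richardson.evalMat (x g) p := by
  induction p using MvPolynomial.induction_on with
  | C a => simpa only [evalMat_apply, eval_C] using const a
  | add p q hp hq => simpa only [map_add] using hp.add hq
  | mul_X p i hp =>
    simp only [map_mul, evalMat_apply _ (X i), eval_X]
    exact hp.mul (hx _ _)

lemma comp_inv (hf : IsRegularFun f) : IsRegularFun fun g => f g⁻¹ := by
  obtain ⟨p, hp⟩ := hf
  have := evalMat (x := fun g => ((g⁻¹ : Matrix.SpecialLinearGroup (Fin r) ℂ) :
    Matrix (Fin r) (Fin r) ℂ)) coe_inv p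
  exact (funext fun g => hp g⁻¹) ▸ this

end IsRegularFun

/-- The action of the special linear group by conjugation. -/
def conjSL (g : Matrix.SpecialLinearGroup (Fin r) ℂ) (x : Matrix (Fin r) (Fin r) ℂ) :
    Matrix (Fin r) (Fin r) ℂ :=
  (g : Matrix (Fin r) (Fin r) ℂ) * x *
    ((g⁻¹ : Matrix.SpecialLinearGroup (Fin r) ℂ) : Matrix (Fin r) (Fin r) ℂ)

lemma conjSL_mul (g h : Matrix.SpecialLinearGroup (Fin r) ℂ) (x : Matrix (Fin r) (Fin r) ℂ) :
    conjSL (g * h) x = conjSL g (conjSL h x) := by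
  have h1 : ((g * h : Matrix.SpecialLinearGroup (Fin r) ℂ) : Matrix (Fin r) (Fin r) ℂ) =
      (g : Matrix (Fin r) (Fin r) ℂ) * (h : Matrix (Fin r) (Fin r) ℂ) := rfl
  have h2 : (((g * h)⁻¹ : Matrix.SpecialLinearGroup (Fin r) ℂ) : Matrix (Fin r) (Fin r) ℂ) =
      ((h⁻¹ : Matrix.SpecialLinearGroup (Fin r) ℂ) : Matrix (Fin r) (Fin r) ℂ) *
      ((g⁻¹ : Matrix.SpecialLinearGroup (Fin r) ℂ) : Matrix (Fin r) (Fin r) ℂ) :=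
    congrArg Subtype.val (mul_inv_rev g h)
  rw [conjSL, conjSL, conjSL, h1, h2]
  simp only [Matrix.mul_assoc]

lemma conjSL_inv_conjSL (g : Matrix.SpecialLinearGroup (Fin r) ℂ)
    (x : Matrix (Fin r) (Fin r) ℂ) : conjSL g⁻¹ (conjSL g x) = x := by
  rw [← conjSL_mul, inv_mul_cancel, conjSL, inv_one]
  exact (Matrix.mul_one _).trans (Matrix.one_mul _)

lemma conjSL_conjSL_inv (g : Matrix.SpecialLinearGroup (Fin r) ℂ)
    (x : Matrix (Fin r) (Fin r) ℂ) : conjSL g (conjSL g⁻¹ x) = x := by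
  simpa using conjSL_inv_conjSL g⁻¹ x

lemma conjSL_smul (g : Matrix.SpecialLinearGroup (Fin r) ℂ) (t : ℂ)
    (x : Matrix (Fin r) (Fin r) ℂ) : conjSL g (t • x) = t • conjSL g x := by
  rw [conjSL, conjSL, Matrix.mul_smul, Matrix.smul_mul]

lemma conjSL_add (g : Matrix.SpecialLinearGroup (Fin r) ℂ)
    (x y : Matrix (Fin r) (Fin r) ℂ) : conjSL g (x + y) = conjSL g x + conjSL g y := by
  rw [conjSL, conjSL, conjSL, Matrix.mul_add, Matrix.add_mul]

lemma isRegularFun_conjSL (x : Matrix (Fin r) (Fin r) ℂ) (i j : Fin r) :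
    IsRegularFun fun g => conjSL g x i j := by
  simp only [conjSL, Matrix.mul_apply]
  exact .sum _ fun b _ => (IsRegularFun.sum _ fun a _ =>
    (IsRegularFun.coe i a).mul (.const _)).mul (.coe_inv b j)

lemma isRegularFun_evalMat_conjSL (x : Matrix (Fin r) (Fin r) ℂ)
    (p : MvPolynomial (Fin r × Fin r) ℂ) : IsRegularFun fun g => evalMat (conjSL g x) p :=
  .evalMat (isRegularFun_conjSL x) p

/-- The inclusion of the special unitary group. -/
def unitaryToSL (r : ℕ) : specialUnitaryGroup (Fin r) ℂ →* Matrix.SpecialLinearGroup (Fin r) ℂ where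
  toFun u := ⟨u.1, (mem_specialUnitaryGroup_iff.1 u.2).2⟩
  map_one' := rfl
  map_mul' _ _ := rfl

lemma IsRegularFun.eq_of_unitary {f f' : Matrix.SpecialLinearGroup (Fin r) ℂ → ℂ}
    (hf : IsRegularFun f) (hf' : IsRegularFun f')
    (h : ∀ u, f (unitaryToSL r u) = f' (unitaryToSL r u)) (g) : f g = f' g := by
  obtain ⟨p, hp⟩ := hf
  obtain ⟨p', hp'⟩ := hf'
  rw [← sub_eq_zero, hp, hp', ← map_sub, evalMat_apply]
  refine eval_eq_zero_of_specialUnitary (fun u hu => ?_) g.2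
  have := h ⟨u, hu⟩
  rw [← sub_eq_zero, hp, hp', ← map_sub, evalMat_apply] at this
  exact this

lemma IsRegularFun.continuous {f : Matrix.SpecialLinearGroup (Fin r) ℂ → ℂ}
    (hf : IsRegularFun f) : Continuous fun u => f (unitaryToSL r u) := by
  obtain ⟨p, hp⟩ := hf
  simp_rw [hp, evalMat_apply]
  exact (continuous_eval p).comp (continuous_pi fun q =>
    (continuous_apply q.2).comp ((continuous_apply q.1).comp continuous_subtype_val))

end Regular

section Averaging

lemma exists_coeffwise {K σ : Type*} [TopologicalSpace K] (I : C(K, ℂ) →ₗ[ℂ] ℂ)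
    (P : MvPolynomial σ C(K, ℂ)) :
    ∃ q : MvPolynomial σ ℂ, q.totalDegree ≤ P.totalDegree ∧
      ∀ x : σ → ℂ, eval x q = I (eval (fun i => algebraMap ℂ C(K, ℂ) (x i)) P) := by
  refine ⟨∑ m ∈ P.support, monomial m (I (coeff m P)), totalDegree_finsetSum_le fun m hm => ?_,
    fun x => ?_⟩
  · refine (totalDegree_monomial_le _ _).trans ?_
    exact le_totalDegree hm
  · rw [map_sum, eval_eq, map_sum]
    refine Finset.sum_congr rfl fun m _ => ?_
    have : ∏ i ∈ m.support, (algebraMap ℂ C(K, ℂ) (x i)) ^ m i =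
        algebraMap ℂ C(K, ℂ) (∏ i ∈ m.support, x i ^ m i) := by
      simp only [map_prod, map_pow]
    rw [this, mul_comm, ← Algebra.smul_def, map_smul, eval_monomial, smul_eq_mul, mul_comm]
    rfl

variable {r N : ℕ}

/-- A representation with regular matrix coefficients. -/
def IsRational (ρ : Representation ℂ (Matrix.SpecialLinearGroup (Fin r) ℂ) (Fin N → ℂ)) : Prop :=
  ∀ w i, IsRegularFun fun g => ρ g w i

/-- The covariants: equivariant maps to the polynomials in the matrix entries. -/
def covariants (ρ : Representation ℂ (Matrix.SpecialLinearGroup (Fin r) ℂ) (Fin N → ℂ)) :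
    Submodule ℂ ((Fin N → ℂ) →ₗ[ℂ] MvPolynomial (Fin r × Fin r) ℂ) where
  carrier := {c | ∀ g w x, evalMat x (c (ρ g w)) = evalMat (conjSL g⁻¹ x) (c w)}
  add_mem' ha hb g w x := by simp [ha g w x, hb g w x]
  zero_mem' g w x := by simp
  smul_mem' a c hc g w x := by simp [hc g w x]

lemma apply_eq_sum {M : Type*} [AddCommGroup M] [Module ℂ M] (c : (Fin N → ℂ) →ₗ[ℂ] M)
    (w : Fin N → ℂ) : c w = ∑ j, w j • c (Pi.single j 1) := by
  conv_lhs => rw [pi_eq_sum_univ' w]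
  simp only [map_sum, map_smul]

lemma exists_mean_conj
    {ρ : Representation ℂ (Matrix.SpecialLinearGroup (Fin r) ℂ) (Fin N → ℂ)} (hρ : IsRational ρ)
    (I : C(specialUnitaryGroup (Fin r) ℂ, ℂ) →ₗ[ℂ] ℂ)
    (c : (Fin N → ℂ) →ₗ[ℂ] MvPolynomial (Fin r × Fin r) ℂ) {d : ℕ}
    (hc : ∀ w, (c w).totalDegree ≤ d) (j : Fin N) :
    ∃ q : MvPolynomial (Fin r × Fin r) ℂ, q.totalDegree ≤ d ∧
      ∀ x, ∃ F : C(specialUnitaryGroup (Fin r) ℂ, ℂ),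
        (∀ u, F u = evalMat (conjSL (unitaryToSL r u)⁻¹ x)
          (c (ρ (unitaryToSL r u)⁻¹ (Pi.single j 1)))) ∧ evalMat x q = I F := by
  let φ : Fin r → Fin r → C(specialUnitaryGroup (Fin r) ℂ, ℂ) := fun i j =>
    ⟨_, (IsRegularFun.coe i j).continuous⟩
  let φ' : Fin r → Fin r → C(specialUnitaryGroup (Fin r) ℂ, ℂ) := fun i j =>
    ⟨_, (IsRegularFun.coe_inv i j).continuous⟩
  let ψ : Fin N → C(specialUnitaryGroup (Fin r) ℂ, ℂ) := fun i =>
    ⟨_, (hρ (Pi.single j 1) i).comp_inv.continuous⟩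
  let L : Fin r × Fin r → MvPolynomial (Fin r × Fin r) C(specialUnitaryGroup (Fin r) ℂ, ℂ) :=
    fun q => ∑ b, (∑ a, C (φ' q.1 a) * X (a, b)) * C (φ b q.2)
  let P : MvPolynomial (Fin r × Fin r) C(specialUnitaryGroup (Fin r) ℂ, ℂ) :=
    ∑ i, C (ψ i) * aeval L (c (Pi.single i 1))
  have hL : ∀ q, (L q).totalDegree ≤ 1 := fun q => totalDegree_finsetSum_le fun b _ =>
    (totalDegree_mul _ _).trans (by
      rw [totalDegree_C, add_zero]
      exact totalDegree_finsetSum_le fun a _ => (totalDegree_mul _ _).trans (by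
        rw [totalDegree_C, zero_add]
        exact (isHomogeneous_X _ _).totalDegree_le))
  have hP : P.totalDegree ≤ d := totalDegree_finsetSum_le fun i _ =>
    (totalDegree_mul _ _).trans (by
      rw [totalDegree_C, zero_add]
      exact (totalDegree_aeval_le _ hL).trans (by rw [one_mul]; exact hc _))
  obtain ⟨q, hq, hqe⟩ := exists_coeffwise I P
  refine ⟨q, hq.trans hP, fun x => ⟨_, fun u => ?_, (evalMat_apply _ _).trans (hqe _)⟩⟩
  rw [apply_eq_sum c, map_sum, map_sum, ContinuousMap.sum_apply]
  refine Finset.sum_congr rfl fun i _ => ?_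
  rw [map_mul, eval_C, map_smul, smul_eq_mul, ContinuousMap.mul_apply]
  congr 1
  generalize c (Pi.single i 1) = p
  induction p using MvPolynomial.induction_on with
  | C a =>
    rw [aeval_C, MvPolynomial.algebraMap_apply, eval_C, evalMat_apply, eval_C]
    rfl
  | add p q hp hq => rw [map_add, map_add, map_add, ContinuousMap.add_apply, hp, hq]
  | mul_X p q hp =>
    rw [map_mul, map_mul, map_mul, ContinuousMap.mul_apply, hp, aeval_X, evalMat_apply _ (X q),
      eval_X]
    congr 1
    simp only [L, map_sum, map_mul, eval_C, eval_X, ContinuousMap.sum_apply,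
      ContinuousMap.mul_apply, conjSL, Matrix.mul_apply, inv_inv]
    rfl

theorem exists_average {ρ : Representation ℂ (Matrix.SpecialLinearGroup (Fin r) ℂ) (Fin N → ℂ)}
    (hρ : IsRational ρ) {I : C(specialUnitaryGroup (Fin r) ℂ, ℂ) →ₗ[ℂ] ℂ}
    (hI : ∀ (f f' : C(specialUnitaryGroup (Fin r) ℂ, ℂ)) (g : specialUnitaryGroup (Fin r) ℂ),
      (∀ x, f' x = f (g * x)) → I f' = I f)
    (c : (Fin N → ℂ) →ₗ[ℂ] MvPolynomial (Fin r × Fin r) ℂ) {d : ℕ}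
    (hc : ∀ w, (c w).totalDegree ≤ d) :
    ∃ y ∈ covariants ρ, (∀ w, (y w).totalDegree ≤ d) ∧
      ∀ x w, ∃ F : C(specialUnitaryGroup (Fin r) ℂ, ℂ),
        (∀ u, F u = evalMat (conjSL (unitaryToSL r u)⁻¹ x) (c (ρ (unitaryToSL r u)⁻¹ w))) ∧
        evalMat x (y w) = I F := by
  choose q hq hqe using fun j => exists_mean_conj hρ I c hc j
  let y : (Fin N → ℂ) →ₗ[ℂ] MvPolynomial (Fin r × Fin r) ℂ := (Pi.basisFun ℂ (Fin N)).constr ℂ q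
  have hy : ∀ w, y w = ∑ j, w j • q j := fun w => by simp [y, Module.Basis.constr_apply_fintype]
  choose F₀ hF₀ hF₀q using hqe
  have hcont : ∀ x w, ∃ F : C(specialUnitaryGroup (Fin r) ℂ, ℂ),
      (∀ u, F u = evalMat (conjSL (unitaryToSL r u)⁻¹ x) (c (ρ (unitaryToSL r u)⁻¹ w))) ∧
      evalMat x (y w) = I F := fun x w => by
    refine ⟨∑ j, w j • F₀ j x, fun u => ?_, ?_⟩
    · rw [ContinuousMap.sum_apply, apply_eq_sum (ρ _) w]
      simp only [map_sum, map_smul, ContinuousMap.smul_apply, hF₀]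
    · rw [hy, map_sum, map_sum]
      refine Finset.sum_congr rfl fun j _ => ?_
      rw [map_smul, map_smul, hF₀q]
  refine ⟨y, fun g w x => ?_, fun w => ?_, hcont⟩
  · refine IsRegularFun.eq_of_unitary (f := fun g => evalMat x (y (ρ g w)))
      (f' := fun g => evalMat (conjSL g⁻¹ x) (y w)) ?_
      (isRegularFun_evalMat_conjSL x (y w)).comp_inv (fun v => ?_) g
    · have : (fun g => evalMat x (y (ρ g w))) =
          fun g => ∑ j, ρ g w j * evalMat x (y (Pi.single j 1)) := by
        ext g
        rw [apply_eq_sum y (ρ g w), map_sum]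
        simp only [map_smul, smul_eq_mul]
      rw [this]
      exact IsRegularFun.sum _ fun j _ => (hρ w j).mul (IsRegularFun.const _)
    · obtain ⟨F, hF, h⟩ := hcont x (ρ (unitaryToSL r v) w)
      obtain ⟨F', hF', h'⟩ := hcont (conjSL (unitaryToSL r v)⁻¹ x) w
      rw [h, h']
      refine hI F' F v⁻¹ fun u => ?_
      have h1 : (unitaryToSL r (v⁻¹ * u))⁻¹ = (unitaryToSL r u)⁻¹ * unitaryToSL r v := by
        rw [(unitaryToSL r).map_mul, (unitaryToSL r).map_inv, _root_.mul_inv_rev, inv_inv]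
      rw [hF, hF', h1, conjSL_mul, conjSL_conjSL_inv, ρ.map_mul, Module.End.mul_apply]
  · rw [hy]
    exact totalDegree_finsetSum_le fun j _ => (totalDegree_smul_le _ _).trans (hq j)

end Averaging

end Richardson

namespace Richardson

open Matrix MvPolynomial

variable {r k : ℕ}

section Unipotent

variable {blk : Fin r → ℕ} {c : Fin r → ℂ} {nm : Matrix (Fin r) (Fin r) ℂ}

lemma exists_strictly_upper_solution (hblk : ∀ i, blk i < k)
    (hc : ∀ i j, blk i < blk j → c i ≠ c j)
    (hnm : ∀ i j, ¬ (blk i < blk j) → nm i j = 0) :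
    ∃ q : Matrix (Fin r) (Fin r) ℂ, (∀ i j, ¬ (blk i < blk j) → q i j = 0) ∧
      q * diagonal c = diagonal c * q + nm * q + nm := by
  let Φ : Matrix (Fin r) (Fin r) ℂ →ₗ[ℂ] Matrix (Fin r) (Fin r) ℂ :=
    { toFun := fun q => Matrix.of fun i j =>
        if blk i < blk j then (q * diagonal c - diagonal c * q - nm * q) i j else q i j
      map_add' := fun q q' => by
        ext i j
        simp only [of_apply, Matrix.add_apply]
        split_ifs
        · simp only [Matrix.add_mul, Matrix.mul_add, Matrix.sub_apply, Matrix.add_apply]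
          ring
        · rfl
      map_smul' := fun t q => by
        ext i j
        simp only [of_apply, Matrix.smul_apply, RingHom.id_apply]
        split_ifs
        · simp only [Matrix.smul_mul, Matrix.mul_smul, Matrix.sub_apply, Matrix.smul_apply, smul_sub]
        · rfl }
  have hΦ : ∀ q i j, Φ q i j = if blk i < blk j then
    (q * diagonal c - diagonal c * q - nm * q) i j else q i j := fun _ _ _ => rfl
  have hinj : Function.Injective Φ := by
    rw [injective_iff_map_eq_zero]
    intro q hq
    have key : ∀ m i, k - blk i = m → ∀ j, q i j = 0 := by
      intro m
      induction m using Nat.strong_induction_on with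
      | _ m ih =>
        intro i hi j
        have h := congrFun (congrFun hq i) j
        rw [hΦ] at h
        split_ifs at h with hij
        · have h0 : (nm * q) i j = 0 := by
            rw [Matrix.mul_apply]
            refine Finset.sum_eq_zero fun s _ => ?_
            by_cases hs : blk i < blk s
            · have h1 := hblk s
              rw [ih (k - blk s) (by lia) s rfl, mul_zero]
            · rw [hnm i s hs, zero_mul]
          rw [Matrix.sub_apply, Matrix.sub_apply, h0, mul_diagonal, diagonal_mul, sub_zero, mul_comm,
            ← sub_mul] at h
          exact (mul_eq_zero.1 h).resolve_left (sub_ne_zero.2 (hc i j hij).symm)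
        · exact h
    ext i j
    exact key _ i rfl j
  obtain ⟨q, hq⟩ := LinearMap.injective_iff_surjective.1 hinj nm
  have hq0 : ∀ i j, ¬ (blk i < blk j) → q i j = 0 := fun i j hij => by
    have h := congrFun (congrFun hq i) j
    rwa [hΦ, if_neg hij, hnm i j hij] at h
  refine ⟨q, hq0, ?_⟩
  ext i j
  by_cases hij : blk i < blk j
  · have h := congrFun (congrFun hq i) j
    rw [hΦ, if_pos hij, Matrix.sub_apply, Matrix.sub_apply] at h
    rw [Matrix.add_apply, Matrix.add_apply]
    linear_combination h
  · have h0 : (nm * q) i j = 0 := by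
      rw [Matrix.mul_apply]
      refine Finset.sum_eq_zero fun s _ => ?_
      by_cases hs : blk i < blk s
      · rw [hq0 s j (by lia), mul_zero]
      · rw [hnm i s hs, zero_mul]
    rw [Matrix.add_apply, Matrix.add_apply, h0, mul_diagonal, diagonal_mul, hq0 i j hij, hnm i j hij]
    ring

lemma det_one_add_eq_one {q : Matrix (Fin r) (Fin r) ℂ}
    (hq : ∀ i j, ¬ (blk i < blk j) → q i j = 0) : (1 + q).det = 1 := by
  have h1 : (1 + q).BlockTriangular blk := fun i j hij => by
    rw [Matrix.add_apply, hq i j hij.not_gt, one_apply_ne (fun h => hij.ne (by rw [h])), add_zero]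
  rw [h1.det]
  refine Finset.prod_eq_one fun a _ => ?_
  have : (1 + q).toSquareBlock blk a = 1 := by
    ext i j
    rw [toSquareBlock_def, of_apply, Matrix.add_apply, hq _ _ (by rw [i.2, j.2]; exact lt_irrefl a),
      add_zero, one_apply, one_apply]
    simp only [Subtype.ext_iff]
  rw [this, det_one]

/-- The translates of the semisimple element by the nilradical lie on its orbit. -/
theorem exists_conjSL_diagonal_eq_add (hblk : ∀ i, blk i < k)
    (hc : ∀ i j, blk i < blk j → c i ≠ c j)
    (hnm : ∀ i j, ¬ (blk i < blk j) → nm i j = 0) :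
    ∃ g : Matrix.SpecialLinearGroup (Fin r) ℂ, conjSL g (diagonal c) = diagonal c + nm := by
  obtain ⟨q, hq, h⟩ := exists_strictly_upper_solution hblk hc hnm
  let g : Matrix.SpecialLinearGroup (Fin r) ℂ := ⟨1 + q, det_one_add_eq_one hq⟩
  have hg : (g : Matrix (Fin r) (Fin r) ℂ) * diagonal c =
      (diagonal c + nm) * (g : Matrix (Fin r) (Fin r) ℂ) := by
    change (1 + q) * diagonal c = (diagonal c + nm) * (1 + q)
    rw [Matrix.add_mul, h, Matrix.one_mul, Matrix.mul_add, Matrix.mul_one, Matrix.add_mul]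
    abel
  refine ⟨g, ?_⟩
  rw [conjSL, hg, Matrix.mul_assoc, coe_mul_coe_inv, Matrix.mul_one]

end Unipotent

section Components

lemma evalMat_eq_sum {f : MvPolynomial (Fin r × Fin r) ℂ} {d : ℕ} (hf : f.totalDegree < d)
    (x : Matrix (Fin r) (Fin r) ℂ) :
    evalMat x f = ∑ e ∈ Finset.range d, evalMat x (homogeneousComponent e f) := by
  conv_lhs => rw [← sum_homogeneousComponent f]
  rw [map_sum]
  refine Finset.sum_subset (Finset.range_mono hf) fun e _ he => ?_
  rw [homogeneousComponent_eq_zero _ _ (by rw [Finset.mem_range] at he; lia), map_zero]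

lemma evalMat_smul {f : MvPolynomial (Fin r × Fin r) ℂ} {d : ℕ} (hf : f.IsHomogeneous d) (t : ℂ)
    (x : Matrix (Fin r) (Fin r) ℂ) : evalMat (t • x) f = t ^ d * evalMat x f :=
  IsHomogeneous.aeval_mul hf t fun q : Fin r × Fin r => x q.1 q.2

lemma evalMat_homogeneousComponent_eq {f f' : MvPolynomial (Fin r × Fin r) ℂ}
    {x x' : Matrix (Fin r) (Fin r) ℂ} (h : ∀ t : ℂ, evalMat (t • x) f = evalMat (t • x') f')
    (e : ℕ) : evalMat x (homogeneousComponent e f) = evalMat x' (homogeneousComponent e f') := by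
  let d := max (max f.totalDegree f'.totalDegree) e + 1
  let P : MvPolynomial (Fin r × Fin r) ℂ → Matrix (Fin r) (Fin r) ℂ → Polynomial ℂ := fun f x =>
    ∑ e ∈ Finset.range d, Polynomial.monomial e (evalMat x (homogeneousComponent e f))
  have hP : ∀ f x t, f.totalDegree < d → (P f x).eval t = evalMat (t • x) f := fun f x t hf => by
    rw [Polynomial.eval_finsetSum, evalMat_eq_sum hf]
    refine Finset.sum_congr rfl fun e _ => ?_
    rw [Polynomial.eval_monomial, evalMat_smul (homogeneousComponent_isHomogeneous e f), mul_comm]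
  have hPc : ∀ f x, (P f x).coeff e = evalMat x (homogeneousComponent e f) := fun f x => by
    rw [Polynomial.finsetSum_coeff, Finset.sum_eq_single e]
    · rw [Polynomial.coeff_monomial, if_pos rfl]
    · intro b _ hb
      rw [Polynomial.coeff_monomial, if_neg hb]
    · intro he
      exact absurd (Finset.mem_range.2 (by lia)) he
  have : P f x = P f' x' := Polynomial.funext fun t => by
    rw [hP f x t (by lia), hP f' x' t (by lia), h t]
  rw [← hPc, ← hPc, this]

/-- The top component of a polynomial vanishing on a family of parallel lines vanishes at the
common direction. -/
lemma evalMat_top_eq_zero {f : MvPolynomial (Fin r × Fin r) ℂ} {d : ℕ} (hf : f.totalDegree ≤ d)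
    {A B : Matrix (Fin r) (Fin r) ℂ} (h : ∀ t : ℂ, evalMat (A + t • B) f = 0) :
    evalMat B (homogeneousComponent d f) = 0 := by
  let Q : ℂ → ℂ := fun s => ∑ e ∈ Finset.range (d + 1),
    s ^ (d - e) * evalMat (s • A + B) (homogeneousComponent e f)
  have hcont : Continuous Q := by
    refine continuous_finsetSum _ fun e _ => (continuous_pow _).mul ?_
    simp_rw [evalMat_apply]
    refine (continuous_eval _).comp (continuous_pi fun q => ?_)
    exact (continuous_id.mul continuous_const).add continuous_const
  have hQ : Q = 0 := Continuous.ext_on (dense_compl_singleton (0 : ℂ)) hcont continuous_const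
    fun s hs => by
      have hs0 : s ≠ 0 := hs
      have h1 := h s⁻¹
      have h2 : A + s⁻¹ • B = s⁻¹ • (s • A + B) := by
        rw [smul_add, smul_smul, inv_mul_cancel₀ hs0, one_smul]
      rw [h2, evalMat_eq_sum (Nat.lt_succ_of_le hf)] at h1
      have h3 : Q s = s ^ d * 0 := by
        rw [← h1, Finset.mul_sum]
        refine Finset.sum_congr rfl fun e he => ?_
        rw [evalMat_smul (homogeneousComponent_isHomogeneous e f), ← mul_assoc]
        congr 1
        rw [inv_pow, ← div_eq_mul_inv, eq_div_iff (pow_ne_zero _ hs0), ← pow_add,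
          Nat.sub_add_cancel (Nat.lt_succ_iff.1 (Finset.mem_range.1 he))]
      rw [h3, mul_zero]
      rfl
  have h0 : Q 0 = 0 := by rw [hQ]; rfl
  rw [← h0]
  refine ((Finset.sum_eq_single d (fun e he hed => ?_) fun hd => ?_).trans ?_).symm
  · have := Finset.mem_range.1 he
    rw [zero_pow (by lia), zero_mul]
  · exact absurd (Finset.mem_range.2 (Nat.lt_succ_self d)) hd
  · rw [Nat.sub_self, pow_zero, one_mul, zero_smul, zero_add]

end Components

end Richardson

namespace Richardson

open Module

section Filtration

variable {V : Type*} [AddCommGroup V] [Module ℂ V]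

lemma finrank_map_add_finrank_inf_ker {H : Type*} [AddCommGroup H] [Module ℂ H]
    (M : Submodule ℂ V) [FiniteDimensional ℂ M] (t : V →ₗ[ℂ] H) :
    finrank ℂ (M.map t) + finrank ℂ (M ⊓ LinearMap.ker t : Submodule ℂ V) = finrank ℂ M := by
  rw [← LinearMap.finrank_range_add_finrank_ker (t.domRestrict M), LinearMap.range_domRestrict,
    LinearMap.ker_domRestrict, ← Submodule.map_comap_subtype]
  congr 1
  exact ((Submodule.equivMapOfInjective _ M.injective_subtype _).finrank_eq).symm

/-- Two subspaces of a filtered space with the same leading components meet the pieces of the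
filtration in subspaces of the same dimension. -/
theorem finrank_inf_eq_of_leading {F : ℕ → Submodule ℂ V} [∀ d, FiniteDimensional ℂ (F d)]
    (hmono : Monotone F) {t : ℕ → V →ₗ[ℂ] V} (htt : ∀ d v, t d (t d v) = t d v)
    (htF : ∀ d, ∀ v ∈ F d, t d v ∈ F d)
    (ht : ∀ d, ∀ v ∈ F (d + 1), t (d + 1) v = 0 ↔ v ∈ F d) {A B : Submodule ℂ V}
    (hA0 : F 0 ⊓ A = ⊥) (hB0 : F 0 ⊓ B = ⊥) (hA : ∀ d, ∀ v ∈ A, t d v ∈ A)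
    (hBA : ∀ d, ∀ v ∈ F (d + 1) ⊓ B, t (d + 1) v ∈ A)
    (hAB : ∀ d, ∀ v ∈ A, t (d + 1) v = v → ∃ y ∈ F d, v - y ∈ B) (d : ℕ) :
    finrank ℂ (F d ⊓ A : Submodule ℂ V) = finrank ℂ (F d ⊓ B : Submodule ℂ V) := by
  induction d with
  | zero => rw [hA0, hB0]
  | succ d ih =>
    have hfd : ∀ C : Submodule ℂ V, FiniteDimensional ℂ (F (d + 1) ⊓ C : Submodule ℂ V) :=
      fun C => inferInstance
    have hker : ∀ C : Submodule ℂ V, F (d + 1) ⊓ C ⊓ LinearMap.ker (t (d + 1)) = F d ⊓ C :=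
      fun C => by
        ext v
        refine ⟨fun h => ⟨(ht d v h.1.1).1 h.2, h.1.2⟩, fun h => ?_⟩
        have h1 := hmono (Nat.le_succ d) h.1
        exact ⟨⟨h1, h.2⟩, (ht d v h1).2 h.1⟩
    have hmap : (F (d + 1) ⊓ A).map (t (d + 1)) = (F (d + 1) ⊓ B).map (t (d + 1)) := by
      refine le_antisymm ?_ ?_
      · rintro _ ⟨v, hv, rfl⟩
        obtain ⟨y, hy, hyB⟩ := hAB d _ (hA (d + 1) v hv.2) (htt _ v)
        have hy' := hmono (Nat.le_succ d) hy
        refine ⟨_, ⟨sub_mem (htF _ v hv.1) hy', hyB⟩, ?_⟩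
        rw [map_sub, htt, (ht d y hy').2 hy, sub_zero]
      · rintro _ ⟨v, hv, rfl⟩
        exact ⟨_, ⟨htF _ v hv.1, hBA d v hv⟩, htt _ v⟩
    rw [← finrank_map_add_finrank_inf_ker _ (t (d + 1)), hker, ih, hmap, ← hker B,
      finrank_map_add_finrank_inf_ker]

lemma rank_le_of_filtration {F : ℕ → Submodule ℂ V} (hmono : Monotone F)
    (hF : ∀ v, ∃ d, v ∈ F d) [∀ d, FiniteDimensional ℂ (F d)] {H : Type*} [AddCommGroup H]
    [Module ℂ H] {φ : V →ₗ[ℂ] H} (hφ : Function.Surjective φ) {m : ℕ}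
    (hm : ∀ d, finrank ℂ ((F d).map φ) ≤ m) : Module.rank ℂ H ≤ m := by
  classical
  refine rank_le fun s hs => ?_
  choose v hv using hφ
  choose e he using hF
  let d := s.sup fun x => e (v x)
  have hsd : ∀ x ∈ s, x ∈ (F d).map φ := fun x hx =>
    ⟨v x, hmono (Finset.le_sup (f := fun x => e (v x)) hx) (he _), hv x⟩
  have hlin : LinearIndependent ℂ fun x : s => (⟨x, hsd x x.2⟩ : (F d).map φ) :=
    LinearIndependent.of_comp ((F d).map φ).subtype hs
  have := hlin.fintype_card_le_finrank
  rw [Fintype.card_coe] at this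
  exact this.trans (hm d)

theorem finrank_eq_of_filtration {F : ℕ → Submodule ℂ V} (hmono : Monotone F)
    (hF : ∀ v, ∃ d, v ∈ F d) [∀ d, FiniteDimensional ℂ (F d)] {H H' : Type*} [AddCommGroup H]
    [Module ℂ H] [AddCommGroup H'] [Module ℂ H'] [FiniteDimensional ℂ H'] {φ : V →ₗ[ℂ] H}
    (hφ : Function.Surjective φ) {ψ : V →ₗ[ℂ] H'} (hψ : Function.Surjective ψ)
    (h : ∀ d, finrank ℂ (F d ⊓ LinearMap.ker φ : Submodule ℂ V) =
      finrank ℂ (F d ⊓ LinearMap.ker ψ : Submodule ℂ V)) : finrank ℂ H = finrank ℂ H' := by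
  have heq : ∀ d, finrank ℂ ((F d).map φ) = finrank ℂ ((F d).map ψ) := fun d => by
    have h1 := finrank_map_add_finrank_inf_ker (F d) φ
    have h2 := finrank_map_add_finrank_inf_ker (F d) ψ
    have h3 := h d
    lia
  have h1 : Module.rank ℂ H ≤ finrank ℂ H' := rank_le_of_filtration hmono hF hφ fun d => by
    rw [heq]
    exact Submodule.finrank_le _
  have hfin : FiniteDimensional ℂ H :=
    Module.rank_lt_aleph0_iff.1 (h1.trans_lt (Cardinal.natCast_lt_aleph0))
  have h2 : Module.rank ℂ H' ≤ finrank ℂ H := rank_le_of_filtration hmono hF hψ fun d => by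
    rw [← heq]
    exact Submodule.finrank_le _
  rw [← finrank_eq_rank] at h1 h2
  exact le_antisymm (by exact_mod_cast h1) (by exact_mod_cast h2)

end Filtration

end Richardson

namespace Richardson

open Matrix MvPolynomial

section Approximation

variable {r N : ℕ}

lemma exists_evalMat_conjTranspose (p : MvPolynomial (Fin r × Fin r) ℂ) :
    ∃ q : MvPolynomial (Fin r × Fin r) ℂ,
      ∀ x : Matrix (Fin r) (Fin r) ℂ, evalMat x q = star (evalMat xᴴ p) := by
  induction p using MvPolynomial.induction_on with
  | C a => exact ⟨C (star a), fun x => by rw [evalMat_apply, evalMat_apply, eval_C, eval_C]⟩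
  | add p p' hp hp' =>
    obtain ⟨q, hq⟩ := hp
    obtain ⟨q', hq'⟩ := hp'
    exact ⟨q + q', fun x => by rw [map_add, map_add, hq, hq', star_add]⟩
  | mul_X p i hp =>
    obtain ⟨q, hq⟩ := hp
    refine ⟨q * X (i.2, i.1), fun x => ?_⟩
    rw [map_mul, map_mul, hq, star_mul', evalMat_apply _ (X _), evalMat_apply _ (X _), eval_X,
      eval_X, conjTranspose_apply, star_star]

lemma continuous_evalMat (p : MvPolynomial (Fin r × Fin r) ℂ) :
    Continuous fun x : Matrix (Fin r) (Fin r) ℂ => evalMat x p := by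
  simp_rw [evalMat_apply]
  exact (continuous_eval p).comp (continuous_pi fun q =>
    (continuous_apply q.2).comp (continuous_apply q.1))

/-- Continuous functions on a compact set of Hermitian matrices are uniform limits of
polynomials. -/
lemma exists_evalMat_near {X : Set (Matrix (Fin r) (Fin r) ℂ)} [CompactSpace X]
    (hX : ∀ x ∈ X, xᴴ = x) (F : C(X, ℂ)) {ε : ℝ} (hε : 0 < ε) :
    ∃ p, ∀ x : X, ‖F x - evalMat (x : Matrix (Fin r) (Fin r) ℂ) p‖ < ε := by
  let A : StarSubalgebra ℂ C(X, ℂ) :=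
    { carrier := {F | ∃ p, ∀ x : X, F x = evalMat (x : Matrix (Fin r) (Fin r) ℂ) p}
      mul_mem' := by
        rintro F F' ⟨p, hp⟩ ⟨p', hp'⟩
        exact ⟨p * p', fun x => by rw [ContinuousMap.mul_apply, hp, hp', map_mul]⟩
      add_mem' := by
        rintro F F' ⟨p, hp⟩ ⟨p', hp'⟩
        exact ⟨p + p', fun x => by rw [ContinuousMap.add_apply, hp, hp', map_add]⟩
      algebraMap_mem' := fun c => ⟨C c, fun x => by
        rw [evalMat_apply, eval_C]
        rfl⟩
      star_mem' := by
        rintro F ⟨p, hp⟩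
        obtain ⟨q, hq⟩ := exists_evalMat_conjTranspose p
        exact ⟨q, fun x => by rw [ContinuousMap.star_apply, hp, hq, hX x x.2]⟩ }
  have hsep : A.SeparatesPoints := by
    intro x y hxy
    have : ∃ i j, (x : Matrix (Fin r) (Fin r) ℂ) i j ≠ (y : Matrix (Fin r) (Fin r) ℂ) i j := by
      by_contra! h
      exact hxy (Subtype.ext (Matrix.ext h))
    obtain ⟨i, j, hij⟩ := this
    refine ⟨fun z => evalMat (z : Matrix (Fin r) (Fin r) ℂ) (MvPolynomial.X (i, j)),
      ⟨⟨_, (continuous_evalMat _).comp continuous_subtype_val⟩,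
        ⟨MvPolynomial.X (i, j), fun z => rfl⟩, rfl⟩, ?_⟩
    simpa only [evalMat_apply, eval_X] using hij
  have htop := ContinuousMap.starSubalgebra_topologicalClosure_eq_top_of_separatesPoints A hsep
  have hF : F ∈ closure (A : Set C(X, ℂ)) := by
    rw [← StarSubalgebra.topologicalClosure_coe, htop]
    exact StarSubalgebra.mem_top
  obtain ⟨F', ⟨p, hp⟩, hd⟩ := Metric.mem_closure_iff.1 hF ε hε
  refine ⟨p, fun x => ?_⟩
  rw [← hp, ← dist_eq_norm]
  exact (ContinuousMap.dist_apply_le_dist x).trans_lt hd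

lemma coe_unitaryToSL_inv (u : specialUnitaryGroup (Fin r) ℂ) :
    (((unitaryToSL r u)⁻¹ : Matrix.SpecialLinearGroup (Fin r) ℂ) : Matrix (Fin r) (Fin r) ℂ) =
      ((unitaryToSL r u : Matrix.SpecialLinearGroup (Fin r) ℂ) : Matrix (Fin r) (Fin r) ℂ)ᴴ := by
  rw [← (unitaryToSL r).map_inv]
  rfl

lemma exists_evalMat_conjSL_near {S : Matrix (Fin r) (Fin r) ℂ} (hS : Sᴴ = S)
    {f : specialUnitaryGroup (Fin r) ℂ → ℂ} (hf : Continuous f)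
    (h : ∀ u v, conjSL (unitaryToSL r u) S = conjSL (unitaryToSL r v) S → f u = f v)
    {ε : ℝ} (hε : 0 < ε) :
    ∃ p, ∀ u, ‖f u - evalMat (conjSL (unitaryToSL r u) S) p‖ < ε := by
  let m : specialUnitaryGroup (Fin r) ℂ → Matrix (Fin r) (Fin r) ℂ :=
    fun u => conjSL (unitaryToSL r u) S
  have hm : Continuous m := continuous_pi fun i => continuous_pi fun j =>
    (isRegularFun_conjSL S i j).continuous
  let π : C(specialUnitaryGroup (Fin r) ℂ, Set.range m) :=
    ⟨Set.rangeFactorization m, hm.subtype_mk _⟩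
  have : CompactSpace (Set.range m) := isCompact_iff_compactSpace.1 (isCompact_range hm)
  have hπ : Topology.IsQuotientMap π :=
    π.continuous.isClosedMap.isQuotientMap π.continuous Set.rangeFactorization_surjective
  let F : C(Set.range m, ℂ) := hπ.lift ⟨f, hf⟩ fun u v huv => h u v (congrArg Subtype.val huv)
  have hF : ∀ u, F (π u) = f u := fun u =>
    DFunLike.congr_fun (hπ.lift_comp ⟨f, hf⟩ fun u v huv => h u v (congrArg Subtype.val huv)) u
  obtain ⟨p, hp⟩ := exists_evalMat_near (X := Set.range m) (by
    rintro _ ⟨u, rfl⟩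
    simp only [m, conjSL]
    rw [coe_unitaryToSL_inv, conjTranspose_mul, conjTranspose_mul, hS, conjTranspose_conjTranspose,
      Matrix.mul_assoc]) F hε
  refine ⟨p, fun u => ?_⟩
  have := hp (π u)
  rwa [hF] at this

end Approximation

section Evaluation

variable {r N : ℕ}

/-- Evaluation of the covariants at a Hermitian matrix gives all functionals invariant under its
stabilizer. -/
theorem exists_covariant_evalMat_eq
    {ρ : Representation ℂ (Matrix.SpecialLinearGroup (Fin r) ℂ) (Fin N → ℂ)}
    (hρ : IsRational ρ) {S : Matrix (Fin r) (Fin r) ℂ} (hS : Sᴴ = S)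
    (l : (Fin N → ℂ) →ₗ[ℂ] ℂ) (hl : ∀ g, conjSL g S = S → ∀ w, l (ρ g w) = l w) :
    ∃ y ∈ covariants ρ, ∀ w, evalMat S (y w) = l w := by
  let E : ((Fin N → ℂ) →ₗ[ℂ] MvPolynomial (Fin r × Fin r) ℂ) →ₗ[ℂ] Module.Dual ℂ (Fin N → ℂ) :=
    LinearMap.compRight ℂ (evalMat S).toLinearMap
  have hE : ∀ c w, E c w = evalMat S (c w) := fun _ _ => rfl
  by_contra! hcon
  have hlE : l ∉ (covariants ρ).map E := by
    rintro ⟨y, hy, rfl⟩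
    obtain ⟨w, hw⟩ := hcon y hy
    exact hw (hE y w).symm
  obtain ⟨f, hfl, hf⟩ := Submodule.exists_le_ker_of_notMem hlE
  let w : Fin N → ℂ := (Module.evalEquiv ℂ (Fin N → ℂ)).symm f
  have hw : ∀ μ : Module.Dual ℂ (Fin N → ℂ), μ w = f μ := fun μ =>
    Module.apply_evalEquiv_symm_apply ℂ (Fin N → ℂ) μ f
  have hlw : l w ≠ 0 := by rwa [hw]
  have hyw : ∀ y ∈ covariants ρ, evalMat S (y w) = 0 := fun y hy => by
    rw [← hE, hw]
    exact hf ⟨y, hy, rfl⟩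
  obtain ⟨I, hI1, hIinv, hIn, -⟩ := exists_mean (specialUnitaryGroup (Fin r) ℂ)
  have hlreg : ∀ w, IsRegularFun fun g => l (ρ g⁻¹ w) := fun w => by
    have : (fun g => l (ρ g⁻¹ w)) = fun g => ∑ j, ρ g⁻¹ w j * l (Pi.single j 1) := by
      ext g
      rw [apply_eq_sum l]
      rfl
    rw [this]
    exact .sum _ fun j _ => (hρ w j).comp_inv.mul (.const _)
  let W : Fin N → C(specialUnitaryGroup (Fin r) ℂ, ℂ) := fun i => ⟨_, (hρ w i).continuous⟩
  have hsmall : ∀ ε : ℝ, 0 < ε → ‖l w‖ ≤ ε * ∑ i, ‖W i‖ := by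
    intro ε hε
    have happ : ∀ i : Fin N, ∃ p : MvPolynomial (Fin r × Fin r) ℂ, ∀ u,
        ‖l (ρ (unitaryToSL r u)⁻¹ (Pi.single i 1)) - evalMat (conjSL (unitaryToSL r u) S) p‖
          < ε := fun i => by
      refine exists_evalMat_conjSL_near hS (hlreg (Pi.single i 1)).continuous (fun u v huv => ?_) hε
      have h1 : conjSL ((unitaryToSL r v)⁻¹ * unitaryToSL r u) S = S := by
        rw [conjSL_mul, huv, conjSL_inv_conjSL]
      rw [← hl _ h1 (ρ (unitaryToSL r u)⁻¹ _), ← Module.End.mul_apply, ← ρ.map_mul,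
        mul_inv_cancel_right]
    choose p hp using happ
    let c : (Fin N → ℂ) →ₗ[ℂ] MvPolynomial (Fin r × Fin r) ℂ := (Pi.basisFun ℂ (Fin N)).constr ℂ p
    have hc : ∀ w, c w = ∑ j, w j • p j := fun w => by
      simp [c, Module.Basis.constr_apply_fintype]
    obtain ⟨y, hy, -, hF⟩ := exists_average hρ hIinv c (d := Finset.univ.sup fun j =>
      (p j).totalDegree) fun w => by
        rw [hc]
        exact totalDegree_finsetSum_le fun j _ => (totalDegree_smul_le _ _).trans
          (Finset.le_sup (f := fun j => (p j).totalDegree) (Finset.mem_univ j))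
    obtain ⟨F, hF, hFI⟩ := hF S w
    rw [hyw y hy] at hFI
    have hI2 : I (F - l w • 1) = - l w := by
      rw [map_sub, map_smul, hI1, ← hFI, zero_sub, smul_eq_mul, mul_one]
    rw [← norm_neg, ← hI2]
    refine (hIn _).trans ((ContinuousMap.norm_le _ (by positivity)).2 fun v => ?_)
    obtain ⟨u, rfl⟩ : ∃ u, v = u⁻¹ := ⟨v⁻¹, (inv_inv v).symm⟩
    have hv : (unitaryToSL r u⁻¹)⁻¹ = unitaryToSL r u := by
      rw [(unitaryToSL r).map_inv, inv_inv]
    have hlw2 : l w = ∑ j, ρ (unitaryToSL r u) w j *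
        l (ρ (unitaryToSL r u)⁻¹ (Pi.single j 1)) := by
      have := apply_eq_sum (l ∘ₗ ρ (unitaryToSL r u)⁻¹) (ρ (unitaryToSL r u) w)
      rw [LinearMap.comp_apply, ← Module.End.mul_apply, ← ρ.map_mul, inv_mul_cancel, ρ.map_one] at this
      exact this
    rw [ContinuousMap.sub_apply, hF, hv, hc, map_sum, ContinuousMap.smul_apply,
      ContinuousMap.one_apply, smul_eq_mul, mul_one]
    conv_lhs => rw [hlw2]
    simp only [map_smul, smul_eq_mul]
    rw [← Finset.sum_sub_distrib, Finset.mul_sum]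
    refine (norm_sum_le _ _).trans (Finset.sum_le_sum fun i _ => ?_)
    rw [← mul_sub, norm_mul, mul_comm, norm_sub_rev]
    exact mul_le_mul (hp i u).le ((W i).norm_coe_le_norm u) (norm_nonneg _) hε.le
  have hC : 0 ≤ ∑ i, ‖W i‖ := by positivity
  have hpos : 0 < ‖l w‖ := norm_pos_iff.2 hlw
  have := hsmall (‖l w‖ / (2 * (∑ i, ‖W i‖ + 1))) (by positivity)
  rw [div_mul_eq_mul_div, le_div_iff₀ (by positivity)] at this
  nlinarith

end Evaluation

end Richardson

namespace Richardson

open Matrix MvPolynomial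

section Unitarian

variable {r N : ℕ}

/-- The conjugate transpose on the special linear group. -/
def conjTransposeSL (g : Matrix.SpecialLinearGroup (Fin r) ℂ) :
    Matrix.SpecialLinearGroup (Fin r) ℂ :=
  ⟨(g : Matrix (Fin r) (Fin r) ℂ)ᴴ, by
    rw [det_conjTranspose]
    exact (congrArg star g.2).trans (star_one ℂ)⟩

lemma conjTransposeSL_conjTransposeSL (g : Matrix.SpecialLinearGroup (Fin r) ℂ) :
    conjTransposeSL (conjTransposeSL g) = g :=
  Subtype.ext (conjTranspose_conjTranspose _)

lemma conjTransposeSL_unitaryToSL (u : specialUnitaryGroup (Fin r) ℂ) :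
    conjTransposeSL (unitaryToSL r u) = (unitaryToSL r u)⁻¹ :=
  Subtype.ext (coe_unitaryToSL_inv u).symm

lemma IsRegularFun.star_conjTransposeSL {f : Matrix.SpecialLinearGroup (Fin r) ℂ → ℂ}
    (hf : IsRegularFun f) : IsRegularFun fun g => star (f (conjTransposeSL g)) := by
  obtain ⟨p, hp⟩ := hf
  obtain ⟨q, hq⟩ := exists_evalMat_conjTranspose p
  exact ⟨q, fun g => (congrArg star (hp (conjTransposeSL g))).trans (hq _).symm⟩

variable {ρ : Representation ℂ (Matrix.SpecialLinearGroup (Fin r) ℂ) (Fin N → ℂ)}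

/-- A rational representation carries a positive definite form for which the conjugate transpose
is the adjoint. -/
theorem exists_adjoint_form (hρ : IsRational ρ) :
    ∃ J : (Fin N → ℂ) →+ Module.Dual ℂ (Fin N → ℂ), (∀ (a : ℂ) v, J (a • v) = star a • J v) ∧
      (∀ v, J v v = 0 → v = 0) ∧ ∀ g v w, J (ρ (conjTransposeSL g) v) w = J v (ρ g w) := by
  obtain ⟨I, -, hIinv, -, hIpos⟩ := exists_mean (specialUnitaryGroup (Fin r) ℂ)
  let W : (Fin N → ℂ) → Fin N → C(specialUnitaryGroup (Fin r) ℂ, ℂ) :=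
    fun v i => ⟨_, (hρ v i).comp_inv.continuous⟩
  have hW : ∀ v i u, W v i u = ρ (unitaryToSL r u)⁻¹ v i := fun _ _ _ => rfl
  have hWadd : ∀ v w i, W (v + w) i = W v i + W w i := fun v w i => by
    ext u
    rw [ContinuousMap.add_apply, hW, hW, hW, map_add, Pi.add_apply]
  have hWsmul : ∀ (a : ℂ) v i, W (a • v) i = a • W v i := fun a v i => by
    ext u
    rw [ContinuousMap.smul_apply, hW, hW, map_smul, Pi.smul_apply]
  let J : (Fin N → ℂ) →+ Module.Dual ℂ (Fin N → ℂ) :=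
    { toFun := fun v =>
        { toFun := fun w => I (∑ i, star (W v i) * W w i)
          map_add' := fun w w' => by
            rw [← map_add, ← Finset.sum_add_distrib]
            simp only [hWadd, mul_add]
          map_smul' := fun a w => by
            rw [RingHom.id_apply, ← map_smul, Finset.smul_sum]
            simp only [hWsmul, mul_smul_comm] }
      map_zero' := by
        ext w
        have : ∀ i, W 0 i = 0 := fun i => by simpa using hWsmul 0 0 i
        simp [this]
      map_add' := fun v v' => by
        refine LinearMap.ext fun w => ?_
        change I _ = I _ + I _
        rw [← map_add, ← Finset.sum_add_distrib]
        simp only [hWadd, star_add, add_mul] }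
  have hJ : ∀ v w, J v w = I (∑ i, star (W v i) * W w i) := fun _ _ => rfl
  have hJs : ∀ (a : ℂ) v, J (a • v) = star a • J v := fun a v => by
    refine LinearMap.ext fun w => ?_
    rw [LinearMap.smul_apply, hJ, hJ, ← map_smul, Finset.smul_sum]
    simp only [hWsmul, star_smul, smul_mul_assoc]
  have hJl : ∀ v w, J v w = ∑ j, star (v j) * J (Pi.single j 1) w := fun v w => by
    conv_lhs => rw [pi_eq_sum_univ' v]
    simp only [map_sum, hJs, LinearMap.sum_apply, LinearMap.smul_apply, smul_eq_mul]
  refine ⟨J, hJs, fun v hv => ?_, fun g v w => ?_⟩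
  · have hre : ∀ u, ((∑ i, star (W v i) * W v i) u).re =
        ∑ i, Complex.normSq (W v i u) := fun u => by
      rw [ContinuousMap.sum_apply, Complex.re_sum]
      refine Finset.sum_congr rfl fun i _ => ?_
      rw [ContinuousMap.mul_apply, ContinuousMap.star_apply, Complex.star_def,
        ← Complex.normSq_eq_conj_mul_self, Complex.ofReal_re]
    by_contra h0
    have := hIpos (∑ i, star (W v i) * W v i) 1 (fun u => by
      rw [hre]
      exact Finset.sum_nonneg fun i _ => Complex.normSq_nonneg _) (by
      rw [hre]
      intro h
      rw [Finset.sum_eq_zero_iff_of_nonneg fun i _ => Complex.normSq_nonneg _] at h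
      refine h0 (funext fun i => ?_)
      have := h i (Finset.mem_univ i)
      rw [Complex.normSq_eq_zero, hW, (unitaryToSL r).map_one, inv_one, ρ.map_one] at this
      exact this)
    rw [← hJ, hv] at this
    exact lt_irrefl _ this
  · refine IsRegularFun.eq_of_unitary (f := fun g => J (ρ (conjTransposeSL g) v) w)
      (f' := fun g => J v (ρ g w)) ?_ ?_ (fun u => ?_) g
    · have : (fun g => J (ρ (conjTransposeSL g) v) w) =
          fun g => ∑ j, star (ρ (conjTransposeSL g) v j) * J (Pi.single j 1) w :=
        funext fun g => hJl _ _
      rw [this]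
      exact .sum _ fun j _ => (hρ v j).star_conjTransposeSL.mul (.const _)
    · have : (fun g => J v (ρ g w)) = fun g => ∑ j, ρ g w j * J v (Pi.single j 1) :=
        funext fun g => apply_eq_sum (J v) (ρ g w)
      rw [this]
      exact .sum _ fun j _ => (hρ w j).mul (.const _)
    · rw [conjTransposeSL_unitaryToSL, hJ, hJ]
      refine hIinv _ _ u fun x => ?_
      simp only [ContinuousMap.sum_apply, ContinuousMap.mul_apply, ContinuousMap.star_apply, hW]
      have h1 : ∀ v, ρ (unitaryToSL r (u * x))⁻¹ v = ρ (unitaryToSL r x)⁻¹ (ρ (unitaryToSL r u)⁻¹ v) :=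
        fun v => by
          rw [(unitaryToSL r).map_mul, _root_.mul_inv_rev, ρ.map_mul, Module.End.mul_apply]
      have h2 : ρ (unitaryToSL r u)⁻¹ (ρ (unitaryToSL r u) w) = w := by
        rw [← Module.End.mul_apply, ← ρ.map_mul, inv_mul_cancel, ρ.map_one, Module.End.one_apply]
      simp only [h1, h2]

/-- Invariant vectors and invariant functionals of a self-adjoint set of group elements have the
same dimension. -/
theorem finrank_invariants_eq (hρ : IsRational ρ) {H : Set (Matrix.SpecialLinearGroup (Fin r) ℂ)}
    (hH : ∀ g ∈ H, conjTransposeSL g ∈ H) {WH : Submodule ℂ (Fin N → ℂ)}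
    (hWH : ∀ w, w ∈ WH ↔ ∀ g ∈ H, ρ g w = w) {DH : Submodule ℂ (Module.Dual ℂ (Fin N → ℂ))}
    (hDH : ∀ l, l ∈ DH ↔ ∀ g ∈ H, ∀ w, l (ρ g w) = l w) :
    Module.finrank ℂ DH = Module.finrank ℂ WH := by
  obtain ⟨J, hJs, hJ0, hJa⟩ := exists_adjoint_form hρ
  have hinj : Function.Injective J := (injective_iff_map_eq_zero J).2 fun v hv =>
    hJ0 v (by rw [hv, LinearMap.zero_apply])
  let J' : (Fin N → ℂ) →ₗ[ℂ] Module.Dual ℂ (Fin N → ℂ) :=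
    { toFun := fun v => J (star v)
      map_add' := fun v w => by rw [star_add, map_add]
      map_smul' := fun a v => by rw [star_smul, hJs, star_star, RingHom.id_apply] }
  have hinj' : Function.Injective J' := fun v w h => star_injective (hinj h)
  have hsurj : Function.Surjective J := fun l => by
    obtain ⟨v, hv⟩ := (LinearMap.injective_iff_surjective_of_finrank_eq_finrank
      (Subspace.dual_finrank_eq (K := ℂ) (V := Fin N → ℂ)).symm).1 hinj' l
    exact ⟨star v, hv⟩
  have hmem : ∀ v, J v ∈ DH ↔ v ∈ WH := fun v => by
    rw [hDH, hWH]
    constructor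
    · intro h g hg
      refine hinj (LinearMap.ext fun w => ?_)
      rw [← conjTransposeSL_conjTransposeSL g, hJa]
      exact h _ (hH g hg) w
    · intro h g hg w
      rw [← hJa, h _ (hH g hg)]
  let j : WH →+ DH := (J.comp WH.subtype.toAddMonoidHom).codRestrict DH fun v =>
    (hmem v).2 v.2
  have hj : Function.Bijective j := by
    constructor
    · intro v w h
      exact Subtype.ext (hinj (congrArg Subtype.val h))
    · intro l
      obtain ⟨v, hv⟩ := hsurj l
      exact ⟨⟨v, (hmem v).1 (hv ▸ l.2)⟩, Subtype.ext hv⟩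
  have hrank := rank_eq_of_equiv_equiv (star : ℂ → ℂ) (AddEquiv.ofBijective j hj)
    star_involutive.bijective fun a v => Subtype.ext (hJs a v)
  rw [Module.finrank, Module.finrank, hrank]

end Unitarian

end Richardson

namespace Richardson

open Matrix MvPolynomial

section Filtration

variable {r N : ℕ}
  {ρ : Representation ℂ (Matrix.SpecialLinearGroup (Fin r) ℂ) (Fin N → ℂ)}

/-- The space of covariants. -/
def Covariant (ρ : Representation ℂ (Matrix.SpecialLinearGroup (Fin r) ℂ) (Fin N → ℂ)) : Type :=
  covariants ρ

noncomputable instance : AddCommGroup (Covariant ρ) := inferInstanceAs (AddCommGroup (covariants ρ))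

noncomputable instance : Module ℂ (Covariant ρ) := inferInstanceAs (Module ℂ (covariants ρ))

/-- The inclusion of the covariants in the linear maps. -/
noncomputable def Covariant.incl
    (ρ : Representation ℂ (Matrix.SpecialLinearGroup (Fin r) ℂ) (Fin N → ℂ)) :
    Covariant ρ →ₗ[ℂ] (Fin N → ℂ) →ₗ[ℂ] MvPolynomial (Fin r × Fin r) ℂ where
  toFun c := c.1
  map_add' _ _ := rfl
  map_smul' _ _ := rfl

/-- The covariants of bounded degree. -/
def covariantsLE (ρ : Representation ℂ (Matrix.SpecialLinearGroup (Fin r) ℂ) (Fin N → ℂ)) (d : ℕ) :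
    Submodule ℂ (Covariant ρ) where
  carrier := {c | ∀ w, (c.1 w).totalDegree ≤ d}
  add_mem' ha hb w := (totalDegree_add _ _).trans (max_le (ha w) (hb w))
  zero_mem' _ := (totalDegree_zero (R := ℂ) (σ := Fin r × Fin r)).trans_le (Nat.zero_le d)
  smul_mem' _ _ hc w := (totalDegree_smul_le _ _).trans (hc w)

lemma mem_covariantsLE {d : ℕ} {c : Covariant ρ} :
    c ∈ covariantsLE ρ d ↔ ∀ w, (c.1 w).totalDegree ≤ d := Iff.rfl

lemma covariantsLE_mono : Monotone (covariantsLE ρ) := fun _ _ h _ hc w => (hc w).trans h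

lemma exists_totalDegree_le (c : (Fin N → ℂ) →ₗ[ℂ] MvPolynomial (Fin r × Fin r) ℂ) :
    ∃ d, ∀ w, (c w).totalDegree ≤ d :=
  ⟨Finset.univ.sup fun j => (c (Pi.single j 1)).totalDegree, fun w => by
    rw [apply_eq_sum]
    exact totalDegree_finsetSum_le fun j _ => (totalDegree_smul_le _ _).trans
      (Finset.le_sup (f := fun j => (c (Pi.single j 1)).totalDegree) (Finset.mem_univ j))⟩

instance (d : ℕ) : FiniteDimensional ℂ (covariantsLE ρ d) := by
  let e : covariantsLE ρ d →ₗ[ℂ] Fin N → restrictTotalDegree (Fin r × Fin r) ℂ d :=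
    { toFun := fun c j => ⟨c.1.1 (Pi.single j 1), (mem_restrictTotalDegree _ _ _).2 (c.2 _)⟩
      map_add' := fun _ _ => rfl
      map_smul' := fun _ _ => rfl }
  refine FiniteDimensional.of_injective e fun c c' h => Subtype.ext (Subtype.ext
    (LinearMap.ext fun w => ?_))
  rw [apply_eq_sum c.1.1, apply_eq_sum c'.1.1]
  exact Finset.sum_congr rfl fun j _ => by rw [show c.1.1 (Pi.single j 1) = c'.1.1 (Pi.single j 1)
    from congrArg Subtype.val (congrFun h j)]

/-- The homogeneous component of a covariant. -/
noncomputable def covariantComponent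
    (ρ : Representation ℂ (Matrix.SpecialLinearGroup (Fin r) ℂ) (Fin N → ℂ)) (d : ℕ) :
    Covariant ρ →ₗ[ℂ] Covariant ρ where
  toFun c := ⟨homogeneousComponent d ∘ₗ c.1, fun g w x =>
    evalMat_homogeneousComponent_eq (fun t => by rw [c.2 g w, conjSL_smul]) d⟩
  map_add' c c' := Subtype.ext (LinearMap.comp_add _ _ _)
  map_smul' a c := Subtype.ext (LinearMap.comp_smul _ _ _)

lemma covariantComponent_apply (d : ℕ) (c : Covariant ρ) (w : Fin N → ℂ) :
    (covariantComponent ρ d c).1 w = homogeneousComponent d (c.1 w) := rfl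

lemma covariantComponent_eq_zero_iff {d : ℕ} {c : Covariant ρ}
    (hc : c ∈ covariantsLE ρ (d + 1)) :
    covariantComponent ρ (d + 1) c = 0 ↔ c ∈ covariantsLE ρ d := by
  constructor
  · intro h w
    have h0 : homogeneousComponent (d + 1) (c.1 w) = 0 :=
      DFunLike.congr_fun (congrArg Subtype.val h) w
    rw [← sum_homogeneousComponent (c.1 w)]
    refine totalDegree_finsetSum_le fun e he => ?_
    rcases Nat.lt_or_ge d e with hde | hde
    · have h1 := hc w
      rw [Finset.mem_range] at he
      obtain rfl : e = d + 1 := by lia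
      rw [h0, totalDegree_zero]
      exact Nat.zero_le d
    · exact (homogeneousComponent_isHomogeneous e _).totalDegree_le.trans hde
  · intro h
    refine Subtype.ext (LinearMap.ext fun w => ?_)
    exact homogeneousComponent_eq_zero _ _ (Nat.lt_succ_of_le (h w))

lemma evalMat_conjSL_covariant (c : Covariant ρ) (g : Matrix.SpecialLinearGroup (Fin r) ℂ)
    (x : Matrix (Fin r) (Fin r) ℂ) (w : Fin N → ℂ) :
    evalMat (conjSL g x) (c.1 w) = evalMat x (c.1 (ρ g⁻¹ w)) := by
  rw [c.2 g⁻¹ w x, inv_inv]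

/-- Averaging does not change values that are already equivariant. -/
lemma exists_average_eq (hρ : IsRational ρ)
    (c : (Fin N → ℂ) →ₗ[ℂ] MvPolynomial (Fin r × Fin r) ℂ) {d : ℕ}
    (hc : ∀ w, (c w).totalDegree ≤ d) :
    ∃ y ∈ covariantsLE ρ d, ∀ x w a,
      (∀ g, evalMat (conjSL g x) (c (ρ g w)) = a) → evalMat x (y.1 w) = a := by
  obtain ⟨I, hI1, hIinv, -, -⟩ := exists_mean (specialUnitaryGroup (Fin r) ℂ)
  obtain ⟨y, hy, hyd, hF⟩ := exists_average hρ hIinv c hc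
  refine ⟨⟨y, hy⟩, hyd, fun x w a ha => ?_⟩
  obtain ⟨F, hF, h⟩ := hF x w
  have : F = a • 1 := by
    ext u
    rw [hF, ha, ContinuousMap.smul_apply, ContinuousMap.one_apply, smul_eq_mul, mul_one]
  rw [h, this, map_smul, hI1, smul_eq_mul, mul_one]

end Filtration

section Count

variable {r N k : ℕ} {blk : Fin r → ℕ}
  {ρ : Representation ℂ (Matrix.SpecialLinearGroup (Fin r) ℂ) (Fin N → ℂ)}

lemma conjSL_diagonal_eq_iff {c : Fin r → ℂ} (hc : ∀ i j, c i = c j ↔ blk i = blk j)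
    (g : Matrix.SpecialLinearGroup (Fin r) ℂ) :
    conjSL g (diagonal c) = diagonal c ↔
      ∀ i j, blk i ≠ blk j → (g : Matrix (Fin r) (Fin r) ℂ) i j = 0 := by
  have h1 : conjSL g (diagonal c) = diagonal c ↔
      (g : Matrix (Fin r) (Fin r) ℂ) * diagonal c =
        diagonal c * (g : Matrix (Fin r) (Fin r) ℂ) := by
    constructor
    · intro h
      conv_rhs => rw [← h]
      rw [conjSL, Matrix.mul_assoc, coe_inv_mul_coe, Matrix.mul_one]
    · intro h
      rw [conjSL, h, Matrix.mul_assoc, coe_mul_coe_inv, Matrix.mul_one]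
  rw [h1, ← Matrix.ext_iff]
  refine forall₂_congr fun i j => ?_
  rw [mul_diagonal, diagonal_mul, mul_comm, mul_eq_mul_right_iff, eq_comm, hc]
  tauto

lemma conjTransposeSL_mem_stabilizer {S : Matrix (Fin r) (Fin r) ℂ} (hS : Sᴴ = S)
    {g : Matrix.SpecialLinearGroup (Fin r) ℂ} (hg : conjSL g S = S) :
    conjSL (conjTransposeSL g) S = S := by
  have h1 := congrArg conjTranspose hg
  rw [conjSL, conjTranspose_mul, conjTranspose_mul, hS] at h1
  have h2 : ((conjTransposeSL g)⁻¹ : Matrix.SpecialLinearGroup (Fin r) ℂ) =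
      conjTransposeSL g⁻¹ := by
    rw [inv_eq_iff_mul_eq_one]
    refine Subtype.ext ?_
    change (g : Matrix (Fin r) (Fin r) ℂ)ᴴ *
      ((g⁻¹ : Matrix.SpecialLinearGroup (Fin r) ℂ) : Matrix (Fin r) (Fin r) ℂ)ᴴ = 1
    rw [← conjTranspose_mul, coe_inv_mul_coe, conjTranspose_one]
  have h3 : S = conjSL (conjTransposeSL g)⁻¹ S := by
    rw [h2]
    conv_lhs => rw [← h1]
    have h4 : (conjTransposeSL g⁻¹)⁻¹ = conjTransposeSL g := by rw [← h2, inv_inv]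
    rw [conjSL, h4, Matrix.mul_assoc]
    rfl
  conv_lhs => rw [h3, conjSL_conjSL_inv]

/-- The equivariant maps to the functions on the saturation of the nilradical are as many as the
vectors invariant under the Levi subgroup. -/
theorem finrank_equivariant_eq (hρ : IsRational ρ) (hblk : ∀ i, blk i < k)
    {O : Set (Matrix (Fin r) (Fin r) ℂ)}
    (hO : ∀ x, x ∈ O ↔ ∃ g nm, (∀ i j, ¬ (blk i < blk j) → nm i j = 0) ∧ x = conjSL g nm)
    {M : Type*} [AddCommGroup M] [Module ℂ M] {π : MvPolynomial (Fin r × Fin r) ℂ →ₗ[ℂ] M}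
    (hπ : Function.Surjective π) (hπ0 : ∀ p, π p = 0 ↔ ∀ x ∈ O, evalMat x p = 0)
    {HomG : Submodule ℂ ((Fin N → ℂ) →ₗ[ℂ] M)}
    (hHomG : ∀ c : (Fin N → ℂ) →ₗ[ℂ] MvPolynomial (Fin r × Fin r) ℂ, π ∘ₗ c ∈ HomG ↔
      ∀ x ∈ O, ∀ g w, evalMat x (c (ρ g w)) = evalMat (conjSL g⁻¹ x) (c w))
    {WL : Submodule ℂ (Fin N → ℂ)}
    (hWL : ∀ w, w ∈ WL ↔ ∀ g : Matrix.SpecialLinearGroup (Fin r) ℂ,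
      (∀ i j, blk i ≠ blk j → (g : Matrix (Fin r) (Fin r) ℂ) i j = 0) → ρ g w = w) :
    Module.finrank ℂ HomG = Module.finrank ℂ WL := by
  obtain ⟨σ, hσ⟩ := exists_sorted_levels hblk
  let c : Fin r → ℕ := fun i => (σ ⟨blk i, hblk i⟩ : Fin k)
  have hc : ∀ i j, ((c i : ℕ) : ℂ) = (c j : ℕ) ↔ blk i = blk j := fun i j => by
    rw [Nat.cast_inj, Fin.val_inj, σ.injective.eq_iff, Fin.mk.injEq]
  let S : Matrix (Fin r) (Fin r) ℂ := diagonal fun i => (c i : ℂ)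
  have hS : Sᴴ = S := by
    rw [diagonal_conjTranspose]
    congr 1
    ext i
    simp
  have hOconj : ∀ g, ∀ x ∈ O, conjSL g x ∈ O := fun g x hx => by
    obtain ⟨h, nm, hnm, rfl⟩ := (hO x).1 hx
    exact (hO _).2 ⟨g * h, nm, hnm, (conjSL_mul _ _ _).symm⟩
  have hOsmul : ∀ t : ℂ, ∀ x ∈ O, t • x ∈ O := fun t x hx => by
    obtain ⟨h, nm, hnm, rfl⟩ := (hO x).1 hx
    refine (hO _).2 ⟨h, t • nm, fun i j hij => ?_, (conjSL_smul _ _ _).symm⟩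
    rw [Matrix.smul_apply, hnm i j hij, smul_zero]
  have h0O : (0 : Matrix (Fin r) (Fin r) ℂ) ∈ O :=
    (hO 0).2 ⟨1, 0, fun _ _ _ => rfl, by rw [conjSL, Matrix.mul_zero, Matrix.zero_mul]⟩
  let DL : Submodule ℂ (Module.Dual ℂ (Fin N → ℂ)) :=
    { carrier := {l | ∀ g, conjSL g S = S → ∀ w, l (ρ g w) = l w}
      add_mem' := fun ha hb g hg w => by
        rw [LinearMap.add_apply, LinearMap.add_apply, ha g hg, hb g hg]
      zero_mem' := fun _ _ _ => rfl
      smul_mem' := fun a l hl g hg w => by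
        rw [LinearMap.smul_apply, LinearMap.smul_apply, hl g hg] }
  have hDW : Module.finrank ℂ DL = Module.finrank ℂ WL :=
    finrank_invariants_eq hρ (H := {g | conjSL g S = S})
      (fun g hg => conjTransposeSL_mem_stabilizer hS hg)
      (fun w => (hWL w).trans (forall_congr' fun g => by
        rw [Set.mem_ofPred_eq, conjSL_diagonal_eq_iff hc]))
      fun l => Iff.rfl
  rw [← hDW]
  let φ : Covariant ρ →ₗ[ℂ] HomG :=
    ((LinearMap.compRight ℂ π).comp (Covariant.incl ρ)).codRestrict HomG fun y =>
      (hHomG y.1).2 fun x _ g w => y.2 g w x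
  let ψ : Covariant ρ →ₗ[ℂ] DL :=
    ((LinearMap.compRight ℂ (evalMat S).toLinearMap).comp (Covariant.incl ρ)).codRestrict DL
      fun y g hg w => by
        change evalMat S (y.1 (ρ g w)) = evalMat S (y.1 w)
        rw [y.2 g w S]
        conv_lhs => rw [← hg, conjSL_inv_conjSL]
  have hφ : ∀ y, y ∈ LinearMap.ker φ ↔ ∀ w, ∀ x ∈ O, evalMat x (y.1 w) = 0 := fun y => by
    rw [LinearMap.mem_ker, Subtype.ext_iff, LinearMap.ext_iff]
    exact forall_congr' fun w => hπ0 _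
  have hψ : ∀ y, y ∈ LinearMap.ker ψ ↔ ∀ w, evalMat S (y.1 w) = 0 := fun y => by
    rw [LinearMap.mem_ker, Subtype.ext_iff, LinearMap.ext_iff]
    exact Iff.rfl
  have hφs : Function.Surjective φ := fun T => by
    choose p hp using fun j : Fin N => hπ (T.1 (Pi.single j 1))
    let c₀ : (Fin N → ℂ) →ₗ[ℂ] MvPolynomial (Fin r × Fin r) ℂ :=
      (Pi.basisFun ℂ (Fin N)).constr ℂ p
    have hc₀ : ∀ w, c₀ w = ∑ j, w j • p j := fun w => by
      simp [c₀, Module.Basis.constr_apply_fintype]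
    have hT : π ∘ₗ c₀ = T.1 := LinearMap.ext fun w => by
      rw [LinearMap.comp_apply, hc₀, map_sum, apply_eq_sum T.1]
      simp only [map_smul, hp]
    have hc₀O := (hHomG c₀).1 (hT ▸ T.2)
    obtain ⟨d, hd⟩ := exists_totalDegree_le c₀
    obtain ⟨y, -, hy⟩ := exists_average_eq hρ c₀ hd
    refine ⟨y, Subtype.ext (Eq.trans (LinearMap.ext fun w => ?_) hT)⟩
    change π (y.1 w) = π (c₀ w)
    rw [← sub_eq_zero, ← map_sub, hπ0]
    intro x hx
    rw [map_sub, sub_eq_zero]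
    refine hy x w _ fun g => ?_
    rw [hc₀O _ (hOconj g x hx), conjSL_inv_conjSL]
  have hψs : Function.Surjective ψ := fun l => by
    obtain ⟨y, hy, h⟩ := exists_covariant_evalMat_eq hρ hS l.1 l.2
    exact ⟨⟨y, hy⟩, Subtype.ext (LinearMap.ext h)⟩
  have hconst : ∀ x (y : Covariant ρ), y ∈ covariantsLE ρ 0 → (∀ w, evalMat x (y.1 w) = 0) →
      y = 0 := fun x y hy h => Subtype.ext (LinearMap.ext fun w => by
    have h1 := h w
    rw [totalDegree_eq_zero_iff_eq_C.1 (Nat.le_zero.1 (hy w)), evalMat_apply, eval_C] at h1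
    rw [totalDegree_eq_zero_iff_eq_C.1 (Nat.le_zero.1 (hy w)), h1, C_0]
    rfl)
  refine finrank_eq_of_filtration (F := covariantsLE ρ) covariantsLE_mono
    (fun y => exists_totalDegree_le y.1) hφs hψs
    (finrank_inf_eq_of_leading (t := covariantComponent ρ) covariantsLE_mono ?_ ?_ ?_ ?_ ?_ ?_ ?_ ?_)
  · intro d y
    refine Subtype.ext (LinearMap.ext fun w => ?_)
    simp only [covariantComponent_apply]
    exact homogeneousComponent_of_mem (homogeneousComponent_isHomogeneous d _) |>.trans (if_pos rfl)
  · intro d y _ w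
    exact (homogeneousComponent_isHomogeneous d _).totalDegree_le
  · exact fun d y hy => covariantComponent_eq_zero_iff hy
  · rw [eq_bot_iff]
    intro y hy
    exact hconst 0 y hy.1 fun w => (hφ y).1 hy.2 w 0 h0O
  · rw [eq_bot_iff]
    intro y hy
    exact hconst S y hy.1 ((hψ y).1 hy.2)
  · intro d y hy
    rw [hφ] at hy ⊢
    intro w x hx
    have := evalMat_homogeneousComponent_eq (f := y.1 w) (f' := 0) (x := x) (x' := x) (fun t => by
      rw [hy w _ (hOsmul t x hx), map_zero]) d
    rwa [map_zero, map_zero] at this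
  · intro d y hy
    rw [hφ]
    intro w x hx
    obtain ⟨g, nm, hnm, rfl⟩ := (hO x).1 hx
    refine evalMat_top_eq_zero (A := conjSL g S) (hy.1 w) fun t => ?_
    obtain ⟨h, hh⟩ := exists_conjSL_diagonal_eq_add (nm := t • nm) (c := fun i => (c i : ℂ)) hblk
      (fun i j hij => (hc i j).not.2 hij.ne) fun i j hij => by
        rw [Matrix.smul_apply, hnm i j hij, smul_zero]
    rw [← conjSL_smul, ← conjSL_add, ← hh, ← conjSL_mul, evalMat_conjSL_covariant]
    exact (hψ y).1 hy.2 _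
  · intro d y hy hyd
    rw [hφ] at hy
    have hq : ∀ j : Fin N, ∃ q : MvPolynomial (Fin r × Fin r) ℂ, q.totalDegree ≤ d ∧
        ∀ g, evalMat (conjSL g S) (y.1 (Pi.single j 1)) = evalMat (conjSL g S) q := fun j => by
      have hom : (y.1 (Pi.single j 1)).IsHomogeneous (d + 1) := by
        have h := DFunLike.congr_fun (congrArg Subtype.val hyd) (Pi.single j (1 : ℂ))
        rw [← h]
        exact homogeneousComponent_isHomogeneous _ _
      obtain ⟨q, hq, h⟩ := exists_eval_eq_of_lower_degree hblk σ (c := c) (fun i => rfl) hσ hom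
        fun g nm hnm => by
          rw [← evalMat_apply]
          exact hy _ _ ((hO _).2 ⟨g, nm, hnm, rfl⟩)
      exact ⟨q, hq, fun g => by
        rw [evalMat_apply, evalMat_apply]
        exact h g⟩
    choose q hqd hq using hq
    let c₀ : (Fin N → ℂ) →ₗ[ℂ] MvPolynomial (Fin r × Fin r) ℂ :=
      (Pi.basisFun ℂ (Fin N)).constr ℂ q
    have hc₀ : ∀ w, c₀ w = ∑ j, w j • q j := fun w => by
      simp [c₀, Module.Basis.constr_apply_fintype]
    obtain ⟨z, hz, h⟩ := exists_average_eq hρ c₀ (d := d) fun w => by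
      rw [hc₀]
      exact totalDegree_finsetSum_le fun j _ => (totalDegree_smul_le _ _).trans (hqd j)
    refine ⟨z, hz, (hψ _).2 fun w => ?_⟩
    change evalMat S (y.1 w - z.1 w) = 0
    rw [map_sub, sub_eq_zero]
    refine (h S w _ fun g => ?_).symm
    have : evalMat (conjSL g S) (c₀ (ρ g w)) = evalMat (conjSL g S) (y.1 (ρ g w)) := by
      rw [hc₀, apply_eq_sum y.1]
      simp only [map_sum, map_smul, hq]
    rw [this, y.2, conjSL_inv_conjSL]

end Count

end Richardson

namespace Richardson

open Matrix MvPolynomial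

variable {k r N : ℕ}

lemma card_filter_succ_le_lt {d : Fin (k + 1) → ℕ} (hd0 : d 0 = 0) (hdr : d (Fin.last k) = r)
    (i : Fin r) : (Finset.univ.filter fun b : Fin k => d b.succ ≤ (i : ℕ)).card < k := by
  obtain _ | k := k
  · exact absurd (hdr.symm.trans hd0) (Nat.pos_iff_ne_zero.1 i.pos)
  · conv_rhs => rw [← Finset.card_fin (k + 1)]
    refine Finset.card_lt_card ((Finset.filter_ssubset).2 ⟨Fin.last k, Finset.mem_univ _, ?_⟩)
    rw [Fin.succ_last, hdr, not_le]
    exact i.2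

lemma isRational_of_coeff
    {ρ : Representation ℂ (Matrix.SpecialLinearGroup (Fin r) ℂ) (Fin N → ℂ)}
    (h : ∀ i j, IsRegularFun fun g => ρ g (Pi.single j 1) i) : IsRational ρ := fun w i => by
  have : (fun g => ρ g w i) = fun g => ∑ j, w j * ρ g (Pi.single j 1) i := by
    ext g
    rw [apply_eq_sum (ρ g) w, Finset.sum_apply]
    rfl
  rw [this]
  exact .sum _ fun j _ => (IsRegularFun.const _).mul (h i j)

lemma evalMat_aeval_conj (g : Matrix.SpecialLinearGroup (Fin r) ℂ) (x : Matrix (Fin r) (Fin r) ℂ)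
    (p : MvPolynomial (Fin r × Fin r) ℂ) :
    evalMat x (aeval (fun q : Fin r × Fin r => ∑ a : Fin r, ∑ b : Fin r,
      (((g⁻¹ : Matrix.SpecialLinearGroup (Fin r) ℂ) : Matrix (Fin r) (Fin r) ℂ) q.1 a
        * (g : Matrix (Fin r) (Fin r) ℂ) b q.2)
        • (X (a, b) : MvPolynomial (Fin r × Fin r) ℂ)) p) = evalMat (conjSL g⁻¹ x) p := by
  rw [← AlgHom.comp_apply]
  refine DFunLike.congr_fun (algHom_ext fun q => ?_) p
  rw [AlgHom.comp_apply, aeval_X, map_sum, evalMat_apply _ (X q), eval_X, conjSL, inv_inv,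
    Matrix.mul_apply]
  simp only [map_sum, map_smul, smul_eq_mul, evalMat_apply, eval_X, Matrix.mul_apply,
    Finset.sum_mul]
  rw [Finset.sum_comm]
  refine Finset.sum_congr rfl fun b _ => Finset.sum_congr rfl fun a _ => ?_
  ring

end Richardson

open scoped Classical

/-- Let `G = SL_r(ℂ)`, `P` the parabolic of block upper triangular
matrices for the dimension sequence `0 = d₀ < ⋯ < d_k = r`, with Levi subgroup `L`
(block diagonal matrices) and nilradical `rad 𝔭` (strictly block upper triangular
matrices).  Let `O_𝔭 = G · rad 𝔭` (the closure of the Richardson nilpotent orbit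
associated to `P`) and let `ℂ[O_𝔭]` be its coordinate ring, the quotient of the
polynomial ring on matrix entries by the vanishing ideal `I` of `O_𝔭`, with `G`
acting by `(g·f)(x) = f(g⁻¹xg)`.  Then, as a `G`-module, `ℂ[O_𝔭]` decomposes so that
the multiplicity `dim Hom_G(W, ℂ[O_𝔭])` of every irreducible finite-dimensional
(rational) `G`-module `W` equals `dim W^L`. -/
theorem stmt10 (k r : ℕ) (d : Fin (k + 1) → ℕ) (hd : StrictMono d)
    (hd0 : d 0 = 0) (hdr : d (Fin.last k) = r)
    (blk : Fin r → ℕ)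
    (hblk : ∀ i : Fin r,
      blk i = (Finset.univ.filter (fun b : Fin k => d b.succ ≤ (i : ℕ))).card)
    -- the saturation `O_𝔭 = G · rad 𝔭`, the closure of the Richardson orbit
    (O : Set (Matrix (Fin r) (Fin r) ℂ))
    (hO : O = {x : Matrix (Fin r) (Fin r) ℂ |
      ∃ g : Matrix.SpecialLinearGroup (Fin r) ℂ,
      ∃ nm : Matrix (Fin r) (Fin r) ℂ,
        (∀ i j : Fin r, ¬ (blk i < blk j) → nm i j = 0) ∧
        x = (g : Matrix (Fin r) (Fin r) ℂ) * nm * ((g⁻¹ : Matrix.SpecialLinearGroup (Fin r) ℂ) : Matrix (Fin r) (Fin r) ℂ)})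
    -- the vanishing ideal of `O_𝔭` and the coordinate ring `ℂ[O_𝔭]`
    (I : Ideal (MvPolynomial (Fin r × Fin r) ℂ))
    (hI : ∀ p : MvPolynomial (Fin r × Fin r) ℂ,
      p ∈ I ↔ ∀ x ∈ O, MvPolynomial.eval (fun q => x q.1 q.2) p = 0)
    -- the `G`-action on `ℂ[O_𝔭]`, induced by `(g·f)(x) = f(g⁻¹xg)`
    (act : Matrix.SpecialLinearGroup (Fin r) ℂ →
      ((MvPolynomial (Fin r × Fin r) ℂ ⧸ I) →ₗ[ℂ] (MvPolynomial (Fin r × Fin r) ℂ ⧸ I)))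
    (hact : ∀ (g : Matrix.SpecialLinearGroup (Fin r) ℂ)
        (p : MvPolynomial (Fin r × Fin r) ℂ),
      act g (Ideal.Quotient.mk I p) = Ideal.Quotient.mk I
        (MvPolynomial.aeval (fun q : Fin r × Fin r =>
          ∑ a : Fin r, ∑ b : Fin r,
            (((g⁻¹ : Matrix.SpecialLinearGroup (Fin r) ℂ) : Matrix (Fin r) (Fin r) ℂ) q.1 a
              * (g : Matrix (Fin r) (Fin r) ℂ) b q.2)
              • (MvPolynomial.X (a, b) : MvPolynomial (Fin r × Fin r) ℂ)) p))
    -- an irreducible rational representation `W` of `G`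
    (N : ℕ) (ρ : Representation ℂ (Matrix.SpecialLinearGroup (Fin r) ℂ) (Fin N → ℂ))
    (hrat : ∀ i j : Fin N, ∃ p : MvPolynomial (Fin r × Fin r) ℂ,
      ∀ g : Matrix.SpecialLinearGroup (Fin r) ℂ,
        ρ g (Pi.single j 1) i
          = MvPolynomial.eval (fun q => (g : Matrix (Fin r) (Fin r) ℂ) q.1 q.2) p)
    (hirr : ∀ U : Submodule ℂ (Fin N → ℂ),
      (∀ g : Matrix.SpecialLinearGroup (Fin r) ℂ, ∀ w ∈ U, ρ g w ∈ U) →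
      U = ⊥ ∨ U = ⊤)
    -- the `L`-invariants of `W`
    (WL : Submodule ℂ (Fin N → ℂ))
    (hWL : ∀ w : Fin N → ℂ, w ∈ WL ↔
      ∀ g : Matrix.SpecialLinearGroup (Fin r) ℂ,
        (∀ i j : Fin r, blk i ≠ blk j → (g : Matrix (Fin r) (Fin r) ℂ) i j = 0) →
        ρ g w = w)
    -- the space `Hom_G(W, ℂ[O_𝔭])` of equivariant maps
    (HomG : Submodule ℂ ((Fin N → ℂ) →ₗ[ℂ] (MvPolynomial (Fin r × Fin r) ℂ ⧸ I)))
    (hHomG : ∀ T : (Fin N → ℂ) →ₗ[ℂ] (MvPolynomial (Fin r × Fin r) ℂ ⧸ I),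
      T ∈ HomG ↔ ∀ (g : Matrix.SpecialLinearGroup (Fin r) ℂ) (w : Fin N → ℂ),
        T (ρ g w) = act g (T w)) :
    Module.finrank ℂ HomG = Module.finrank ℂ WL := by
  have hρ : Richardson.IsRational ρ := Richardson.isRational_of_coeff fun i j => by
    obtain ⟨p, hp⟩ := hrat i j
    exact ⟨p, fun g => (hp g).trans (Richardson.evalMat_apply _ p).symm⟩
  have hmk : ∀ p, Ideal.Quotient.mk I p = 0 ↔ ∀ x ∈ O, Richardson.evalMat x p = 0 := fun p => by
    simp only [Ideal.Quotient.eq_zero_iff_mem, hI, Richardson.evalMat_apply]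
  refine Richardson.finrank_equivariant_eq (O := O) (π := (Ideal.Quotient.mkₐ ℂ I).toLinearMap) hρ
    (fun i => (hblk i).trans_lt (Richardson.card_filter_succ_le_lt hd0 hdr i))
    (fun x => by rw [hO]; rfl) Ideal.Quotient.mk_surjective hmk (fun c => ?_) hWL
  rw [hHomG]
  have h : ∀ g w, Ideal.Quotient.mk I (c (ρ g w)) = act g (Ideal.Quotient.mk I (c w)) ↔
      ∀ x ∈ O, Richardson.evalMat x (c (ρ g w)) =
        Richardson.evalMat (Richardson.conjSL g⁻¹ x) (c w) := fun g w => by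
    rw [hact, ← sub_eq_zero, ← map_sub, hmk]
    simp only [map_sub, Richardson.evalMat_aeval_conj, sub_eq_zero]
  refine (forall₂_congr h).trans ⟨fun h x hx g w => h g w x hx, fun h g w x hx => h x hx g w⟩
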